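/- Let d ≥ 2, and suppose that the coordinates of α = (α_1, …, α_d) ∈ ℝ^d are algebraic numbers that are linearly independent over ℚ. Then for every starting point s ∈ [0,1]^d there is a constant C depending only on α such that sup_{R ∈ 𝓡} |Δ_T(s, α, R)| ≤ C for all T > 0, where 𝓡 denotes the family of axis-parallel boxes R = ∏_{k=1}^d [a_k, b_k] ⊆ [0,1]^d. -/

import Mathlib

section

open MeasureTheory Real

/-- `Δ_T(s, α, A) = ∫_0^T χ_A({s+tα}) dt - T·λ(A)` for `A ⊆ [0,1]^d`. -/
noncomputable def Delta {d : ℕ} (s α : Fin d → ℝ) (A : Set (Fin d → ℝ)) (T : ℝ) : ℝ :=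
  (∫ t in (0:ℝ)..T, Set.indicator A (fun _ => (1:ℝ)) (fun i => Int.fract (s i + t * α i)))
    - T * (volume A).toReal

end

section

open MvPolynomial

/-- All monomials of `P` have weight at least `c`. -/
def OrdGE {σ R : Type*} [CommSemiring R] (w : σ → ℝ) (c : ℝ) (P : MvPolynomial σ R) : Prop :=
  ∀ m, P.coeff m ≠ 0 → c ≤ Finsupp.weight w m

namespace OrdGE
variable {σ τ R S ι : Type*} [CommSemiring R] [CommSemiring S] {w : σ → ℝ} {c c' : ℝ}
  {P Q : MvPolynomial σ R}

theorem mono (h : OrdGE w c P) (hc : c' ≤ c) : OrdGE w c' P := fun m hm => hc.trans (h m hm)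

theorem zero : OrdGE w c (0 : MvPolynomial σ R) := fun m hm => by simp at hm

theorem add (hP : OrdGE w c P) (hQ : OrdGE w c Q) : OrdGE w c (P + Q) := by
  intro m hm
  by_cases h : P.coeff m = 0
  · exact hQ m (by simpa [h] using hm)
  · exact hP m h

theorem sum {s : Finset ι} {f : ι → MvPolynomial σ R} (h : ∀ i ∈ s, OrdGE w c (f i)) :
    OrdGE w c (∑ i ∈ s, f i) := by
  classical
  induction s using Finset.induction_on with
  | empty => simpa using zero
  | insert a s ha ih =>
    rw [Finset.sum_insert ha]
    exact (h a (by simp)).add (ih fun i hi => h i (by simp [hi]))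

theorem mul (hP : OrdGE w c P) (hQ : OrdGE w c' Q) : OrdGE w (c + c') (P * Q) := by
  classical
  intro m hm
  rw [coeff_mul] at hm
  obtain ⟨x, hx, hx0⟩ := Finset.exists_ne_zero_of_sum_ne_zero hm
  rw [Finset.HasAntidiagonal.mem_antidiagonal] at hx
  rw [← hx, map_add]
  exact add_le_add (hP _ (left_ne_zero_of_mul hx0)) (hQ _ (right_ne_zero_of_mul hx0))

theorem const (hc : c ≤ 0) (a : R) : OrdGE w c (C a) := by
  classical
  intro m hm
  rw [coeff_C] at hm
  have : m = 0 := by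
    by_contra h
    exact hm (if_neg (Ne.symm h))
  simpa [this] using hc

theorem X {s : σ} (hc : c ≤ w s) : OrdGE w c (X s : MvPolynomial σ R) := by
  classical
  intro m hm
  rw [coeff_X] at hm
  have : Finsupp.single s 1 = m := by
    by_contra h
    exact hm (if_neg h)
  simpa [← this, Finsupp.weight_apply] using hc

theorem prod {s : Finset ι} {f : ι → MvPolynomial σ R} {d : ι → ℝ}
    (h : ∀ i ∈ s, OrdGE w (d i) (f i)) : OrdGE w (∑ i ∈ s, d i) (∏ i ∈ s, f i) := by
  classical
  induction s using Finset.induction_on with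
  | empty => simpa using const (σ := σ) (R := R) (w := w) le_rfl 1
  | insert a s ha ih =>
    rw [Finset.sum_insert ha, Finset.prod_insert ha]
    exact (h a (by simp)).mul (ih fun i hi => h i (by simp [hi]))

theorem pow (h : OrdGE w c P) (n : ℕ) : OrdGE w (n * c) (P ^ n) := by
  have := prod (s := Finset.range n) (f := fun _ => P) (d := fun _ => c) (w := w) fun _ _ => h
  simpa using this

theorem eval₂ {w' : τ → ℝ} (h : OrdGE w c P) (g : R →+* MvPolynomial τ S)
    (hg : ∀ a, OrdGE w' 0 (g a)) (f : σ → MvPolynomial τ S) (hf : ∀ s, OrdGE w' (w s) (f s)) :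
    OrdGE w' c (P.eval₂ g f) := by
  rw [MvPolynomial.eval₂_eq]
  refine sum fun m hm => ?_
  have h1 := h m (by simpa using hm)
  have h2 : OrdGE w' (∑ i ∈ m.support, (m i : ℝ) * w i) (∏ i ∈ m.support, f i ^ m i) :=
    prod fun i _ => (hf i).pow _
  refine ((hg _).mul h2).mono ?_
  rw [Finsupp.weight_apply, Finsupp.sum] at h1
  simpa using h1

theorem aeval {w' : τ → ℝ} [Algebra R S] (h : OrdGE w c P) (f : σ → MvPolynomial τ S)
    (hf : ∀ s, OrdGE w' (w s) (f s)) : OrdGE w' c (aeval f P) := by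
  rw [MvPolynomial.aeval_def]
  refine h.eval₂ _ (fun a => ?_) f hf
  rw [MvPolynomial.algebraMap_apply]
  exact const le_rfl _

theorem map (h : OrdGE w c P) (g : R →+* S) : OrdGE w c (MvPolynomial.map g P) := by
  intro m hm
  rw [coeff_map] at hm
  exact h m fun h0 => hm (by simp [h0])
end OrdGE

/-- The sum of the sizes of the coefficients. -/
noncomputable def l1 {σ R : Type*} [CommRing R] (ν : RingSeminorm R) (P : MvPolynomial σ R) : ℝ :=
  ∑ m ∈ P.support, ν (P.coeff m)

section l1
variable {σ τ R S ι : Type*} [CommRing R] [CommRing S] {ν : RingSeminorm R}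

theorem l1_eq_of_subset (P : MvPolynomial σ R) {s : Finset (σ →₀ ℕ)} (h : P.support ⊆ s) :
    l1 ν P = ∑ m ∈ s, ν (P.coeff m) :=
  Finset.sum_subset h fun m _ hm => by rw [notMem_support_iff.1 hm, map_zero]

theorem l1_nonneg (P : MvPolynomial σ R) : 0 ≤ l1 ν P :=
  Finset.sum_nonneg fun _ _ => apply_nonneg ν _

theorem coeff_le_l1 (P : MvPolynomial σ R) (m : σ →₀ ℕ) : ν (P.coeff m) ≤ l1 ν P := by
  by_cases h : m ∈ P.support
  · exact Finset.single_le_sum (f := fun m => ν (P.coeff m)) (fun _ _ => apply_nonneg ν _) h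
  · rw [notMem_support_iff.1 h, map_zero]; exact l1_nonneg P

theorem l1_zero : l1 ν (0 : MvPolynomial σ R) = 0 := by simp [l1]

theorem l1_add (P Q : MvPolynomial σ R) : l1 ν (P + Q) ≤ l1 ν P + l1 ν Q := by
  classical
  rw [l1_eq_of_subset (P + Q) (support_add), l1_eq_of_subset P (Finset.subset_union_left),
    l1_eq_of_subset Q (Finset.subset_union_right), ← Finset.sum_add_distrib]
  exact Finset.sum_le_sum fun m _ => by rw [coeff_add]; exact map_add_le_add ν _ _

theorem l1_sum (s : Finset ι) (f : ι → MvPolynomial σ R) :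
    l1 ν (∑ i ∈ s, f i) ≤ ∑ i ∈ s, l1 ν (f i) := by
  classical
  induction s using Finset.induction_on with
  | empty => simp [l1_zero]
  | insert a s ha ih =>
    rw [Finset.sum_insert ha, Finset.sum_insert ha]
    exact (l1_add _ _).trans (by gcongr)

theorem l1_monomial_le (m : σ →₀ ℕ) (a : R) : l1 ν (monomial m a) ≤ ν a := by
  classical
  rw [l1_eq_of_subset _ support_monomial_subset]
  simp

theorem l1_C_le (a : R) : l1 ν (C a : MvPolynomial σ R) ≤ ν a := l1_monomial_le 0 a

theorem l1_mul (P Q : MvPolynomial σ R) : l1 ν (P * Q) ≤ l1 ν P * l1 ν Q := by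
  classical
  have : P * Q = ∑ m ∈ P.support, ∑ m' ∈ Q.support,
      monomial (m + m') (P.coeff m * Q.coeff m') := by
    conv_lhs => rw [P.as_sum, Q.as_sum]
    rw [Finset.sum_mul_sum]
    simp [monomial_mul]
  rw [this, show l1 ν P * l1 ν Q = _ from Finset.sum_mul_sum _ _ _ _]
  refine (l1_sum _ _).trans (Finset.sum_le_sum fun m _ => (l1_sum _ _).trans
    (Finset.sum_le_sum fun m' _ => (l1_monomial_le _ _).trans (map_mul_le_mul ν _ _)))

theorem l1_prod (h1 : ν 1 ≤ 1) (s : Finset ι) (f : ι → MvPolynomial σ R) :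
    l1 ν (∏ i ∈ s, f i) ≤ ∏ i ∈ s, l1 ν (f i) := by
  classical
  induction s using Finset.induction_on with
  | empty => simpa using (l1_C_le (σ := σ) (1 : R)).trans h1
  | insert a s ha ih =>
    rw [Finset.prod_insert ha, Finset.prod_insert ha]
    exact (l1_mul _ _).trans (mul_le_mul_of_nonneg_left ih (l1_nonneg _))

theorem l1_pow (h1 : ν 1 ≤ 1) (P : MvPolynomial σ R) (n : ℕ) : l1 ν (P ^ n) ≤ l1 ν P ^ n := by
  simpa using l1_prod h1 (Finset.range n) fun _ => P

theorem l1_neg (P : MvPolynomial σ R) : l1 ν (-P) = l1 ν P := by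
  simp [l1, support_neg]

theorem l1_eval₂_le {μ : RingSeminorm S} (h1 : μ 1 ≤ 1) (g : R →+* S)
    (f : σ → MvPolynomial τ S) (P : MvPolynomial σ R) :
    l1 μ (P.eval₂ (C.comp g) f) ≤
      ∑ m ∈ P.support, μ (g (P.coeff m)) * ∏ i ∈ m.support, l1 μ (f i) ^ m i := by
  rw [eval₂_eq]
  refine (l1_sum _ _).trans (Finset.sum_le_sum fun m _ => (l1_mul _ _).trans ?_)
  refine mul_le_mul (l1_C_le _) ?_ (l1_nonneg _) (apply_nonneg _ _)
  exact (l1_prod h1 _ _).trans (Finset.prod_le_prod (fun _ _ => l1_nonneg _) fun i _ => l1_pow h1 _ _)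
end l1

/-- The absolute value as a ring seminorm on the integers. -/
noncomputable abbrev zNorm : RingSeminorm ℤ := normRingSeminorm ℤ

theorem one_le_l1 {σ : Type*} {P : MvPolynomial σ ℤ} (h : P ≠ 0) : 1 ≤ l1 zNorm P := by
  obtain ⟨m, hm⟩ := ne_zero_iff.1 h
  refine le_trans ?_ (coeff_le_l1 P m)
  change (1 : ℝ) ≤ ‖P.coeff m‖
  rw [Int.norm_eq_abs]
  exact_mod_cast Int.one_le_abs hm

theorem zNorm_one : zNorm 1 ≤ 1 := (norm_one (α := ℤ)).le

end

section

open MvPolynomial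

/-- The Hasse derivative `(1/I!) ∂^I`. -/
noncomputable def hasse {σ R : Type*} [Fintype σ] [CommRing R] (I : σ →₀ ℕ) :
    MvPolynomial σ R →ₗ[R] MvPolynomial σ R :=
  (basisMonomials σ R).constr R fun m => monomial (m - I) (∏ s, ((m s).choose (I s) : R))

/-- Translation of the variables by `β`. -/
noncomputable def shift {σ R : Type*} [CommRing R] (β : σ → R) :
    MvPolynomial σ R →ₐ[R] MvPolynomial σ R :=
  aeval fun s => X s + C (β s)

theorem finsupp_induction_single {σ : Type*} {p : (σ →₀ ℕ) → Prop} (I : σ →₀ ℕ) (h0 : p 0)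
    (hadd : ∀ I s, p I → p (I + Finsupp.single s 1)) : p I := by
  suffices h : ∀ J, p J → p (J + I) by simpa using h 0 h0
  induction I using Finsupp.induction_linear with
  | zero => simp
  | add f g hf hg => intro J hJ; rw [← add_assoc]; exact hg _ (hf _ hJ)
  | single s n =>
    induction n with
    | zero => simp
    | succ n ih =>
      intro J hJ
      rw [Finsupp.single_add, ← add_assoc]
      exact hadd _ _ (ih _ hJ)

theorem pderiv_shift {σ R : Type*} [CommRing R] (β : σ → R) (s : σ) (P : MvPolynomial σ R) :
    pderiv s (shift β P) = shift β (pderiv s P) := by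
  classical
  induction P using MvPolynomial.induction_on with
  | C a => simp [shift]
  | add p q hp hq => rw [map_add, map_add, hp, hq, map_add, map_add]
  | mul_X p t hp =>
    rw [map_mul, pderiv_mul, hp, pderiv_mul, map_add, map_mul, map_mul]
    congr 2
    simp only [shift, aeval_X, map_add, pderiv_C, add_zero, pderiv_X]
    by_cases h : s = t
    · subst h; simp
    · simp [h]

section hasse
variable {σ R : Type*} [Fintype σ] [CommRing R]

theorem hasse_monomial (I m : σ →₀ ℕ) (a : R) :
    hasse I (monomial m a) = monomial (m - I) (a * ∏ s, ((m s).choose (I s) : R)) := by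
  have : monomial m a = a • (basisMonomials σ R) m := by
    simp [coe_basisMonomials, smul_monomial]
  rw [this, map_smul, hasse, Module.Basis.constr_basis, smul_monomial, smul_eq_mul]

theorem prod_choose_eq_zero {I m : σ →₀ ℕ} (h : ¬ I ≤ m) :
    ∏ s, ((m s).choose (I s) : R) = 0 := by
  rw [Finsupp.le_def] at h
  push Not at h
  obtain ⟨s, hs⟩ := h
  exact Finset.prod_eq_zero (Finset.mem_univ s) (by rw [Nat.choose_eq_zero_of_lt hs, Nat.cast_zero])

theorem hasse_zero (P : MvPolynomial σ R) : hasse 0 P = P := by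
  induction P using MvPolynomial.induction_on' with
  | monomial m a => rw [hasse_monomial]; simp
  | add p q hp hq => rw [map_add, hp, hq]

theorem pderiv_hasse (s : σ) (I : σ →₀ ℕ) (P : MvPolynomial σ R) :
    pderiv s (hasse I P) = ((I s + 1 : ℕ) : R) • hasse (I + Finsupp.single s 1) P := by
  classical
  induction P using MvPolynomial.induction_on' with
  | add p q hp hq => rw [map_add, map_add, hp, hq, map_add, smul_add]
  | monomial m a =>
    rw [hasse_monomial, hasse_monomial, pderiv_monomial, smul_monomial, smul_eq_mul, tsub_tsub]
    congr 1
    rw [← Finset.mul_prod_erase Finset.univ _ (Finset.mem_univ s),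
      ← Finset.mul_prod_erase Finset.univ (fun t => ((m t).choose ((I + Finsupp.single s 1 : σ →₀ ℕ) t) : R))
        (Finset.mem_univ s)]
    have h1 : ∏ x ∈ Finset.univ.erase s, ((m x).choose ((I + Finsupp.single s 1 : σ →₀ ℕ) x) : R)
        = ∏ x ∈ Finset.univ.erase s, ((m x).choose (I x) : R) := by
      refine Finset.prod_congr rfl fun x hx => ?_
      rw [Finsupp.add_apply, Finsupp.single_eq_of_ne (Finset.ne_of_mem_erase hx), add_zero]
    rw [h1]
    have h2 : ((m s).choose (I s + 1) : R) * ((I s + 1 : ℕ) : R)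
        = ((m s).choose (I s) : R) * ((m s - I s : ℕ) : R) := by
      exact_mod_cast congrArg (Nat.cast (R := R)) (Nat.choose_succ_right_eq (m s) (I s))
    simp only [Finsupp.tsub_apply, Finsupp.add_apply, Finsupp.single_eq_same]
    linear_combination a * (∏ x ∈ Finset.univ.erase s, ((m x).choose (I x) : R)) * (-h2)

theorem constantCoeff_hasse (I : σ →₀ ℕ) (P : MvPolynomial σ R) :
    constantCoeff (hasse I P) = P.coeff I := by
  classical
  induction P using MvPolynomial.induction_on' with
  | add p q hp hq => rw [map_add, map_add, hp, hq, coeff_add]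
  | monomial m a =>
    rw [hasse_monomial, constantCoeff_eq, coeff_monomial, coeff_monomial]
    by_cases h : m = I
    · subst h; simp
    · rw [if_neg h]
      by_cases hle : I ≤ m
      · rw [if_neg]
        intro h0
        exact h (le_antisymm (tsub_eq_zero_iff_le.1 h0) hle)
      · rw [prod_choose_eq_zero hle]; simp

theorem hasse_shift [IsDomain R] [CharZero R] (β : σ → R) (I : σ →₀ ℕ)
    (P : MvPolynomial σ R) : hasse I (shift β P) = shift β (hasse I P) := by
  induction I using finsupp_induction_single with
  | h0 => rw [hasse_zero, hasse_zero]
  | hadd I s ih =>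
    have h := congrArg (pderiv s) ih
    rw [pderiv_shift, pderiv_hasse, pderiv_hasse, map_smul] at h
    exact smul_right_injective _ (Nat.cast_ne_zero.2 (Nat.succ_ne_zero _)) h

theorem l1_hasse_le (I : σ →₀ ℕ) (P : MvPolynomial σ ℤ) {r : σ → ℕ}
    (hr : ∀ s, P.degreeOf s ≤ r s) : l1 zNorm (hasse I P) ≤ 2 ^ (∑ s, r s) * l1 zNorm P := by
  conv_lhs => rw [P.as_sum, map_sum]
  refine (l1_sum _ _).trans ?_
  rw [l1, Finset.mul_sum]
  refine Finset.sum_le_sum fun m hm => ?_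
  rw [hasse_monomial]
  refine (l1_monomial_le _ _).trans ((map_mul_le_mul _ _ _).trans ?_)
  rw [mul_comm]
  refine mul_le_mul_of_nonneg_right ?_ (apply_nonneg _ _)
  change ‖(∏ s, ((m s).choose (I s) : ℤ))‖ ≤ _
  rw [norm_prod, ← Finset.prod_pow_eq_pow_sum]
  refine Finset.prod_le_prod (fun _ _ => norm_nonneg _) fun s _ => ?_
  rw [Int.norm_eq_abs]
  push_cast
  rw [abs_of_nonneg (by positivity)]
  calc ((m s).choose (I s) : ℝ) ≤ 2 ^ m s := by exact_mod_cast Nat.choose_le_two_pow _ _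
    _ ≤ 2 ^ r s := pow_le_pow_right₀ (by norm_num)
        ((monomial_le_degreeOf s hm).trans (hr s))

theorem OrdGE.hasse {w : σ → ℝ} {c : ℝ} {P : MvPolynomial σ R} (h : OrdGE w c P) (I : σ →₀ ℕ) :
    OrdGE w (c - Finsupp.weight w I) (hasse I P) := by
  classical
  rw [P.as_sum, map_sum]
  refine OrdGE.sum fun m hm m' hm' => ?_
  rw [hasse_monomial, coeff_monomial] at hm'
  split_ifs at hm' with h1
  · subst h1
    have hle : I ≤ m := by
      by_contra hle
      exact hm' (by rw [prod_choose_eq_zero hle, mul_zero])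
    have := h m (by simpa using hm)
    have h2 : Finsupp.weight w m = Finsupp.weight w (m - I) + Finsupp.weight w I := by
      rw [← map_add, tsub_add_cancel_of_le hle]
    linarith
  · exact absurd rfl hm'

theorem map_hasse {S : Type*} [CommRing S] (g : R →+* S) (I : σ →₀ ℕ) (P : MvPolynomial σ R) :
    map g (hasse I P) = hasse I (map g P) := by
  induction P using MvPolynomial.induction_on' with
  | add p q hp hq => rw [map_add, map_add, hp, hq, map_add, map_add]
  | monomial m a => simp [hasse_monomial, map_monomial]

theorem degreeOf_hasse_le (I : σ →₀ ℕ) (P : MvPolynomial σ R) (s : σ) :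
    (hasse I P).degreeOf s ≤ P.degreeOf s := by
  classical
  rw [degreeOf_le_iff]
  intro m hm
  rw [mem_support_iff, P.as_sum, map_sum, coeff_sum] at hm
  obtain ⟨m', hm', h⟩ := Finset.exists_ne_zero_of_sum_ne_zero hm
  rw [hasse_monomial, coeff_monomial] at h
  split_ifs at h with h1
  · rw [← h1, Finsupp.tsub_apply]
    exact (Nat.sub_le _ _).trans (monomial_le_degreeOf s hm')
  · exact absurd rfl h
end hasse

end

section

open MvPolynomial

theorem shift_neg_shift {σ R : Type*} [CommRing R] (β : σ → R) (P : MvPolynomial σ R) :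
    shift (-β) (shift β P) = P := by
  have : (shift (-β)).comp (shift β) = AlgHom.id R (MvPolynomial σ R) := by
    ext s
    simp [shift]
  exact DFunLike.congr_fun this P

theorem shift_injective {σ R : Type*} [CommRing R] (β : σ → R) :
    Function.Injective (shift β) := Function.LeftInverse.injective (shift_neg_shift β)

theorem constantCoeff_shift {σ R : Type*} [CommRing R] (β : σ → R) (P : MvPolynomial σ R) :
    constantCoeff (shift β P) = eval β P := by
  induction P using MvPolynomial.induction_on with
  | C a => simp [shift]
  | add p q hp hq => rw [map_add, map_add, hp, hq, map_add]
  | mul_X p t hp => rw [map_mul, map_mul, hp, map_mul]; simp [shift]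

/-- Linearly independent polynomials have a nonvanishing generalised Wronskian. -/
theorem exists_wronskian_ne_zero {σ : Type*} [Fintype σ] (k : ℕ) (φ : Fin k → MvPolynomial σ ℚ)
    (h : LinearIndependent ℚ φ) : ∃ Δ : Fin k → (σ →₀ ℕ), (∀ l, (Δ l).degree ≤ l) ∧
      (Matrix.of fun l j => hasse (Δ l) (φ j)).det ≠ 0 := by
  classical
  induction k with
  | zero => exact ⟨fun _ => 0, fun l => l.elim0, by simp⟩
  | succ k ih =>
    obtain ⟨Δ, hΔ, hdet⟩ := ih (fun j => φ j.castSucc)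
      (h.comp _ (Fin.castSucc_injective k))
    by_contra! hall
    set A : Matrix (Fin k) (Fin k) (MvPolynomial σ ℚ) :=
      Matrix.of fun l j => hasse (Δ l) (φ j.castSucc) with hA
    let M : (σ →₀ ℕ) → Matrix (Fin (k + 1)) (Fin (k + 1)) (MvPolynomial σ ℚ) := fun I =>
      Matrix.of fun l j => hasse (Fin.snoc (α := fun _ => σ →₀ ℕ) Δ I l) (φ j)
    let c : Fin (k + 1) → MvPolynomial σ ℚ := fun j =>
      (-1) ^ (k + j : ℕ) * ((M 0).submatrix (Fin.last k).succAbove j.succAbove).det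
    have hM : ∀ I, (M I).det = ∑ j, c j * hasse I (φ j) := by
      intro I
      rw [Matrix.det_succ_row _ (Fin.last k)]
      refine Finset.sum_congr rfl fun j _ => ?_
      have : (M I).submatrix (Fin.last k).succAbove j.succAbove
          = (M 0).submatrix (Fin.last k).succAbove j.succAbove := by
        ext1 a b
        simp [M]
      rw [this]
      simp only [M, c, Matrix.of_apply, Fin.snoc_last, Fin.val_last]
      ring
    have hE : ∀ I : σ →₀ ℕ, I.degree ≤ k → ∑ j, c j * hasse I (φ j) = 0 := by
      intro I hI
      rw [← hM]
      refine hall _ fun l => ?_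
      refine Fin.lastCases ?_ (fun l => ?_) l
      · simpa using hI
      · simpa using hΔ l
    have hc : c (Fin.last k) ≠ 0 := by
      have : (M 0).submatrix (Fin.last k).succAbove (Fin.last k).succAbove = A := by
        ext1 a b
        simp [M, A]
      simp only [c, this]
      exact mul_ne_zero (by simp) hdet
    clear_value c
    have hder : ∀ (I : σ →₀ ℕ) (s : σ), ∑ j, c j * hasse I (φ j) = 0 →
        ∑ j, pderiv s (c j) * hasse I (φ j)
          + ((I s + 1 : ℕ) : ℚ) • ∑ j, c j * hasse (I + Finsupp.single s 1) (φ j) = 0 := by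
      intro I s h0
      have := congrArg (pderiv s) h0
      rw [map_zero, map_sum] at this
      rw [← this, Finset.smul_sum, ← Finset.sum_add_distrib]
      refine Finset.sum_congr rfl fun j _ => ?_
      rw [pderiv_mul, pderiv_hasse, mul_smul_comm]
    have hprop : ∀ s j, c (Fin.last k) * pderiv s (c j) = c j * pderiv s (c (Fin.last k)) := by
      intro s
      have hrow : ∀ l : Fin k, ∑ j, pderiv s (c j) * hasse (Δ l) (φ j) = 0 := by
        intro l
        have h1 := hder (Δ l) s (hE _ ((hΔ l).trans l.2.le))
        rwa [hE _ (by rw [map_add, Finsupp.degree_single]; have := hΔ l; omega), smul_zero,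
          add_zero] at h1
      have hv := Matrix.eq_zero_of_mulVec_eq_zero (M := A) hdet
        (v := fun j => c (Fin.last k) * pderiv s (c j.castSucc)
          - c j.castSucc * pderiv s (c (Fin.last k))) (by
          funext l
          have h1 := hrow l
          have h2 := hE (Δ l) ((hΔ l).trans l.2.le)
          rw [Fin.sum_univ_castSucc] at h1 h2
          simp only [Matrix.mulVec, dotProduct, A, Matrix.of_apply, Pi.zero_apply]
          have e : ∀ j : Fin k, hasse (Δ l) (φ j.castSucc) * (c (Fin.last k) *
              pderiv s (c j.castSucc) - c j.castSucc * pderiv s (c (Fin.last k)))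
              = c (Fin.last k) * (pderiv s (c j.castSucc) * hasse (Δ l) (φ j.castSucc))
                - pderiv s (c (Fin.last k)) * (c j.castSucc * hasse (Δ l) (φ j.castSucc)) :=
            fun j => by ring
          rw [Finset.sum_congr rfl fun j _ => e j, Finset.sum_sub_distrib, ← Finset.mul_sum,
            ← Finset.mul_sum]
          linear_combination c (Fin.last k) * h1 - pderiv s (c (Fin.last k)) * h2)
      intro j
      refine Fin.lastCases ?_ (fun j => ?_) j
      · rfl
      · exact sub_eq_zero.1 (congrFun hv j)
    have hEall : ∀ I : σ →₀ ℕ, ∑ j, c j * hasse I (φ j) = 0 := by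
      intro I
      induction I using finsupp_induction_single with
      | h0 => exact hE 0 (by simp)
      | hadd I s ihI =>
        have h1 := hder I s ihI
        have h2 : c (Fin.last k) * ∑ j, pderiv s (c j) * hasse I (φ j) = 0 := by
          rw [Finset.mul_sum]
          have : ∀ j, c (Fin.last k) * (pderiv s (c j) * hasse I (φ j))
              = pderiv s (c (Fin.last k)) * (c j * hasse I (φ j)) := fun j => by
            rw [← mul_assoc, hprop]; ring
          rw [Finset.sum_congr rfl fun j _ => this j, ← Finset.mul_sum, ihI, mul_zero]
        rw [(mul_eq_zero.1 h2).resolve_left hc, zero_add] at h1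
        exact (smul_eq_zero.1 h1).resolve_left (Nat.cast_ne_zero.2 (Nat.succ_ne_zero _))
    obtain ⟨x, hx⟩ : ∃ x, eval x (c (Fin.last k)) ≠ 0 := by
      by_contra! h0
      exact hc (MvPolynomial.funext fun x => by rw [h0, map_zero])
    have hdep : ∑ j, eval x (c j) • φ j = 0 := by
      apply shift_injective x
      rw [map_zero]
      ext I
      rw [coeff_zero, ← constantCoeff_hasse, hasse_shift, constantCoeff_shift, map_sum, map_sum,
        ← map_zero (eval x), ← hEall I, map_sum]
      refine Finset.sum_congr rfl fun j _ => ?_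
      rw [map_smul, smul_eval, map_mul]
    exact hx (Fintype.linearIndependent_iff.1 h _ hdep _)

end

section

open MvPolynomial

theorem OrdGE.neg {σ R : Type*} [CommRing R] {w : σ → ℝ} {c : ℝ} {P : MvPolynomial σ R}
    (h : OrdGE w c P) : OrdGE w c (-P) := fun m hm => h m (by simpa using hm)

theorem OrdGE.det {σ R ι : Type*} [CommRing R] [Fintype ι] [DecidableEq ι] {w : σ → ℝ} {d : ι → ℝ}
    {M : Matrix ι ι (MvPolynomial σ R)} (h : ∀ i j, OrdGE w (d j) (M i j)) :
    OrdGE w (∑ j, d j) M.det := by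
  rw [Matrix.det_apply]
  refine OrdGE.sum fun p _ => ?_
  have := OrdGE.prod (s := Finset.univ) (f := fun i => M (p i) i) fun i _ => h (p i) i
  rcases Int.units_eq_one_or (Equiv.Perm.sign p) with hp | hp
  · simpa [hp] using this
  · simpa [hp] using this.neg

theorem l1_det {σ ι : Type*} [Fintype ι] [DecidableEq ι] {B : ℝ}
    {M : Matrix ι ι (MvPolynomial σ ℤ)} (h : ∀ i j, l1 zNorm (M i j) ≤ B) :
    l1 zNorm M.det ≤ (Fintype.card ι).factorial * B ^ Fintype.card ι := by
  rw [Matrix.det_apply]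
  refine (l1_sum _ _).trans ?_
  have : ∀ p ∈ (Finset.univ : Finset (Equiv.Perm ι)),
      l1 zNorm (Equiv.Perm.sign p • ∏ i, M (p i) i) ≤ B ^ Fintype.card ι := by
    intro p _
    have h1 : l1 zNorm (∏ i, M (p i) i) ≤ B ^ Fintype.card ι := by
      refine (l1_prod zNorm_one _ _).trans ?_
      refine (Finset.prod_le_prod (fun _ _ => l1_nonneg _) fun i _ => h (p i) i).trans ?_
      simp
    rcases Int.units_eq_one_or (Equiv.Perm.sign p) with hp | hp
    · simpa [hp] using h1
    · simpa [hp, l1_neg] using h1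
  refine (Finset.sum_le_sum this).trans ?_
  rw [Finset.sum_const, nsmul_eq_mul, Finset.card_univ, Fintype.card_perm]

theorem degreeOf_det_le {σ R ι : Type*} [CommRing R] [Fintype ι] [DecidableEq ι] {r : ℕ} (s : σ)
    {M : Matrix ι ι (MvPolynomial σ R)} (h : ∀ i j, (M i j).degreeOf s ≤ r) :
    M.det.degreeOf s ≤ Fintype.card ι * r := by
  rw [Matrix.det_apply]
  refine (degreeOf_sum_le _ _ _).trans (Finset.sup_le fun p _ => ?_)
  have h1 : (∏ i, M (p i) i).degreeOf s ≤ Fintype.card ι * r := by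
    refine (degreeOf_prod_le _ _ _).trans ((Finset.sum_le_sum fun i _ => h (p i) i).trans ?_)
    simp
  rcases Int.units_eq_one_or (Equiv.Perm.sign p) with hp | hp
  · simpa [hp] using h1
  · rw [hp]
    simpa [degreeOf_neg] using h1

/-- The product of a polynomial in the variables `1, …, n` and a polynomial in the variable `0`. -/
noncomputable def glue {n : ℕ} {R : Type*} [CommRing R] (φ : MvPolynomial (Fin n) R)
    (ψ : MvPolynomial (Fin 1) R) : MvPolynomial (Fin (n + 1)) R :=
  rename Fin.succ φ * rename (fun _ => 0) ψ

section glue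
variable {n : ℕ} {R : Type*} [CommRing R]

theorem glue_monomial (m : Fin n →₀ ℕ) (m' : Fin 1 →₀ ℕ) (a b : R) :
    glue (monomial m a) (monomial m' b) = monomial (Finsupp.cons (m' 0) m) (a * b) := by
  rw [glue, rename_monomial, rename_monomial, monomial_mul]
  have h : m' = Finsupp.single 0 (m' 0) := by ext; simp
  rw [h, Finsupp.mapDomain_single]
  refine congrArg (fun t => monomial t (a * b)) ?_
  ext i
  refine Fin.cases ?_ (fun i => ?_) i
  · rw [Finsupp.add_apply, Finsupp.mapDomain_of_notMem_range]
    · simp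
    · simp
  · rw [Finsupp.add_apply, Finsupp.mapDomain_apply (Fin.succ_injective n)]
    simp

theorem glue_add_left (φ φ' : MvPolynomial (Fin n) R) (ψ : MvPolynomial (Fin 1) R) :
    glue (φ + φ') ψ = glue φ ψ + glue φ' ψ := by simp [glue, add_mul]

theorem glue_add_right (φ : MvPolynomial (Fin n) R) (ψ ψ' : MvPolynomial (Fin 1) R) :
    glue φ (ψ + ψ') = glue φ ψ + glue φ ψ' := by simp [glue, mul_add]

theorem glue_induction {p : MvPolynomial (Fin n) R → MvPolynomial (Fin 1) R → Prop}
    (hm : ∀ m m' a b, p (monomial m a) (monomial m' b))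
    (hl : ∀ φ φ' ψ, p φ ψ → p φ' ψ → p (φ + φ') ψ) (hr : ∀ φ ψ ψ', p φ ψ → p φ ψ' → p φ (ψ + ψ'))
    (φ : MvPolynomial (Fin n) R) (ψ : MvPolynomial (Fin 1) R) : p φ ψ := by
  induction φ using MvPolynomial.induction_on' with
  | add φ φ' h h' => exact hl _ _ _ h h'
  | monomial m a =>
    induction ψ using MvPolynomial.induction_on' with
    | add ψ ψ' h h' => exact hr _ _ _ h h'
    | monomial m' b => exact hm _ _ _ _

theorem hasse_glue (I : Fin n →₀ ℕ) (e : Fin 1 →₀ ℕ) (φ : MvPolynomial (Fin n) R)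
    (ψ : MvPolynomial (Fin 1) R) :
    hasse (Finsupp.cons (e 0) I) (glue φ ψ) = glue (hasse I φ) (hasse e ψ) := by
  induction φ, ψ using glue_induction with
  | hl φ φ' ψ h h' => simp only [glue_add_left, map_add, h, h']
  | hr φ ψ ψ' h h' => simp only [glue_add_right, map_add, h, h']
  | hm m m' a b =>
    rw [glue_monomial, hasse_monomial, hasse_monomial, hasse_monomial, glue_monomial,
      Fin.prod_univ_succ]
    congr 1
    · congr 1
      ext i
      refine Fin.cases ?_ (fun i => ?_) i <;> simp
    · simp
      ring

theorem coeff_glue (i : ℕ) (m : Fin n →₀ ℕ) (φ : MvPolynomial (Fin n) R)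
    (ψ : MvPolynomial (Fin 1) R) :
    (glue φ ψ).coeff (Finsupp.cons i m) = φ.coeff m * ψ.coeff (Finsupp.single 0 i) := by
  classical
  induction φ, ψ using glue_induction with
  | hl φ φ' ψ h h' => simp only [glue_add_left, coeff_add, h, h', add_mul]
  | hr φ ψ ψ' h h' => simp only [glue_add_right, coeff_add, h, h', mul_add]
  | hm m₁ m' a b =>
    rw [glue_monomial, coeff_monomial, coeff_monomial, coeff_monomial]
    have h : m' = Finsupp.single 0 i ↔ m' 0 = i := by
      constructor
      · rintro rfl; simp
      · rintro rfl; ext; simp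
    have h2 : Finsupp.cons (m' 0) m₁ = Finsupp.cons i m ↔ m₁ = m ∧ m' 0 = i := by
      constructor
      · intro h3
        refine ⟨?_, ?_⟩
        · have := congrArg Finsupp.tail h3
          simpa using this
        · have := DFunLike.congr_fun h3 0
          simpa using this
      · rintro ⟨rfl, rfl⟩; rfl
    simp only [h, h2]
    by_cases h3 : m₁ = m <;> by_cases h4 : m' 0 = i <;> simp [h3, h4]

theorem shift_glue (β : Fin (n + 1) → R) (φ : MvPolynomial (Fin n) R)
    (ψ : MvPolynomial (Fin 1) R) :
    shift β (glue φ ψ) = glue (shift (fun i => β i.succ) φ) (shift (fun _ => β 0) ψ) := by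
  rw [glue, glue, map_mul]
  congr 1
  · rw [shift, shift, aeval_rename, ← AlgHom.comp_apply]
    congr 1
    ext i
    simp
  · rw [shift, shift, aeval_rename, ← AlgHom.comp_apply]
    congr 1
    ext i
    simp

theorem ext_cons {P Q : MvPolynomial (Fin (n + 1)) R}
    (h : ∀ i m, P.coeff (Finsupp.cons i m) = Q.coeff (Finsupp.cons i m)) : P = Q := by
  ext m
  rw [← Finsupp.cons_tail m]
  exact h _ _
end glue

end

section

open MvPolynomial

theorem coeff_aeval_X_fin_one {R : Type*} [CommRing R] (g : Polynomial R) (t : ℕ) :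
    (Polynomial.aeval (X 0 : MvPolynomial (Fin 1) R) g).coeff (Finsupp.single 0 t)
      = g.coeff t := by
  classical
  induction g using Polynomial.induction_on' with
  | add p q hp hq => rw [map_add, coeff_add, hp, hq, Polynomial.coeff_add]
  | monomial n a =>
    rw [Polynomial.aeval_monomial, algebraMap_eq, coeff_C_mul, coeff_X_pow,
      Polynomial.coeff_monomial]
    have : Finsupp.single (0 : Fin 1) n = Finsupp.single 0 t ↔ n = t :=
      (Finsupp.single_injective 0).eq_iff
    simp only [this]
    split_ifs <;> simp

theorem isPrimitive_linear {p q : ℤ} (h : IsCoprime p q) :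
    (Polynomial.C q * Polynomial.X - Polynomial.C p).IsPrimitive := by
  intro r hr
  rw [Polynomial.C_dvd_iff_dvd_coeff] at hr
  have h0 := hr 0
  have h1 := hr 1
  rw [Polynomial.coeff_sub, Polynomial.coeff_C_mul, Polynomial.coeff_C] at h0 h1
  simp at h0 h1
  exact h.isUnit_of_dvd' h0 h1

/-- An integer polynomial vanishing to a high order at `p / q` has a large coefficient. -/
theorem exists_order_le {U : MvPolynomial (Fin 1) ℤ} (hU : U ≠ 0) {p q : ℤ} (hq : 0 < q)
    (hpq : IsCoprime p q) :
    ∃ t : ℕ, (shift (fun _ => (p / q : ℚ)) (map (Int.castRingHom ℚ) U)).coeff (Finsupp.single 0 t)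
      ≠ 0 ∧ (q : ℝ) ^ t ≤ l1 zNorm U := by
  set u : Polynomial ℤ := aeval (fun _ => Polynomial.X) U with hu
  have huU : Polynomial.aeval (X 0 : MvPolynomial (Fin 1) ℤ) u = U := by
    have : (Polynomial.aeval (X 0 : MvPolynomial (Fin 1) ℤ)).comp
        (aeval (fun _ => Polynomial.X)) = AlgHom.id ℤ (MvPolynomial (Fin 1) ℤ) := by
      ext i
      simp [Subsingleton.elim i 0]
    exact DFunLike.congr_fun this U
  have hu0 : u ≠ 0 := by
    intro h
    rw [h, map_zero] at huU
    exact hU huU.symm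
  set uq : Polynomial ℚ := u.map (Int.castRingHom ℚ) with huq
  have huq0 : uq ≠ 0 := (Polynomial.map_ne_zero_iff Int.cast_injective).2 hu0
  have hmap : map (Int.castRingHom ℚ) U = Polynomial.aeval (X 0) uq := by
    rw [← huU, huq, Polynomial.aeval_def, Polynomial.aeval_def, Polynomial.eval₂_map,
      Polynomial.hom_eval₂]
    simp only [map_X]
    congr 1
    exact RingHom.ext_int _ _
  set t := uq.rootMultiplicity (p / q : ℚ) with ht
  have hdvd : (Polynomial.C q * Polynomial.X - Polynomial.C p) ^ t ∣ u := by
    have hprim : ((Polynomial.C q * Polynomial.X - Polynomial.C p) ^ t).IsPrimitive := by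
      generalize t = n
      induction n with
      | zero => rw [pow_zero]; exact Polynomial.isPrimitive_one
      | succ n ih => rw [pow_succ]; exact ih.mul (isPrimitive_linear hpq)
    rw [Polynomial.IsPrimitive.Int.dvd_iff_map_cast_dvd_map_cast _ _ hprim]
    have h1 := Polynomial.pow_rootMultiplicity_dvd uq (p / q : ℚ)
    rw [← ht] at h1
    refine dvd_trans ?_ h1
    have h2 : (Polynomial.C q * Polynomial.X - Polynomial.C p).map (Int.castRingHom ℚ)
        = Polynomial.C (q : ℚ) * (Polynomial.X - Polynomial.C (p / q : ℚ)) := by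
      rw [mul_sub, ← Polynomial.C_mul, mul_div_cancel₀ _ (by exact_mod_cast hq.ne')]
      simp
    rw [Polynomial.map_pow, h2, mul_pow, ← Polynomial.C_pow]
    refine (Polynomial.isUnit_C.2 ?_).mul_left_dvd.2 dvd_rfl
    exact (IsUnit.mk0 _ (by exact_mod_cast hq.ne')).pow _
  refine ⟨t, ?_, ?_⟩
  · have h3 : shift (fun _ => (p / q : ℚ)) (map (Int.castRingHom ℚ) U)
        = Polynomial.aeval (X 0) (uq.comp (Polynomial.X + Polynomial.C (p / q : ℚ))) := by
      rw [hmap, shift, Polynomial.aeval_comp, ← Polynomial.aeval_algHom_apply]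
      simp [algebraMap_eq]
    rw [h3, coeff_aeval_X_fin_one, ht, Polynomial.rootMultiplicity_eq_natTrailingDegree]
    have h4 : uq.comp (Polynomial.X + Polynomial.C (p / q : ℚ)) ≠ 0 := by
      rw [← Polynomial.taylor_apply]
      exact fun h => huq0 (Polynomial.taylor_injective _ (by rw [h, map_zero]))
    exact Polynomial.trailingCoeff_nonzero_iff_nonzero.2 h4
  · obtain ⟨v, hv⟩ := hdvd
    have h5 : u.leadingCoeff = q ^ t * v.leadingCoeff := by
      rw [hv, Polynomial.leadingCoeff_mul, Polynomial.leadingCoeff_pow]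
      congr 2
      rw [sub_eq_add_neg, ← Polynomial.C_neg]
      exact Polynomial.leadingCoeff_linear hq.ne'
    have h6 : v.leadingCoeff ≠ 0 := by
      intro h
      rw [h, mul_zero] at h5
      exact hu0 (Polynomial.leadingCoeff_eq_zero.1 h5)
    have h7 : zNorm (U.coeff (Finsupp.single 0 u.natDegree)) ≤ l1 zNorm U := coeff_le_l1 _ _
    rw [← huU, coeff_aeval_X_fin_one, huU] at h7
    refine le_trans ?_ h7
    change _ ≤ ‖u.leadingCoeff‖
    rw [h5, norm_mul, norm_pow]
    have h8 : (1 : ℝ) ≤ ‖v.leadingCoeff‖ := by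
      rw [Int.norm_eq_abs]
      exact_mod_cast Int.one_le_abs h6
    have h9 : ‖q‖ = (q : ℝ) := by
      rw [Int.norm_eq_abs, abs_of_pos (by exact_mod_cast hq)]
    rw [h9]
    exact le_mul_of_one_le_right (by positivity) h8

end

section

open MvPolynomial

theorem exists_glue_decomposition {n r : ℕ} {P : MvPolynomial (Fin (n + 1)) ℚ} (hP : P ≠ 0)
    (hr : P.degreeOf 0 ≤ r) : ∃ (k : ℕ) (φ : Fin k → MvPolynomial (Fin n) ℚ)
      (ψ : Fin k → MvPolynomial (Fin 1) ℚ), 0 < k ∧ k ≤ r + 1 ∧ LinearIndependent ℚ φ ∧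
        LinearIndependent ℚ ψ ∧ P = ∑ j, glue (φ j) (ψ j) := by
  classical
  let f : Fin (r + 1) → MvPolynomial (Fin n) ℚ := fun i => (finSuccEquiv ℚ n P).coeff i
  let S : Submodule ℚ (MvPolynomial (Fin n) ℚ) := Submodule.span ℚ (Set.range f)
  have hfS : ∀ i, f i ∈ S := fun i => Submodule.subset_span ⟨i, rfl⟩
  have : FiniteDimensional ℚ S := FiniteDimensional.span_of_finite ℚ (Set.finite_range f)
  let b := Module.finBasis ℚ S
  let a : Fin (r + 1) → Fin (Module.finrank ℚ S) → ℚ := fun i j => b.repr ⟨f i, hfS i⟩ j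
  let φ : Fin (Module.finrank ℚ S) → MvPolynomial (Fin n) ℚ := fun j => (b j : MvPolynomial _ ℚ)
  let ψ : Fin (Module.finrank ℚ S) → MvPolynomial (Fin 1) ℚ := fun j =>
    ∑ i : Fin (r + 1), monomial (Finsupp.single 0 (i : ℕ)) (a i j)
  have hf : ∀ i, f i = ∑ j, a i j • φ j := by
    intro i
    have := congrArg (Subtype.val) (b.sum_repr ⟨f i, hfS i⟩)
    rw [Submodule.coe_sum] at this
    exact this.symm
  have hψ : ∀ j (i : ℕ), (ψ j).coeff (Finsupp.single 0 i)
      = if h : i < r + 1 then a ⟨i, h⟩ j else 0 := by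
    intro j i
    simp only [ψ, coeff_sum, coeff_monomial, (Finsupp.single_injective (0 : Fin 1)).eq_iff]
    split_ifs with h
    · rw [Finset.sum_eq_single ⟨i, h⟩]
      · simp
      · intro x _ hx
        rw [if_neg]
        exact fun h' => hx (Fin.ext h')
      · simp
    · exact Finset.sum_eq_zero fun x _ => if_neg fun h' : (x : ℕ) = i => h (h' ▸ x.2)
  have hsum : P = ∑ j, glue (φ j) (ψ j) := by
    refine ext_cons fun i m => ?_
    rw [coeff_sum, ← finSuccEquiv_coeff_coeff]
    simp only [coeff_glue, hψ]
    by_cases h : i < r + 1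
    · simp only [dif_pos h]
      have := congrArg (coeff m) (hf ⟨i, h⟩)
      simp only [coeff_sum, coeff_smul, smul_eq_mul, f] at this
      rw [this]
      exact Finset.sum_congr rfl fun j _ => mul_comm _ _
    · simp only [dif_neg h, mul_zero, Finset.sum_const_zero]
      rw [Polynomial.coeff_eq_zero_of_natDegree_lt, coeff_zero]
      rw [natDegree_finSuccEquiv]
      omega
  refine ⟨Module.finrank ℚ S, φ, ψ, ?_, ?_, ?_, ?_, hsum⟩
  · rw [Nat.pos_iff_ne_zero]
    intro h
    apply hP
    rw [hsum]
    have : IsEmpty (Fin (Module.finrank ℚ S)) := by rw [h]; infer_instance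
    simp
  · simpa [Set.finrank] using finrank_range_le_card (R := ℚ) f
  · exact b.linearIndependent.map' S.subtype (by simp)
  · rw [Fintype.linearIndependent_iff]
    intro g hg
    have h1 : ∀ i, ∑ j, g j * a i j = 0 := by
      intro i
      have := congrArg (coeff (Finsupp.single 0 (i : ℕ))) hg
      simpa only [coeff_sum, coeff_smul, hψ, dif_pos i.2, smul_eq_mul, coeff_zero] using this
    have h2 : ∀ x : S, ∑ j, g j * b.repr x j = 0 := by
      rintro ⟨x, hx⟩
      obtain ⟨c, rfl⟩ := (Submodule.mem_span_range_iff_exists_fun ℚ).1 hx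
      have : (⟨∑ i, c i • f i, hx⟩ : S) = ∑ i, c i • ⟨f i, hfS i⟩ := by
        apply Subtype.ext; simp
      rw [this]
      simp only [map_sum, map_smul, Finsupp.coe_finsetSum, Finset.sum_apply, Finsupp.smul_apply,
        smul_eq_mul, Finset.mul_sum]
      rw [Finset.sum_comm]
      refine Finset.sum_eq_zero fun i _ => ?_
      have := congrArg (c i * ·) (h1 i)
      simp only [mul_zero, Finset.mul_sum] at this
      rw [← this]
      exact Finset.sum_congr rfl fun j _ => by simp only [a]; ring
    intro j
    simpa [Finsupp.single_apply] using h2 (b j)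

end

section

open MvPolynomial

theorem l1_coeff_finSuccEquiv_le {n : ℕ} (W : MvPolynomial (Fin (n + 1)) ℤ) (i : ℕ) :
    l1 zNorm ((finSuccEquiv ℤ n W).coeff i) ≤ l1 zNorm W := by
  classical
  rw [l1, l1]
  simp only [finSuccEquiv_coeff_coeff]
  have hinj : Set.InjOn (Finsupp.cons i : (Fin n →₀ ℕ) → (Fin (n + 1) →₀ ℕ))
      ↑((finSuccEquiv ℤ n W).coeff i).support := by
    intro a _ b _ h
    simpa using congrArg Finsupp.tail h
  rw [← Finset.sum_image (f := fun x => zNorm (W.coeff x)) hinj]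
  refine Finset.sum_le_sum_of_subset_of_nonneg ?_ fun _ _ _ => apply_nonneg _ _
  intro x hx
  obtain ⟨m, hm, rfl⟩ := Finset.mem_image.1 hx
  rw [mem_support_iff, finSuccEquiv_coeff_coeff] at hm
  rwa [mem_support_iff]

theorem exists_slice {n : ℕ} (W : MvPolynomial (Fin (n + 1)) ℤ) (m : Fin n →₀ ℕ) :
    ∃ U : MvPolynomial (Fin 1) ℤ, l1 zNorm U ≤ l1 zNorm W ∧
      ∀ i, U.coeff (Finsupp.single 0 i) = W.coeff (Finsupp.cons i m) := by
  classical
  refine ⟨∑ x ∈ W.support with Finsupp.tail x = m,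
    monomial (Finsupp.single 0 (x 0)) (W.coeff x), ?_, fun i => ?_⟩
  · refine (l1_sum _ _).trans ((Finset.sum_le_sum fun x _ => l1_monomial_le _ _).trans ?_)
    exact Finset.sum_le_sum_of_subset_of_nonneg (Finset.filter_subset _ _)
      fun _ _ _ => apply_nonneg _ _
  · simp only [coeff_sum, coeff_monomial, (Finsupp.single_injective (0 : Fin 1)).eq_iff]
    rw [Finset.sum_eq_single (Finsupp.cons i m)]
    · simp
    · intro x hx hne
      rw [if_neg]
      rintro rfl
      rw [Finset.mem_filter] at hx
      exact hne (by rw [← hx.2, Finsupp.cons_tail])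
    · intro h
      rw [Finset.mem_filter, not_and_or] at h
      simp only [Finsupp.cons_zero, if_true]
      rcases h with h | h
      · exact notMem_support_iff.1 h
      · exact absurd (Finsupp.tail_cons _ _) h

theorem sum_max_ge {k r : ℕ} {δ : ℝ} (hk : k ≤ r + 1) (hr : 0 < r) (hδ : 0 < δ) (hδ1 : δ ≤ 1) :
    k * (δ ^ 2 / 8) ≤ ∑ s : Fin k, max 0 (δ - (s : ℕ) / (r : ℝ)) := by
  rw [Fin.sum_univ_eq_sum_range (fun s => max 0 (δ - (s : ℝ) / (r : ℝ)))]
  have hr' : (0 : ℝ) < r := by exact_mod_cast hr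
  set n := min k (⌊δ * r / 2⌋₊ + 1) with hn
  have h1 : ∑ s ∈ Finset.range n, max 0 (δ - (s : ℝ) / r)
      ≤ ∑ s ∈ Finset.range k, max 0 (δ - (s : ℝ) / r) :=
    Finset.sum_le_sum_of_subset_of_nonneg (Finset.range_subset_range.2 (min_le_left _ _))
      fun _ _ _ => le_max_left _ _
  have h2 : ∑ s ∈ Finset.range n, δ / 2 ≤ ∑ s ∈ Finset.range n, max 0 (δ - (s : ℝ) / r) := by
    refine Finset.sum_le_sum fun s hs => le_max_of_le_right ?_
    have hs1 : s ≤ ⌊δ * r / 2⌋₊ := by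
      have := (Finset.mem_range.1 hs).trans_le (min_le_right _ _); omega
    have hs2 : (s : ℝ) ≤ δ * r / 2 := (Nat.le_floor_iff (by positivity)).1 hs1
    have : (s : ℝ) / r ≤ δ / 2 := by rw [div_le_iff₀ hr']; linarith
    linarith
  refine le_trans ?_ (h2.trans h1)
  rw [Finset.sum_const, Finset.card_range, nsmul_eq_mul]
  have h3 : (k : ℝ) * δ / 4 ≤ n := by
    have hk' : (k : ℝ) ≤ 2 * r := by
      have : k ≤ 2 * r := by omega
      exact_mod_cast this
    rw [hn, Nat.cast_min, le_min_iff]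
    constructor
    · nlinarith [Nat.cast_nonneg (α := ℝ) k]
    · have := (Nat.lt_floor_add_one (δ * r / 2)).le
      push_cast
      nlinarith
  nlinarith

end

section

open MvPolynomial

theorem weight_eq_sum {σ : Type*} [Fintype σ] (w : σ → ℝ) (m : σ →₀ ℕ) :
    Finsupp.weight w m = ∑ s, (m s : ℝ) * w s := by
  rw [Finsupp.weight_apply, Finsupp.sum_fintype]
  · simp
  · simp

theorem weight_cons {n : ℕ} (w : Fin (n + 1) → ℝ) (i : ℕ) (m : Fin n →₀ ℕ) :
    Finsupp.weight w (Finsupp.cons i m) = i * w 0 + Finsupp.weight (fun h => w h.succ) m := by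
  rw [weight_eq_sum, weight_eq_sum, Fin.sum_univ_succ]
  simp

theorem OrdGE.of_nonneg {σ R : Type*} [Fintype σ] [CommSemiring R] {w : σ → ℝ} (hw : ∀ s, 0 ≤ w s)
    (P : MvPolynomial σ R) : OrdGE w 0 P := fun m _ => by
  rw [weight_eq_sum]
  exact Finset.sum_nonneg fun s _ => mul_nonneg (Nat.cast_nonneg _) (hw s)

/-- Roth's lemma in `m` variables, the degrees being increasing. -/
def RothLemma (m : ℕ) : Prop := ∀ ε : ℝ, 0 < ε → ∃ ω : ℝ, 0 < ω ∧
  ∀ (r : Fin m → ℕ) (p q : Fin m → ℤ) (P : MvPolynomial (Fin m) ℤ) (Λ : ℝ),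
    (∀ h, 0 < r h) → (∀ i j, i < j → (r i : ℝ) ≤ ω * r j) → P ≠ 0 → (∀ h, P.degreeOf h ≤ r h) →
    (∀ h, 0 < q h) → (∀ h, IsCoprime (p h) (q h)) → 0 < Λ → (∀ h, Λ ≤ r h * Real.log (q h)) →
    Real.log (l1 zNorm P) ≤ ω * Λ → (∀ h, (r h : ℝ) ≤ ω * Λ) →
    ¬ OrdGE (fun h => 1 / (r h : ℝ)) ε
      (shift (fun h => (p h / q h : ℚ)) (map (Int.castRingHom ℚ) P))

theorem rothLemma_zero : RothLemma 0 := by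
  intro ε hε
  refine ⟨1, one_pos, fun r p q P Λ _ _ hP _ _ _ _ _ _ _ h => ?_⟩
  have h0 : (shift (fun h => (p h / q h : ℚ)) (map (Int.castRingHom ℚ) P)) ≠ 0 := by
    rw [Ne, ← map_zero (shift _), (shift_injective _).eq_iff,
      ← map_zero (map (Int.castRingHom ℚ)), (map_injective _ Int.cast_injective).eq_iff]
    exact hP
  obtain ⟨m, hm⟩ := ne_zero_iff.1 h0
  have := h m hm
  rw [weight_eq_sum] at this
  simp at this
  linarith

/-- The Wronskian determinant of `P` which factors into a polynomial in the variable `0` and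
a polynomial in the other variables. -/
theorem exists_wronskian_glue {n : ℕ} {r : Fin (n + 1) → ℕ} {P : MvPolynomial (Fin (n + 1)) ℤ}
    (hP : P ≠ 0) (hr : ∀ h, P.degreeOf h ≤ r h) :
    ∃ (k : ℕ) (V : MvPolynomial (Fin n) ℚ) (U : MvPolynomial (Fin 1) ℚ)
      (Δ : Fin k → (Fin n →₀ ℕ)) (e : Fin k → ℕ), 0 < k ∧ k ≤ r 0 + 1 ∧ V ≠ 0 ∧ U ≠ 0 ∧
      (∀ l, (Δ l).degree ≤ r 0) ∧ (∀ s, e s ≤ s) ∧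
      map (Int.castRingHom ℚ) (Matrix.of fun l s => hasse (Finsupp.cons (e s) (Δ l)) P).det
        = glue V U := by
  have hPq : map (Int.castRingHom ℚ) P ≠ 0 := by
    rw [Ne, ← map_zero (map (Int.castRingHom ℚ)), (map_injective _ Int.cast_injective).eq_iff]
    exact hP
  have hdeg : (map (Int.castRingHom ℚ) P).degreeOf 0 ≤ r 0 := by
    refine le_trans ?_ (hr 0)
    rw [degreeOf_eq_sup, degreeOf_eq_sup]
    exact Finset.sup_mono (support_map_subset _ _)
  obtain ⟨k, φ, ψ, hk0, hk, hφ, hψ, hsum⟩ := exists_glue_decomposition hPq hdeg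
  obtain ⟨Δ, hΔ, hV⟩ := exists_wronskian_ne_zero k φ hφ
  obtain ⟨e, he, hU⟩ := exists_wronskian_ne_zero k ψ hψ
  refine ⟨k, _, _, Δ, fun s => e s 0, hk0, hk, hV, hU, fun l => ?_, fun s => ?_, ?_⟩
  · have := hΔ l; have := l.2; omega
  · refine le_trans ?_ (he s)
    simp [Finsupp.degree_eq_sum]
  · rw [glue, AlgHom.map_det, AlgHom.map_det, RingHom.map_det, ← Matrix.det_transpose
      (AlgHom.mapMatrix (rename _) (Matrix.of fun l j => hasse (e l) (ψ j))), ← Matrix.det_mul]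
    congr 1
    ext1 l s
    simp only [RingHom.mapMatrix_apply, Matrix.map_apply, Matrix.of_apply, Matrix.mul_apply,
      AlgHom.mapMatrix_apply, Matrix.transpose_apply]
    rw [map_hasse, hsum, map_sum]
    exact Finset.sum_congr rfl fun j _ => hasse_glue _ _ _ _

theorem log_l1_wronskian_le {n k : ℕ} {r : Fin (n + 1) → ℕ} {P : MvPolynomial (Fin (n + 1)) ℤ}
    (hP : P ≠ 0) (hr : ∀ h, P.degreeOf h ≤ r h) (hk0 : 0 < k) (hk : k ≤ r 0 + 1)
    {Δ : Fin k → (Fin n →₀ ℕ)} {e : Fin k → ℕ} {B : ℝ} (hB : ∀ h, (r h : ℝ) ≤ B)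
    (hPB : Real.log (l1 zNorm P) ≤ B)
    (hW : (Matrix.of fun l s => hasse (Finsupp.cons (e s) (Δ l)) P).det ≠ 0) :
    Real.log (l1 zNorm (Matrix.of fun l s => hasse (Finsupp.cons (e s) (Δ l)) P).det)
      ≤ k * ((n + 4) * B) := by
  have h1 := l1_det (M := Matrix.of fun l s => hasse (Finsupp.cons (e s) (Δ l)) P)
    (B := 2 ^ (∑ h, r h) * l1 zNorm P) (fun l s => l1_hasse_le _ _ hr)
  have hP1 := one_le_l1 hP
  have hW1 := one_le_l1 hW
  rw [Fintype.card_fin] at h1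
  have h2 : (k.factorial : ℝ) ≤ (k : ℝ) ^ k := by exact_mod_cast Nat.factorial_le_pow k
  have hk0' : (0 : ℝ) < k := by exact_mod_cast hk0
  have h3 : l1 zNorm (Matrix.of fun l s => hasse (Finsupp.cons (e s) (Δ l)) P).det
      ≤ (k * (2 ^ (∑ h, r h) * l1 zNorm P)) ^ k := by
    rw [mul_pow]
    exact h1.trans (mul_le_mul_of_nonneg_right h2 (by positivity))
  refine (Real.log_le_log (by linarith) h3).trans ?_
  rw [Real.log_pow, Real.log_mul hk0'.ne' (by positivity), Real.log_mul (by positivity)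
    (by positivity), Real.log_pow]
  refine mul_le_mul_of_nonneg_left ?_ hk0'.le
  have h4 : Real.log k ≤ B := by
    have h5 := Real.log_le_sub_one_of_pos hk0'
    have h6 : (k : ℝ) ≤ r 0 + 1 := by exact_mod_cast hk
    linarith [hB 0]
  have h7 : ((∑ h, r h : ℕ) : ℝ) ≤ (n + 1) * B := by
    push_cast
    refine (Finset.sum_le_sum fun h _ => hB h).trans ?_
    simp
  have h8 : Real.log 2 ≤ 1 := by linarith [Real.log_two_lt_d9]
  have h9 : ((∑ h, r h : ℕ) : ℝ) * Real.log 2 ≤ ((∑ h, r h : ℕ) : ℝ) :=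
    mul_le_of_le_one_right (Nat.cast_nonneg _) h8
  have h10 : 0 ≤ B := (Nat.cast_nonneg _).trans (hB 0)
  linarith

theorem weight_le_degree_mul {σ : Type*} [Fintype σ] {w : σ → ℝ} {a : ℝ} (m : σ →₀ ℕ)
    (hw : ∀ s, w s ≤ a) : Finsupp.weight w m ≤ m.degree * a := by
  rw [weight_eq_sum, Finsupp.degree_eq_sum, Nat.cast_sum, Finset.sum_mul]
  exact Finset.sum_le_sum fun s _ => mul_le_mul_of_nonneg_left (hw s) (Nat.cast_nonneg _)

theorem rothLemma_succ {n : ℕ} (ih : RothLemma n) : RothLemma (n + 1) := by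
  intro ε₀ hε₀
  set δ : ℝ := min ε₀ 1 / 2 with hδdef
  have hδ : 0 < δ := by positivity
  have hδ1 : δ ≤ 1 := by have := min_le_right ε₀ 1; linarith
  have hδε : 2 * δ ≤ ε₀ := by have := min_le_left ε₀ 1; linarith
  obtain ⟨ω', hω', hIH⟩ := ih (δ ^ 2 / 32) (by positivity)
  have hn4 : (0 : ℝ) < n + 4 := by positivity
  set ω : ℝ := min δ (min (ω' / (n + 4)) (δ ^ 2 / 32 / (n + 4))) with hωdef
  have hω : 0 < ω := by positivity
  have hω1 : ω ≤ δ := min_le_left _ _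
  have hω2 : ω * (n + 4) ≤ ω' := by
    rw [← le_div_iff₀ hn4]; exact (min_le_right _ _).trans (min_le_left _ _)
  have hω3 : ω * (n + 4) ≤ δ ^ 2 / 32 := by
    rw [← le_div_iff₀ hn4]; exact (min_le_right _ _).trans (min_le_right _ _)
  have hω4 : ω ≤ ω' := by nlinarith [Nat.cast_nonneg (α := ℝ) n]
  refine ⟨ω, hω, fun r p q P Λ hr0 hr hP hdeg hq hpq hΛ hΛq hPΛ hrΛ hord => ?_⟩
  obtain ⟨k, V, U, Δ, e, hk0, hk, hV, hU, hΔ, he, hglue⟩ := exists_wronskian_glue hP hdeg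
  set W := (Matrix.of fun l s => hasse (Finsupp.cons (e s) (Δ l)) P).det with hW
  have hk0' : (0 : ℝ) < k := by exact_mod_cast hk0
  set β : Fin (n + 1) → ℚ := fun h => p h / q h with hβ
  have hr0' : ∀ h, (0 : ℝ) < r h := fun h => by exact_mod_cast hr0 h
  obtain ⟨i₀, hi₀⟩ : ∃ i, U.coeff (Finsupp.single 0 i) ≠ 0 := by
    obtain ⟨m, hm⟩ := ne_zero_iff.1 hU
    refine ⟨m 0, ?_⟩
    rwa [show Finsupp.single 0 (m 0) = m by ext; simp]
  obtain ⟨m₀, hm₀⟩ := ne_zero_iff.1 hV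
  have hcoeff : ∀ i m, ((W.coeff (Finsupp.cons i m) : ℤ) : ℚ)
      = V.coeff m * U.coeff (Finsupp.single 0 i) := by
    intro i m
    rw [← coeff_glue, ← hglue, coeff_map]; rfl
  have hW0 : W ≠ 0 := by
    intro h
    have := hcoeff i₀ m₀
    rw [h, coeff_zero, Int.cast_zero] at this
    exact mul_ne_zero hm₀ hi₀ this.symm
  have hlogW := log_l1_wronskian_le hP hdeg hk0 hk hrΛ hPΛ hW0
  rw [← hW] at hlogW
  -- a monomial of small weight in the polynomial in the last variables
  obtain ⟨μ, hμ0, hμ⟩ : ∃ μ, (shift (fun h => β h.succ) V).coeff μ ≠ 0 ∧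
      Finsupp.weight (fun h : Fin n => 1 / (r h.succ : ℝ)) μ < k * (δ ^ 2 / 32) := by
    set V' := (finSuccEquiv ℤ n W).coeff i₀ with hV'
    have hV'V : map (Int.castRingHom ℚ) V' = C (U.coeff (Finsupp.single 0 i₀)) * V := by
      ext m
      rw [coeff_map, hV', finSuccEquiv_coeff_coeff, coeff_C_mul, mul_comm]
      exact hcoeff i₀ m
    have hV'0 : V' ≠ 0 := by
      intro h
      rw [h, map_zero] at hV'V
      exact mul_ne_zero (C_ne_zero.2 hi₀) hV hV'V.symm
    have hl1V : Real.log (l1 zNorm V') ≤ Real.log (l1 zNorm W) :=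
      Real.log_le_log (by linarith [one_le_l1 hV'0]) (l1_coeff_finSuccEquiv_le W i₀)
    have := hIH (fun h => k * r h.succ) (fun h => p h.succ) (fun h => q h.succ) V' (k * Λ)
      (fun h => Nat.mul_pos hk0 (hr0 _)) (fun i j hij => ?_) hV'0 (fun h => ?_) (fun h => hq _)
      (fun h => hpq _) (by positivity) (fun h => ?_) ?_ (fun h => ?_)
    · rw [OrdGE] at this
      push Not at this
      obtain ⟨μ, hμ0, hμ⟩ := this
      rw [hV'V, map_mul] at hμ0
      refine ⟨μ, fun h => hμ0 ?_, ?_⟩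
      · rw [shift, ← algebraMap_eq, AlgHom.commutes, algebraMap_eq, coeff_C_mul]
        exact mul_eq_zero_of_right _ h
      · have h2 : Finsupp.weight (fun h : Fin n => 1 / (r h.succ : ℝ)) μ
            = k * Finsupp.weight (fun h : Fin n => 1 / ((k * r h.succ : ℕ) : ℝ)) μ := by
          rw [weight_eq_sum, weight_eq_sum, Finset.mul_sum]
          refine Finset.sum_congr rfl fun h _ => ?_
          have := (hr0' h.succ).ne'
          push_cast
          field_simp
        rw [h2]
        exact mul_lt_mul_of_pos_left hμ hk0'
    · push_cast
      have := hr i.succ j.succ (Fin.succ_lt_succ_iff.2 hij)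
      have h2 : ω * (r j.succ : ℝ) ≤ ω' * r j.succ := by gcongr
      nlinarith
    · refine (degreeOf_coeff_finSuccEquiv W h i₀).trans ?_
      have := degreeOf_det_le (M := Matrix.of fun l s => hasse (Finsupp.cons (e s) (Δ l)) P)
        h.succ (r := r h.succ) fun i j => (degreeOf_hasse_le _ _ _).trans (hdeg _)
      rwa [Fintype.card_fin] at this
    · push_cast
      have := hΛq h.succ
      nlinarith
    · refine hl1V.trans (hlogW.trans ?_)
      have : (n + 4) * (ω * Λ) ≤ ω' * Λ := by nlinarith
      nlinarith
    · push_cast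
      have := hrΛ h.succ
      have h2 : ω * Λ ≤ ω' * Λ := by gcongr
      nlinarith
  obtain ⟨t, ht0, ht⟩ : ∃ t : ℕ, (shift (fun _ => β 0) U).coeff (Finsupp.single 0 t) ≠ 0 ∧
      (t : ℝ) * (1 / r 0) ≤ k * (δ ^ 2 / 32) := by
    obtain ⟨U', hU'l, hU'c⟩ := exists_slice W m₀
    have hU'U : map (Int.castRingHom ℚ) U' = C (V.coeff m₀) * U := by
      ext m
      rw [show m = Finsupp.single 0 (m 0) by ext; simp, coeff_map, hU'c, coeff_C_mul]
      exact hcoeff _ _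
    have hU'0 : U' ≠ 0 := by
      intro h
      rw [h, map_zero] at hU'U
      exact mul_ne_zero (C_ne_zero.2 hm₀) hU hU'U.symm
    obtain ⟨t, ht0, ht⟩ := exists_order_le hU'0 (hq 0) (hpq 0)
    refine ⟨t, fun h => ht0 ?_, ?_⟩
    · rw [hU'U, map_mul, shift, ← algebraMap_eq, AlgHom.commutes, algebraMap_eq, coeff_C_mul]
      exact mul_eq_zero_of_right _ h
    · have hq0 : (0 : ℝ) < q 0 := by exact_mod_cast hq 0
      have h1 := Real.log_le_log (by positivity) (ht.trans hU'l)
      rw [Real.log_pow] at h1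
      have h2 := h1.trans hlogW
      have h3 : (t : ℝ) * Λ ≤ t * (r 0 * Real.log (q 0)) := by
        gcongr
        exact hΛq 0
      have h4 : (t : ℝ) * Λ ≤ r 0 * (k * (δ ^ 2 / 32)) * Λ := by
        have h5 : (r 0 : ℝ) * (t * Real.log (q 0)) ≤ r 0 * (k * ((n + 4) * (ω * Λ))) := by gcongr
        have h6 : (r 0 : ℝ) * (k * ((n + 4) * (ω * Λ))) ≤ r 0 * (k * (δ ^ 2 / 32 * Λ)) := by
          have h8 : (n + 4) * (ω * Λ) ≤ δ ^ 2 / 32 * Λ := by nlinarith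
          exact mul_le_mul_of_nonneg_left (mul_le_mul_of_nonneg_left h8 hk0'.le) (hr0' 0).le
        linarith
      have h7 := le_of_mul_le_mul_right h4 hΛ
      rw [mul_one_div, div_le_iff₀ (hr0' 0)]
      linarith
  -- the order of vanishing of the determinant
  have hordW : OrdGE (fun h => 1 / (r h : ℝ)) (∑ s : Fin k, max 0 (δ - (s : ℕ) / (r 0 : ℝ)))
      (shift β (map (Int.castRingHom ℚ) W)) := by
    rw [hW, RingHom.map_det, AlgHom.map_det]
    refine OrdGE.det fun l s => ?_
    simp only [RingHom.mapMatrix_apply, Matrix.map_apply, Matrix.of_apply, AlgHom.mapMatrix_apply]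
    rw [map_hasse, ← hasse_shift]
    rcases le_total 0 (δ - (s : ℕ) / (r 0 : ℝ)) with hs | hs
    · rw [max_eq_right hs]
      refine (hord.hasse _).mono ?_
      rw [weight_cons]
      have h1 : ((e s : ℕ) : ℝ) * (1 / (r 0 : ℝ)) ≤ (s : ℕ) / (r 0 : ℝ) := by
        rw [mul_one_div]
        gcongr
        exact he s
      have h2 : Finsupp.weight (fun h : Fin n => 1 / (r h.succ : ℝ)) (Δ l) ≤ ω := by
        refine (weight_le_degree_mul (a := ω / r 0) _ fun h => ?_).trans ?_
        · rw [div_le_div_iff₀ (hr0' _) (hr0' _), one_mul]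
          exact hr 0 h.succ (Fin.succ_pos h)
        · have : ((Δ l).degree : ℝ) ≤ r 0 := by exact_mod_cast hΔ l
          rw [mul_div_assoc', div_le_iff₀ (hr0' _)]
          nlinarith
      linarith
    · rw [max_eq_left hs]
      exact OrdGE.of_nonneg (fun h => by positivity) _
  rw [hglue, shift_glue] at hordW
  have h1 := hordW (Finsupp.cons t μ) (by rw [coeff_glue]; exact mul_ne_zero hμ0 ht0)
  rw [weight_cons] at h1
  have h2 := sum_max_ge hk (hr0 0) hδ hδ1
  have h3 : 0 < (k : ℝ) * δ ^ 2 := by positivity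
  linarith

theorem rothLemma (m : ℕ) : RothLemma m := by
  induction m with
  | zero => exact rothLemma_zero
  | succ n ih => exact rothLemma_succ ih

end

section

open MvPolynomial

theorem coeff_eval₂_of_minimal {σ A A' : Type*} [CommRing A] [CommRing A']
    (θ : A →+* MvPolynomial σ A') (G : MvPolynomial σ A) (τ : σ →₀ ℕ)
    (h : ∀ τ', τ' < τ → G.coeff τ' = 0) :
    (G.eval₂ θ X).coeff τ = constantCoeff (θ (G.coeff τ)) := by
  classical
  have h1 : ∀ τ' ∈ G.support, τ' ≠ τ → coeff τ (θ (G.coeff τ') * monomial τ' 1) = 0 := by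
    intro τ' hτ' hne
    rw [coeff_mul_monomial']
    split_ifs with hle
    · exact absurd (h τ' (lt_of_le_of_ne hle hne)) (mem_support_iff.1 hτ')
    · rfl
  have h2 : ∀ τ' : σ →₀ ℕ, ∏ i ∈ τ'.support, (X i : MvPolynomial σ A') ^ τ' i = monomial τ' 1 :=
    fun τ' => by rw [monomial_eq, C_1, one_mul, Finsupp.prod]
  rw [eval₂_eq, coeff_sum]
  simp only [h2]
  by_cases hτ : τ ∈ G.support
  · rw [Finset.sum_eq_single_of_mem τ hτ h1, coeff_mul_monomial', if_pos le_rfl]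
    simp [constantCoeff_eq]
  · rw [Finset.sum_eq_zero fun τ' hτ' => h1 τ' hτ' (by rintro rfl; exact hτ hτ'),
      notMem_support_iff.1 hτ]
    simp

section
variable {m : ℕ} {ι : Type*} [Fintype ι] [DecidableEq ι] (κ lam : Fin m → ι)

/-- The exponents of the distinguished variables `(h, κ h)`. -/
noncomputable def mainExp (J : Fin m × ι →₀ ℕ) : Fin m →₀ ℕ :=
  Finsupp.equivFunOnFinite.symm fun h => J (h, κ h)

/-- The exponents of the variables different from `(h, κ h)` and `(h, lam h)`. -/
noncomputable def otherExp (J : Fin m × ι →₀ ℕ) : Fin m × ι →₀ ℕ :=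
  J.filter fun v => v.2 ≠ κ v.1 ∧ v.2 ≠ lam v.1

/-- Separation of the variables, with `(h, lam h)` replaced by `1`. -/
noncomputable def separate (R : Type*) [CommRing R] :
    MvPolynomial (Fin m × ι) R →+* MvPolynomial (Fin m × ι) (MvPolynomial (Fin m) R) :=
  eval₂Hom (C.comp C) fun v => if v.2 = κ v.1 then C (X v.1) else if v.2 = lam v.1 then 1 else X v

theorem separate_monomial {R : Type*} [CommRing R] (J : Fin m × ι →₀ ℕ) (c : R) :
    separate κ lam R (monomial J c) = monomial (otherExp κ lam J) (monomial (mainExp κ J) c) := by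
  rw [separate, coe_eval₂Hom, eval₂_monomial, Finsupp.prod_fintype _ _ (by simp)]
  have h1 : ∀ v : Fin m × ι, (if v.2 = κ v.1 then (C (X v.1) :
      MvPolynomial (Fin m × ι) (MvPolynomial (Fin m) R)) else if v.2 = lam v.1 then 1 else X v) ^ J v
      = C ((if v.2 = κ v.1 then X v.1 else 1) ^ J v) * X v ^ (otherExp κ lam J v) := by
    intro v
    rw [otherExp, Finsupp.filter_apply]
    by_cases h1 : v.2 = κ v.1
    · simp [h1]
    · by_cases h2 : v.2 = lam v.1
      · rw [if_neg h1, if_pos h2, if_neg h1, if_neg fun h => h.2 h2]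
        simp
      · rw [if_neg h1, if_neg h2, if_neg h1, if_pos ⟨h1, h2⟩]
        simp
  rw [Finset.prod_congr rfl fun v _ => h1 v, Finset.prod_mul_distrib, ← map_prod]
  have h2 : ∏ v : Fin m × ι, (if v.2 = κ v.1 then (X v.1 : MvPolynomial (Fin m) R) else 1) ^ J v
      = ∏ h, X h ^ mainExp κ J h := by
    rw [Fintype.prod_prod_type]
    refine Finset.prod_congr rfl fun h _ => ?_
    rw [Finset.prod_eq_single (κ h)]
    · simp [mainExp]
    · intro l _ hl
      simp [hl]
    · simp
  rw [h2, RingHom.comp_apply, ← mul_assoc, ← C_mul]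
  rw [monomial_eq (s := otherExp κ lam J), monomial_eq (s := mainExp κ J),
    Finsupp.prod_fintype _ _ (by simp), Finsupp.prod_fintype _ _ (by simp)]

theorem coeff_separate {R : Type*} [CommRing R] (F : MvPolynomial (Fin m × ι) R)
    (τ : Fin m × ι →₀ ℕ) : (separate κ lam R F).coeff τ
      = ∑ J ∈ F.support with otherExp κ lam J = τ, monomial (mainExp κ J) (F.coeff J) := by
  classical
  conv_lhs => rw [F.as_sum, map_sum, coeff_sum]
  rw [Finset.sum_filter]
  exact Finset.sum_congr rfl fun J _ => by rw [separate_monomial, coeff_monomial]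

theorem OrdGE.coeff_separate {R : Type*} [CommRing R] {u : Fin m → ℝ} {c : ℝ}
    {F : MvPolynomial (Fin m × ι) R}
    (h : OrdGE (fun v : Fin m × ι => if v.2 = κ v.1 then u v.1 else 0) c F) (τ : Fin m × ι →₀ ℕ) :
    OrdGE u c ((separate κ lam R F).coeff τ) := by
  classical
  rw [_root_.coeff_separate]
  refine OrdGE.sum fun J hJ μ hμ => ?_
  rw [coeff_monomial] at hμ
  split_ifs at hμ with h1
  · have := h J (mem_support_iff.1 (Finset.mem_filter.1 hJ).1)
    refine this.trans_eq ?_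
    rw [← h1, weight_eq_sum, weight_eq_sum, Fintype.sum_prod_type]
    refine Finset.sum_congr rfl fun k _ => ?_
    rw [Finset.sum_eq_single (κ k)]
    · simp [mainExp]
    · intro l _ hl
      simp [hl]
    · simp
  · exact absurd rfl hμ

/-- The substitution `X_{h,κ h} ↦ X_{h,κ h} - ∑_{l ≠ κ h} c_{h,l} X_{h,l}`. -/
noncomputable def shear {R : Type*} [CommRing R] (c : Fin m → ι → R) :
    MvPolynomial (Fin m × ι) R →ₐ[R] MvPolynomial (Fin m × ι) R :=
  aeval fun v => if v.2 = κ v.1 then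
    X v - ∑ l ∈ Finset.univ.erase (κ v.1), C (c v.1 l) * X (v.1, l) else X v

variable {κ lam}

variable (κ lam) in
/-- The effect of `shear` on the coefficients after separation of the variables. -/
noncomputable def shearCoeff (c : Fin m → ι → ℚ) :
    MvPolynomial (Fin m) ℤ →+* MvPolynomial (Fin m × ι) (MvPolynomial (Fin m) ℚ) :=
  eval₂Hom ((C.comp C).comp (Int.castRingHom ℚ)) fun h =>
    C (X h + C (- c h (lam h))) - ∑ l ∈ (Finset.univ.erase (κ h)).erase (lam h),
      C (C (c h l)) * X (h, l)

theorem constantCoeff_shearCoeff (c : Fin m → ι → ℚ) (f : MvPolynomial (Fin m) ℤ) :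
    constantCoeff (shearCoeff κ lam c f) =
      shift (fun h => - c h (lam h)) (map (Int.castRingHom ℚ) f) := by
  have h2 : constantCoeff.comp (shearCoeff κ lam c) =
      ((shift fun h => (- c h (lam h)) : MvPolynomial (Fin m) ℚ →ₐ[ℚ] MvPolynomial (Fin m) ℚ) :
        MvPolynomial (Fin m) ℚ →+* MvPolynomial (Fin m) ℚ).comp (map (Int.castRingHom ℚ)) := by
    refine MvPolynomial.ringHom_ext (fun a => ?_) fun h => ?_
    · simp [shearCoeff]
    · simp only [shearCoeff, RingHom.comp_apply, eval₂Hom_X', map_sub, map_sum, map_mul,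
        constantCoeff_X, constantCoeff_C, mul_zero, Finset.sum_const_zero, sub_zero, map_X,
        RingHom.coe_coe, shift, aeval_X]
  exact DFunLike.congr_fun h2 f

theorem separate_shear_X (hne : ∀ h, lam h ≠ κ h) (c : Fin m → ι → ℚ) (v : Fin m × ι) :
    separate κ lam ℚ (shear κ c (map (Int.castRingHom ℚ) (X v))) =
      (separate κ lam ℤ (X v)).eval₂ (shearCoeff κ lam c) X := by
  obtain ⟨h, l⟩ := v
  by_cases h1 : l = κ h
  · subst h1
    have e1 : separate κ lam ℤ (X (h, κ h)) = C (X h) := by simp [separate]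
    have e2 : ∀ x : ℚ, separate κ lam ℚ (C x) = C (C x) := by simp [separate]
    have e3 : separate κ lam ℚ (X (h, κ h)) = C (X h) := by simp [separate]
    have e4 : separate κ lam ℚ (X (h, lam h)) = 1 := by simp [separate, hne]
    have e5 : ∀ l ∈ (Finset.univ.erase (κ h)).erase (lam h),
        separate κ lam ℚ (C (c h l) * X (h, l)) = C (C (c h l)) * X (h, l) := by
      intro l hl
      rw [Finset.mem_erase, Finset.mem_erase] at hl
      rw [map_mul, e2]
      simp [separate, hl.1, hl.2.1]
    rw [e1, eval₂_C, shearCoeff, eval₂Hom_X', map_X, shear, aeval_X, if_pos rfl, map_sub, map_sum,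
      e3, ← Finset.add_sum_erase _ _ (Finset.mem_erase.2 ⟨hne h, Finset.mem_univ (lam h)⟩),
      Finset.sum_congr rfl e5, map_mul, e2, e4, mul_one, map_add, map_neg, map_neg]
    ring
  · by_cases h2 : l = lam h
    · subst h2
      simp [separate, shear, hne h]
    · simp [separate, shear, h1, h2]

theorem separate_shear (hne : ∀ h, lam h ≠ κ h) (c : Fin m → ι → ℚ)
    (P : MvPolynomial (Fin m × ι) ℤ) :
    separate κ lam ℚ (shear κ c (map (Int.castRingHom ℚ) P)) =
      (separate κ lam ℤ P).eval₂ (shearCoeff κ lam c) X := by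
  have key : (separate κ lam ℚ).comp ((shear κ c : MvPolynomial (Fin m × ι) ℚ →+*
      MvPolynomial (Fin m × ι) ℚ).comp (map (Int.castRingHom ℚ))) =
      (eval₂Hom (shearCoeff κ lam c) X).comp (separate κ lam ℤ) := by
    refine MvPolynomial.ringHom_ext (fun a => ?_) fun v => ?_
    · simp [separate, shearCoeff]
    · exact separate_shear_X hne c v
  exact DFunLike.congr_fun key P

theorem injOn_mainExp {r : Fin m → ℕ} {J J' : Fin m × ι →₀ ℕ}
    (hJ : ∀ h, ∑ l, J (h, l) = r h) (hJ' : ∀ h, ∑ l, J' (h, l) = r h)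
    (h1 : otherExp κ lam J = otherExp κ lam J') (h2 : mainExp κ J = mainExp κ J') : J = J' := by
  have hκ : ∀ h, J (h, κ h) = J' (h, κ h) := fun h => by
    simpa [mainExp] using DFunLike.congr_fun h2 h
  have ho : ∀ h l, l ≠ κ h → l ≠ lam h → J (h, l) = J' (h, l) := fun h l hl hl' => by
    simpa [otherExp, Finsupp.filter_apply, hl, hl'] using DFunLike.congr_fun h1 (h, l)
  ext ⟨h, l⟩
  by_cases hl : l = κ h
  · subst hl; exact hκ h
  by_cases hl' : l = lam h
  · subst hl'
    have h3 := (hJ h).trans (hJ' h).symm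
    rw [← Finset.add_sum_erase _ _ (Finset.mem_univ (lam h)),
      ← Finset.add_sum_erase _ (fun l => J' (h, l)) (Finset.mem_univ (lam h))] at h3
    have h4 : ∑ l ∈ Finset.univ.erase (lam h), J (h, l)
        = ∑ l ∈ Finset.univ.erase (lam h), J' (h, l) := by
      refine Finset.sum_congr rfl fun l hl => ?_
      by_cases h5 : l = κ h
      · subst h5; exact hκ h
      · exact ho h l h5 (Finset.ne_of_mem_erase hl)
    omega
  · exact ho h l hl hl'
end

/-- Roth's lemma for hyperplanes: a multihomogeneous integral polynomial of small height does not
vanish to a high order along a product of hyperplanes of large height. -/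
theorem roth_hyperplane (m : ℕ) {ε : ℝ} (hε : 0 < ε) : ∃ ω : ℝ, 0 < ω ∧
    ∀ {ι : Type} [Fintype ι] [DecidableEq ι] (κ lam : Fin m → ι) (c : Fin m → ι → ℚ)
      (r : Fin m → ℕ) (P : MvPolynomial (Fin m × ι) ℤ) (Λ : ℝ), (∀ h, lam h ≠ κ h) →
      (∀ h, 0 < r h) → (∀ i j, i < j → (r i : ℝ) ≤ ω * r j) → P ≠ 0 →
      (∀ J ∈ P.support, ∀ h, ∑ l, J (h, l) = r h) → 0 < Λ →
      (∀ h, Λ ≤ r h * Real.log (c h (lam h)).den) →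
      Real.log (l1 zNorm P) ≤ ω * Λ → (∀ h, (r h : ℝ) ≤ ω * Λ) →
      ¬ OrdGE (fun v : Fin m × ι => if v.2 = κ v.1 then 1 / (r v.1 : ℝ) else 0) ε
        (shear κ c (map (Int.castRingHom ℚ) P)) := by
  classical
  obtain ⟨ω, hω, hroth⟩ := rothLemma m ε hε
  refine ⟨ω, hω, ?_⟩
  intro ι _ _ κ lam c r P Λ hne hr0 hr hP hhom hΛ hΛc hPΛ hrΛ hord
  obtain ⟨J₀, hJ₀, hmin⟩ : ∃ J₀ ∈ P.support, ∀ J ∈ P.support,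
      ¬ otherExp κ lam J < otherExp κ lam J₀ := by
    obtain ⟨τ, hτ⟩ := (P.support.image (otherExp κ lam)).exists_minimal
      ((support_nonempty.2 hP).image _)
    obtain ⟨J₀, hJ₀, h0⟩ := Finset.mem_image.1 hτ.prop
    refine ⟨J₀, hJ₀, fun J hJ h => ?_⟩
    rw [h0] at h
    exact hτ.not_lt (Finset.mem_image_of_mem _ hJ) h
  set τ := otherExp κ lam J₀ with hτ
  set f := (separate κ lam ℤ P).coeff τ with hf
  have hfc : f = ∑ J ∈ P.support with otherExp κ lam J = τ, monomial (mainExp κ J) (P.coeff J) :=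
    coeff_separate κ lam P τ
  have hf0 : f ≠ 0 := by
    intro h
    have h1 : f.coeff (mainExp κ J₀) = P.coeff J₀ := by
      rw [hfc, coeff_sum, Finset.sum_eq_single J₀]
      · simp
      · intro J hJ hJne
        rw [coeff_monomial, if_neg]
        intro h2
        rw [Finset.mem_filter] at hJ
        exact hJne (injOn_mainExp (hhom J hJ.1) (hhom J₀ hJ₀) hJ.2 h2)
      · intro h2
        exact absurd (Finset.mem_filter.2 ⟨hJ₀, hτ.symm⟩) h2
    rw [h, coeff_zero] at h1
    exact mem_support_iff.1 hJ₀ h1.symm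
  have hlow : ∀ τ', τ' < τ → (separate κ lam ℤ P).coeff τ' = 0 := by
    intro τ' hlt
    rw [coeff_separate]
    refine Finset.sum_eq_zero fun J hJ => ?_
    rw [Finset.mem_filter] at hJ
    exact absurd (hJ.2 ▸ hlt) (hmin J hJ.1)
  have hl1 : l1 zNorm f ≤ l1 zNorm P := by
    rw [hfc]
    refine (l1_sum _ _).trans ((Finset.sum_le_sum fun x _ => l1_monomial_le _ _).trans ?_)
    exact Finset.sum_le_sum_of_subset_of_nonneg (Finset.filter_subset _ _)
      fun _ _ _ => apply_nonneg _ _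
  have hdeg : ∀ h, f.degreeOf h ≤ r h := by
    intro h
    rw [hfc]
    refine (degreeOf_sum_le _ _ _).trans (Finset.sup_le fun J hJ => ?_)
    rw [degreeOf_monomial_eq _ _ (mem_support_iff.1 (Finset.mem_filter.1 hJ).1)]
    rw [← hhom J (Finset.mem_filter.1 hJ).1 h]
    simpa [mainExp] using Finset.single_le_sum (f := fun l => J (h, l)) (fun _ _ => Nat.zero_le _)
      (Finset.mem_univ (κ h))
  refine hroth r (fun h => (- c h (lam h)).num) (fun h => ((- c h (lam h)).den : ℤ)) f Λ hr0 hr hf0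
    hdeg (fun h => by exact_mod_cast (- c h (lam h)).den_pos)
    (fun h => Rat.isCoprime_num_den _) hΛ (fun h => ?_)
    ((Real.log_le_log (by linarith [one_le_l1 hf0]) hl1).trans hPΛ) hrΛ ?_
  · have := hΛc h
    rwa [← Rat.neg_den] at this
  · have h1 := OrdGE.coeff_separate (u := fun h => 1 / (r h : ℝ)) κ lam hord τ
    rw [separate_shear hne, coeff_eval₂_of_minimal _ _ _ hlow, ← hf, constantCoeff_shearCoeff] at h1
    convert h1 using 3
    funext h
    simpa using Rat.num_div_den (- c h (lam h))

end

section

open MvPolynomial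

section
variable {m : ℕ} {ι : Type*} [Fintype ι]

/-- The blockwise linear substitution `X_h ↦ A_h X_h`. -/
noncomputable def linSub {R : Type*} [CommRing R] (A : Fin m → Matrix ι ι R) :
    MvPolynomial (Fin m × ι) R →ₐ[R] MvPolynomial (Fin m × ι) R :=
  aeval fun v => ∑ j, C (A v.1 v.2 j) * X (v.1, j)

theorem linSub_X {R : Type*} [CommRing R] (A : Fin m → Matrix ι ι R) (v : Fin m × ι) :
    linSub A (X v) = ∑ j, C (A v.1 v.2 j) * X (v.1, j) := aeval_X _ _

theorem linSub_linSub {R : Type*} [CommRing R] (A B : Fin m → Matrix ι ι R)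
    (P : MvPolynomial (Fin m × ι) R) :
    linSub A (linSub B P) = linSub (fun h => B h * A h) P := by
  have : (linSub A).comp (linSub B) = linSub (fun h => B h * A h) := by
    refine MvPolynomial.algHom_ext fun v => ?_
    rw [AlgHom.comp_apply, linSub_X, linSub_X, map_sum]
    simp only [map_mul, linSub_X, algHom_C, Matrix.mul_apply, map_sum, Finset.mul_sum,
      Finset.sum_mul, MvPolynomial.algebraMap_eq]
    rw [Finset.sum_comm]
    exact Finset.sum_congr rfl fun i _ => Finset.sum_congr rfl fun j _ => by ring
  exact DFunLike.congr_fun this P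

theorem map_linSub {R S : Type*} [CommRing R] [CommRing S] (f : R →+* S)
    (A : Fin m → Matrix ι ι R) (P : MvPolynomial (Fin m × ι) R) :
    map f (linSub A P) = linSub (fun h => (A h).map f) (map f P) := by
  have : (map f).comp (linSub A : MvPolynomial (Fin m × ι) R →+* MvPolynomial (Fin m × ι) R) =
      (linSub (fun h => (A h).map f) : MvPolynomial (Fin m × ι) S →+*
        MvPolynomial (Fin m × ι) S).comp (map f) := by
    refine MvPolynomial.ringHom_ext (fun a => ?_) fun v => ?_
    · simp [linSub]
    · simp [linSub_X]
  exact DFunLike.congr_fun this P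

theorem shear_eq_linSub [DecidableEq ι] {R : Type*} [CommRing R] (κ : Fin m → ι) (c : Fin m → ι → R) :
    shear κ c = linSub fun h => Matrix.of fun i j =>
      if i = j then 1 else if i = κ h then - c h j else 0 := by
  refine MvPolynomial.algHom_ext fun v => ?_
  rw [linSub_X, shear, aeval_X, ← Finset.add_sum_erase _ _ (Finset.mem_univ v.2)]
  obtain ⟨h, l⟩ := v
  by_cases hl : l = κ h
  · subst hl
    rw [if_pos rfl, sub_eq_add_neg, ← Finset.sum_neg_distrib]
    congr 1
    · simp
    · refine Finset.sum_congr rfl fun i hi => ?_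
      have : κ h ≠ i := (Finset.ne_of_mem_erase hi).symm
      simp [this]
  · rw [if_neg hl]
    simp only [Matrix.of_apply, if_true, C_1, one_mul]
    rw [Finset.sum_eq_zero, add_zero]
    intro i hi
    have : l ≠ i := (Finset.ne_of_mem_erase hi).symm
    simp [this, hl]

/-- Multihomogeneity of multidegree `r`. -/
def BlockHom {R : Type*} [CommRing R] (r : Fin m → ℕ) (P : MvPolynomial (Fin m × ι) R) : Prop :=
  ∀ J ∈ P.support, ∀ h, ∑ l, J (h, l) = r h

theorem weight_block (h : Fin m) (e : ℝ) (J : Fin m × ι →₀ ℕ) :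
    Finsupp.weight (fun v : Fin m × ι => if v.1 = h then e else 0) J
      = e * (∑ l, J (h, l) : ℕ) := by
  rw [weight_eq_sum, Fintype.sum_prod_type, Finset.sum_eq_single h]
  · simp [Finset.mul_sum, mul_comm]
  · intro k _ hk
    simp [hk]
  · simp

theorem blockHom_iff {R : Type*} [CommRing R] {r : Fin m → ℕ} {P : MvPolynomial (Fin m × ι) R} :
    BlockHom r P ↔ ∀ h, OrdGE (fun v : Fin m × ι => if v.1 = h then 1 else 0) (r h) P ∧
      OrdGE (fun v : Fin m × ι => if v.1 = h then -1 else 0) (-r h) P := by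
  refine ⟨fun H h => ⟨fun J hJ => ?_, fun J hJ => ?_⟩, fun H J hJ h => ?_⟩
  · rw [weight_block, H J (mem_support_iff.2 hJ) h, one_mul]
  · rw [weight_block, H J (mem_support_iff.2 hJ) h, neg_one_mul]
  · have h1 := (H h).1 J (mem_support_iff.1 hJ)
    have h2 := (H h).2 J (mem_support_iff.1 hJ)
    rw [weight_block] at h1 h2
    rw [← Nat.cast_inj (R := ℝ)]
    linarith

theorem OrdGE.linSub {R : Type*} [CommRing R] {w : Fin m → ℝ} {c : ℝ}
    {P : MvPolynomial (Fin m × ι) R} (h : OrdGE (fun v : Fin m × ι => w v.1) c P)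
    (A : Fin m → Matrix ι ι R) : OrdGE (fun v : Fin m × ι => w v.1) c (linSub A P) := by
  refine OrdGE.aeval h _ fun v => OrdGE.sum fun j _ => ?_
  have := (OrdGE.const (w := fun v : Fin m × ι => w v.1) (le_refl 0) (A v.1 v.2 j)).mul
    (OrdGE.X (R := R) (s := (v.1, j)) (le_refl (w v.1)))
  rwa [zero_add] at this

theorem BlockHom.linSub {R : Type*} [CommRing R] {r : Fin m → ℕ} {P : MvPolynomial (Fin m × ι) R}
    (hP : BlockHom r P) (A : Fin m → Matrix ι ι R) : BlockHom r (linSub A P) := by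
  rw [blockHom_iff] at hP ⊢
  exact fun h => ⟨OrdGE.linSub (w := fun k => if k = h then 1 else 0) (hP h).1 A,
    OrdGE.linSub (w := fun k => if k = h then -1 else 0) (hP h).2 A⟩

theorem BlockHom.map {R S : Type*} [CommRing R] [CommRing S] {r : Fin m → ℕ}
    {P : MvPolynomial (Fin m × ι) R} (hP : BlockHom r P) (f : R →+* S) :
    BlockHom r (map f P) := fun J hJ => hP J (support_map_subset _ _ hJ)

theorem l1_linSub_le {R : Type*} [CommRing R] {ν : RingSeminorm R} (h1 : ν 1 ≤ 1)
    (A : Fin m → Matrix ι ι R) (K : Fin m × ι → ℝ)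
    (hK : ∀ v, ∑ j, ν (A v.1 v.2 j) ≤ K v) (P : MvPolynomial (Fin m × ι) R) :
    l1 ν (linSub A P) ≤ ∑ J ∈ P.support, ν (P.coeff J) * ∏ v, K v ^ J v := by
  have h2 := l1_eval₂_le (μ := ν) h1 (RingHom.id R) (fun v : Fin m × ι =>
    ∑ j, C (A v.1 v.2 j) * X (v.1, j)) P
  rw [RingHom.comp_id] at h2
  refine h2.trans (Finset.sum_le_sum fun J _ => mul_le_mul_of_nonneg_left ?_ (apply_nonneg _ _))
  rw [← Finset.prod_subset (Finset.subset_univ J.support)]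
  · refine Finset.prod_le_prod (fun _ _ => pow_nonneg (l1_nonneg _) _) fun v _ =>
      pow_le_pow_left₀ (l1_nonneg _) (le_trans ?_ (hK v)) _
    refine (l1_sum _ _).trans (Finset.sum_le_sum fun j _ => ?_)
    rw [show C (A v.1 v.2 j) * X (v.1, j) = monomial (Finsupp.single (v.1, j) 1) (A v.1 v.2 j) by
      rw [← C_mul_X_eq_monomial]]
    exact l1_monomial_le _ _
  · intro v _ hv
    rw [Finsupp.notMem_support_iff.1 hv, pow_zero]
end

end

section

/-- Second moment of a sum of independent centred bounded variables, in counting form. -/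
theorem sum_piFinset_sq_le {m : ℕ} {β : Type*} [DecidableEq β] (S : Fin m → Finset β)
    (f : Fin m → β → ℝ) (h0 : ∀ h, ∑ x ∈ S h, f h x = 0) (h1 : ∀ h, ∀ x ∈ S h, |f h x| ≤ 1) :
    ∑ J ∈ Fintype.piFinset S, (∑ h, f h (J h)) ^ 2 ≤ m * (Fintype.piFinset S).card := by
  have hcross : ∀ h k, h ≠ k → ∑ J ∈ Fintype.piFinset S, f h (J h) * f k (J k) = 0 := by
    intro h k hk
    have := Finset.prod_univ_sum S fun i x => if i = h then f h x else if i = k then f k x else 1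
    have e : ∀ J : Fin m → β, (∏ i, if i = h then f h (J i) else if i = k then f k (J i) else 1)
        = f h (J h) * f k (J k) := by
      intro J
      rw [← Finset.mul_prod_erase _ _ (Finset.mem_univ h),
        ← Finset.mul_prod_erase _ _ (Finset.mem_erase.2 ⟨hk.symm, Finset.mem_univ k⟩),
        Finset.prod_eq_one]
      · simp [hk.symm]
      · intro i hi
        rw [Finset.mem_erase, Finset.mem_erase] at hi
        simp [hi.1, hi.2.1]
    simp only [e] at this
    rw [← this]
    refine Finset.prod_eq_zero (Finset.mem_univ h) ?_
    simpa using h0 h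
  calc ∑ J ∈ Fintype.piFinset S, (∑ h, f h (J h)) ^ 2
      = ∑ h, ∑ k, ∑ J ∈ Fintype.piFinset S, f h (J h) * f k (J k) := by
        simp only [sq, Finset.sum_mul_sum]
        rw [Finset.sum_comm]
        exact Finset.sum_congr rfl fun h _ => Finset.sum_comm
    _ = ∑ h, ∑ J ∈ Fintype.piFinset S, f h (J h) * f h (J h) := by
        refine Finset.sum_congr rfl fun h _ => Finset.sum_eq_single h (fun k _ hk => ?_) (by simp)
        exact hcross h k hk.symm
    _ ≤ ∑ h : Fin m, ∑ J ∈ Fintype.piFinset S, (1 : ℝ) := by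
        refine Finset.sum_le_sum fun h _ => Finset.sum_le_sum fun J hJ => ?_
        have := h1 h (J h) (Fintype.mem_piFinset.1 hJ h)
        rw [← abs_mul_abs_self]
        nlinarith [abs_nonneg (f h (J h))]
    _ = m * (Fintype.piFinset S).card := by simp

theorem card_abs_gt_le {m : ℕ} {β : Type*} [DecidableEq β] (S : Fin m → Finset β)
    (f : Fin m → β → ℝ) (h0 : ∀ h, ∑ x ∈ S h, f h x = 0) (h1 : ∀ h, ∀ x ∈ S h, |f h x| ≤ 1)
    {η : ℝ} (hη : 0 < η) :
    η ^ 2 * m * ((Fintype.piFinset S).filter fun J => η * m < |∑ h, f h (J h)|).card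
      ≤ (Fintype.piFinset S).card := by
  rcases Nat.eq_zero_or_pos m with rfl | hm
  · simp
  have hm' : (0 : ℝ) < m := by exact_mod_cast hm
  have h2 := sum_piFinset_sq_le S f h0 h1
  have h3 : ∑ J ∈ (Fintype.piFinset S).filter (fun J => η * m < |∑ h, f h (J h)|), (η * m) ^ 2
      ≤ ∑ J ∈ Fintype.piFinset S, (∑ h, f h (J h)) ^ 2 := by
    refine (Finset.sum_le_sum fun J hJ => ?_).trans
      (Finset.sum_le_sum_of_subset_of_nonneg (Finset.filter_subset _ _) fun _ _ _ => sq_nonneg _)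
    rw [← sq_abs (∑ h, f h (J h))]
    exact pow_le_pow_left₀ (by positivity) (Finset.mem_filter.1 hJ).2.le 2
  rw [Finset.sum_const, nsmul_eq_mul] at h3
  refine le_of_mul_le_mul_left ?_ hm'
  calc _ = _ := by ring
    _ ≤ _ := h3.trans h2

/-- The mean of a coordinate over the compositions of `r`. -/
theorem sum_piAntidiag_coord {ι : Type*} [Fintype ι] [DecidableEq ι] (r : ℕ) (i : ι) :
    (Fintype.card ι : ℝ) * ∑ x ∈ Finset.piAntidiag (Finset.univ : Finset ι) r, (x i : ℝ)
      = r * (Finset.piAntidiag (Finset.univ : Finset ι) r).card := by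
  have hsym : ∀ j, ∑ x ∈ Finset.piAntidiag (Finset.univ : Finset ι) r, (x j : ℝ)
      = ∑ x ∈ Finset.piAntidiag (Finset.univ : Finset ι) r, (x i : ℝ) := by
    intro j
    refine Finset.sum_nbij' (fun x => x ∘ Equiv.swap i j) (fun x => x ∘ Equiv.swap i j) ?_ ?_ ?_ ?_ ?_
    · intro x hx
      simp only [Finset.mem_piAntidiag, Finset.mem_univ, implies_true, and_true] at hx ⊢
      rw [← hx]
      exact Equiv.sum_comp (Equiv.swap i j) x
    · intro x hx
      simp only [Finset.mem_piAntidiag, Finset.mem_univ, implies_true, and_true] at hx ⊢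
      rw [← hx]
      exact Equiv.sum_comp (Equiv.swap i j) x
    · intro x _
      funext l
      simp
    · intro x _
      funext l
      simp
    · intro x _
      simp
  calc _ = ∑ j : ι, ∑ x ∈ Finset.piAntidiag (Finset.univ : Finset ι) r, (x j : ℝ) := by
        rw [Finset.sum_congr rfl fun j _ => hsym j]; simp
    _ = ∑ x ∈ Finset.piAntidiag (Finset.univ : Finset ι) r, (r : ℝ) := by
        rw [Finset.sum_comm]
        refine Finset.sum_congr rfl fun x hx => ?_
        rw [← (Finset.mem_piAntidiag.1 hx).1]
        push_cast
        rfl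
    _ = _ := by simp [mul_comm]

theorem card_piAntidiag_le {ι : Type*} [Fintype ι] [DecidableEq ι] (r : ℕ) :
    (Finset.piAntidiag (Finset.univ : Finset ι) r).card ≤ (2 ^ Fintype.card ι) ^ r := by
  calc _ ≤ (Fintype.piFinset fun _ : ι => Finset.range (r + 1)).card := by
        refine Finset.card_le_card fun x hx => Fintype.mem_piFinset.2 fun i => ?_
        rw [Finset.mem_range, Nat.lt_succ_iff, ← (Finset.mem_piAntidiag.1 hx).1]
        exact Finset.single_le_sum (f := x) (fun _ _ => Nat.zero_le _) (Finset.mem_univ i)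
    _ = (r + 1) ^ Fintype.card ι := by simp
    _ ≤ (2 ^ r) ^ Fintype.card ι := Nat.pow_le_pow_left Nat.lt_two_pow_self _
    _ = _ := by rw [← pow_mul, ← pow_mul, mul_comm]

/-- Siegel's lemma when there are at least twice as many unknowns as equations. -/
theorem siegel_of_two_mul_le {A B : Type*} [Fintype A] [Fintype B] (M : Matrix A B ℤ)
    (hB : 0 < Fintype.card B) (h : 2 * Fintype.card A ≤ Fintype.card B) {K : ℝ} (hK : 1 ≤ K)
    (hM : ∀ i j, |(M i j : ℝ)| ≤ K) :
    ∃ t : B → ℤ, t ≠ 0 ∧ M.mulVec t = 0 ∧ ∀ j, |(t j : ℝ)| ≤ Fintype.card B * K := by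
  classical
  have hB' : (1 : ℝ) ≤ Fintype.card B := by exact_mod_cast hB
  rcases Nat.eq_zero_or_pos (Fintype.card A) with hA | hA
  · have := Fintype.card_eq_zero_iff.1 hA
    obtain ⟨b⟩ := Fintype.card_pos_iff.1 hB
    refine ⟨fun _ => 1, fun h => one_ne_zero (congr_fun h b), Subsingleton.elim _ _, fun j => ?_⟩
    simp only [Int.cast_one, abs_one]
    nlinarith
  · let := Matrix.seminormedAddCommGroup (m := A) (n := B) (α := ℤ)
    obtain ⟨t, ht0, ht, htn⟩ := Int.Matrix.exists_ne_zero_int_vec_norm_le M (by omega) hA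
    refine ⟨t, ht0, ht, fun j => ?_⟩
    have h1 : max 1 ‖M‖ ≤ K := by
      refine max_le hK ?_
      rw [Matrix.norm_le_iff (by linarith)]
      intro i j
      rw [Int.norm_eq_abs]
      exact hM i j
    have h2 : ‖t j‖ ≤ ‖t‖ := norm_le_pi_norm t j
    rw [Int.norm_eq_abs] at h2
    have h3 : (1 : ℝ) ≤ Fintype.card B * max 1 ‖M‖ := by nlinarith [le_max_left 1 ‖M‖]
    have h5 : 2 * (Fintype.card A : ℝ) ≤ Fintype.card B := by exact_mod_cast h
    have h6 : (0 : ℝ) < Fintype.card A := by exact_mod_cast hA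
    have h4 : (Fintype.card A : ℝ) / (Fintype.card B - Fintype.card A) ≤ 1 := by
      rw [div_le_one (by linarith)]; linarith
    calc |(t j : ℝ)| ≤ _ := h2.trans htn
      _ ≤ (Fintype.card B * max 1 ‖M‖) ^ (1 : ℝ) := Real.rpow_le_rpow_of_exponent_le h3 h4
      _ ≤ _ := by rw [Real.rpow_one]; gcongr

end

section

open Matrix

theorem exists_one_le_bound {ι : Type*} [Finite ι] (f : ι → ℝ) :
    ∃ K : ℝ, 1 ≤ K ∧ ∀ i, |f i| ≤ K := by
  obtain ⟨K, hK⟩ := (Set.finite_range fun i => |f i|).bddAbove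
  exact ⟨max 1 K, le_max_left _ _, fun i => (hK ⟨i, rfl⟩).trans (le_max_right _ _)⟩

/-- A free finite `ℤ`-algebra carries a ring seminorm that bounds the coordinates. -/
theorem exists_ringSeminorm (O : Type*) [CommRing O] [Nontrivial O] [Module.Finite ℤ O]
    [Module.Free ℤ O] : ∃ (D : ℕ) (b : Module.Basis (Fin D) ℤ O) (ν : RingSeminorm O) (K : ℝ),
      ν 1 ≤ 1 ∧ 0 ≤ K ∧ ∀ x i, |(b.repr x i : ℝ)| ≤ K * ν x := by
  classical
  let b := Module.finBasis ℤ O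
  let D := Module.finrank ℤ O
  let _ : NormedRing (Matrix (Fin D) (Fin D) ℤ) := Matrix.linftyOpNormedRing
  let ψ := Algebra.leftMulMatrix b
  have hD : 0 < D := Module.finrank_pos
  have : Nonempty (Fin D) := ⟨⟨0, hD⟩⟩
  refine ⟨D, b, 
    { toFun := fun x => ‖ψ x‖
      map_zero' := by simp
      add_le' := fun x y => by rw [map_add]; exact norm_add_le _ _
      neg' := fun x => by rw [map_neg, norm_neg]
      mul_le' := fun x y => by rw [map_mul]; exact norm_mul_le _ _ },
    ∑ j, |(b.repr 1 j : ℝ)|, ?_, Finset.sum_nonneg fun _ _ => abs_nonneg _, ?_⟩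
  · change ‖ψ 1‖ ≤ 1
    rw [map_one]
    have : NormOneClass (Matrix (Fin D) (Fin D) ℤ) := Matrix.linfty_opNormOneClass
    exact norm_one.le
  · intro x i
    change _ ≤ _ * ‖ψ x‖
    have h1 : b.repr x = ψ x *ᵥ b.repr 1 := by
      rw [Algebra.leftMulMatrix_mulVec_repr, mul_one]
    have h2 : ∀ j, |((ψ x i j : ℤ) : ℝ)| ≤ ‖ψ x‖ := by
      intro j
      have h3 := Finset.le_sup (f := fun i => ∑ j, ‖ψ x i j‖₊) (Finset.mem_univ i)
      have h4 : ‖ψ x i j‖₊ ≤ ∑ j, ‖ψ x i j‖₊ :=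
        Finset.single_le_sum (f := fun j => ‖ψ x i j‖₊) (fun _ _ => zero_le) (Finset.mem_univ j)
      rw [Matrix.linfty_opNorm_def, ← Int.norm_eq_abs]
      exact_mod_cast h4.trans h3
    rw [congr_fun h1 i, Matrix.mulVec, dotProduct]
    push_cast
    refine (Finset.abs_sum_le_sum_abs _ _).trans ?_
    rw [Finset.sum_mul]
    refine Finset.sum_le_sum fun j _ => ?_
    rw [abs_mul, mul_comm]
    exact mul_le_mul_of_nonneg_left (h2 j) (abs_nonneg _)

/-- A Liouville type lower bound for values of a fixed linear form with coefficients in an order. -/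
theorem exists_liouville {O : Type*} [CommRing O] [IsDomain O] [Module.Finite ℤ O]
    [Module.Free ℤ O] (φ : O →+* ℝ) (hφ : Function.Injective φ) {ι : Type*} [Fintype ι]
    (v : ι → O) : ∃ (D : ℕ) (c : ℝ), 0 < c ∧ ∀ (w : ι → ℤ) (H : ℝ), 1 ≤ H →
      (∀ i, |(w i : ℝ)| ≤ H) → ∑ i, (w i : O) * v i ≠ 0 →
      c ≤ |φ (∑ i, (w i : O) * v i)| * H ^ D := by
  classical
  obtain ⟨D, hD, ⟨b⟩⟩ : ∃ D, 0 < D ∧ Nonempty (Module.Basis (Fin D) ℤ O) :=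
    ⟨_, Module.finrank_pos, ⟨Module.finBasis ℤ O⟩⟩
  set ψ := Algebra.leftMulMatrix b with hψ
  obtain ⟨K, hK1, hK'⟩ := exists_one_le_bound fun x : ι × Fin D × Fin D =>
    (ψ (v x.1) x.2.1 x.2.2 : ℝ)
  have hK : ∀ k i j, |(ψ (v k) i j : ℝ)| ≤ K := fun k i j => hK' (k, i, j)
  set j₀ : Fin D := ⟨0, hD⟩
  have hb0 : φ (b j₀) ≠ 0 := (map_ne_zero_iff φ hφ).2 (b.ne_zero j₀)
  set N : ℝ := Fintype.card ι + 1 with hN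
  have hN1 : 1 ≤ N := by simp [hN]
  set c₁ : ℝ := (∑ i, |φ (b i)|) * (Nat.factorial D * (N * K) ^ D) with hc₁
  have hsum : 0 < ∑ i, |φ (b i)| :=
    Finset.sum_pos' (fun _ _ => abs_nonneg _) ⟨j₀, Finset.mem_univ _, abs_pos.2 hb0⟩
  have hc₁0 : 0 < c₁ := by positivity
  refine ⟨D, |φ (b j₀)| / c₁, div_pos (abs_pos.2 hb0) hc₁0, fun w H hH hw hx => ?_⟩
  set x := ∑ i, (w i : O) * v i with hxdef
  set M := ψ x with hM
  have hMb : ∀ i j, |(M i j : ℝ)| ≤ N * K * H := by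
    intro i j
    have h1 : M i j = ∑ k, w k * ψ (v k) i j := by
      rw [hM, hxdef, map_sum, Matrix.sum_apply]
      refine Finset.sum_congr rfl fun k _ => ?_
      rw [← zsmul_eq_mul, map_zsmul, Matrix.smul_apply, smul_eq_mul]
    rw [h1]
    push_cast
    refine (Finset.abs_sum_le_sum_abs _ _).trans ?_
    calc _ ≤ ∑ k : ι, H * K := Finset.sum_le_sum fun k _ => by
          rw [abs_mul]; exact mul_le_mul (hw k) (hK k i j) (abs_nonneg _) (by linarith)
      _ = Fintype.card ι * (H * K) := by simp
      _ ≤ N * K * H := by rw [hN]; nlinarith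
  have hdet : M.det ≠ 0 := by
    have := (Algebra.norm_ne_zero_iff (R := ℤ) (S := O)).2 hx
    rwa [Algebra.norm_eq_matrix_det b] at this
  have hrow : (fun i => φ (b i)) ᵥ* (M.map (Int.cast : ℤ → ℝ)) = φ x • fun i => φ (b i) := by
    funext j
    have h1 : x * b j = ∑ i, M i j • b i := by
      conv_lhs => rw [← b.sum_repr (x * b j)]
      refine Finset.sum_congr rfl fun i _ => ?_
      rw [hM, Algebra.leftMulMatrix_eq_repr_mul]
    simp only [Matrix.vecMul, dotProduct, Matrix.map_apply, Pi.smul_apply, smul_eq_mul]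
    rw [← map_mul, h1, map_sum]
    refine Finset.sum_congr rfl fun i _ => ?_
    rw [map_zsmul, zsmul_eq_mul, mul_comm]
  set M' := M.map (Int.cast : ℤ → ℝ) with hM'
  have hdet' : M'.det = (M.det : ℝ) := by
    rw [hM', Int.cast_det]
  have hmul : M'.det * φ (b j₀) = φ x * ∑ i, φ (b i) * M'.adjugate i j₀ := by
    have h1 := congr_arg (fun u => (u ᵥ* M'.adjugate) j₀) hrow
    simp only [Matrix.vecMul_vecMul, Matrix.mul_adjugate, Matrix.vecMul_smul, Matrix.vecMul_one,
      Matrix.smul_vecMul, Pi.smul_apply, smul_eq_mul] at h1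
    exact h1
  have hadj : ∀ i, |M'.adjugate i j₀| ≤ Nat.factorial D * (N * K * H) ^ D := by
    intro i
    rw [Matrix.adjugate_apply]
    have h3 : 1 ≤ N * K * H := by
      have : 1 ≤ N * K := by nlinarith
      nlinarith
    have := Matrix.det_le (A := M'.updateRow j₀ (Pi.single i 1)) (abv := AbsoluteValue.abs)
      (x := N * K * H) (fun k l => ?_)
    · simpa using this
    · change |_| ≤ _
      rw [Matrix.updateRow_apply]
      split_ifs
      · rw [Pi.single_apply]
        split_ifs
        · simpa using h3
        · simp; linarith
      · exact hMb k l
  have hdet1 : 1 ≤ |M'.det| := by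
    rw [hdet']
    exact_mod_cast Int.one_le_abs hdet
  rw [div_le_iff₀ hc₁0]
  calc |φ (b j₀)| ≤ |M'.det| * |φ (b j₀)| := by nlinarith [abs_nonneg (φ (b j₀))]
    _ = |φ x| * |∑ i, φ (b i) * M'.adjugate i j₀| := by rw [← abs_mul, hmul, abs_mul]
    _ ≤ |φ x| * ∑ i, |φ (b i)| * (Nat.factorial D * (N * K * H) ^ D) := by
        refine mul_le_mul_of_nonneg_left ((Finset.abs_sum_le_sum_abs _ _).trans
          (Finset.sum_le_sum fun i _ => ?_)) (abs_nonneg _)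
        rw [abs_mul]
        exact mul_le_mul_of_nonneg_left (hadj i) (abs_nonneg _)
    _ = |φ x| * H ^ D * c₁ := by rw [← Finset.sum_mul, hc₁, mul_pow]; ring

end

section

open MvPolynomial

section
variable {m : ℕ} {ι : Type*} [Fintype ι] [DecidableEq ι]

/-- The exponent attached to a family of block exponents. -/
noncomputable def toExp (J : Fin m → ι → ℕ) : Fin m × ι →₀ ℕ :=
  Finsupp.equivFunOnFinite.symm fun v => J v.1 v.2

/-- The exponents of multidegree `r`. -/
def blockExp (ι : Type*) [Fintype ι] [DecidableEq ι] (r : Fin m → ℕ) : Finset (Fin m → ι → ℕ) :=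
  Fintype.piFinset fun h => Finset.piAntidiag Finset.univ (r h)

theorem mem_blockExp {r : Fin m → ℕ} {J : Fin m → ι → ℕ} :
    J ∈ blockExp ι r ↔ ∀ h, ∑ i, J h i = r h := by
  simp [blockExp, Fintype.mem_piFinset, Finset.mem_piAntidiag]

theorem card_blockExp_le (r : Fin m → ℕ) :
    (blockExp ι r).card ≤ (2 ^ Fintype.card ι) ^ ∑ h, r h := by
  rw [blockExp, Fintype.card_piFinset, ← Finset.prod_pow_eq_pow_sum]
  exact Finset.prod_le_prod' fun h _ => card_piAntidiag_le _

theorem card_blockExp_pos [Nonempty ι] (r : Fin m → ℕ) : 0 < (blockExp ι r).card := by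
  obtain ⟨i⟩ := ‹Nonempty ι›
  exact Finset.card_pos.2 ⟨fun h => Pi.single i (r h), mem_blockExp.2 fun h => by simp⟩

theorem card_unbalanced_le [Nonempty ι] (r : Fin m → ℕ) (hr : ∀ h, 0 < r h) {η : ℝ} (hη : 0 < η) :
    η ^ 2 * m * ((blockExp ι r).filter fun J => ∃ i,
      η * m < |∑ h, (J h i : ℝ) / r h - m / Fintype.card ι|).card
      ≤ Fintype.card ι * (blockExp ι r).card := by
  have hN : (1 : ℝ) ≤ Fintype.card ι := by exact_mod_cast Fintype.card_pos (α := ι)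
  have hi : ∀ i : ι, η ^ 2 * m * ((blockExp ι r).filter fun J =>
      η * m < |∑ h, (J h i : ℝ) / r h - m / Fintype.card ι|).card ≤ (blockExp ι r).card := by
    intro i
    have := card_abs_gt_le (fun h => Finset.piAntidiag (Finset.univ : Finset ι) (r h))
      (fun h x => (x i : ℝ) / r h - 1 / Fintype.card ι) (fun h => ?_) (fun h x hx => ?_) hη
    · simp only [Finset.sum_sub_distrib, Finset.sum_const, Finset.card_univ, Fintype.card_fin,
        nsmul_eq_mul, mul_one_div] at this
      exact this
    · have hrh : (0 : ℝ) < r h := by exact_mod_cast hr h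
      rw [Finset.sum_sub_distrib, ← Finset.sum_div, Finset.sum_const, nsmul_eq_mul, sub_eq_zero]
      have := sum_piAntidiag_coord (r h) i
      field_simp
      linarith
    · have hrh : (0 : ℝ) < r h := by exact_mod_cast hr h
      have h1 : x i ≤ r h := by
        rw [← (Finset.mem_piAntidiag.1 hx).1]
        exact Finset.single_le_sum (f := x) (fun _ _ => Nat.zero_le _) (Finset.mem_univ i)
      have h2 : (x i : ℝ) / r h ≤ 1 := by
        rw [div_le_one hrh]; exact_mod_cast h1
      have h3 : (0 : ℝ) ≤ (x i : ℝ) / r h := by positivity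
      have h4 : (1 : ℝ) / Fintype.card ι ≤ 1 := by rw [div_le_one (by linarith)]; exact hN
      have h5 : (0 : ℝ) ≤ 1 / Fintype.card ι := by positivity
      rw [abs_le]
      constructor <;> linarith
  have hc : ((blockExp ι r).filter fun J => ∃ i,
      η * m < |∑ h, (J h i : ℝ) / r h - m / Fintype.card ι|).card ≤
      ∑ i : ι, ((blockExp ι r).filter fun J =>
      η * m < |∑ h, (J h i : ℝ) / r h - m / Fintype.card ι|).card := by
    refine le_trans (Finset.card_le_card fun J hJ => ?_) Finset.card_biUnion_le
    rw [Finset.mem_filter] at hJ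
    obtain ⟨i, hi⟩ := hJ.2
    exact Finset.mem_biUnion.2 ⟨i, Finset.mem_univ i, Finset.mem_filter.2 ⟨hJ.1, hi⟩⟩
  calc _ ≤ η ^ 2 * m * ((∑ i : ι, ((blockExp ι r).filter fun J =>
      η * m < |∑ h, (J h i : ℝ) / r h - m / Fintype.card ι|).card : ℕ) : ℝ) := by
        gcongr
    _ = ∑ i : ι, η ^ 2 * m * ((blockExp ι r).filter fun J =>
      η * m < |∑ h, (J h i : ℝ) / r h - m / Fintype.card ι|).card := by
        push_cast; rw [Finset.mul_sum]
    _ ≤ ∑ i : ι, ((blockExp ι r).card : ℝ) := Finset.sum_le_sum fun i _ => hi i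
    _ = _ := by simp

end

theorem toExp_injective {m : ℕ} {ι : Type*} [Fintype ι] : Function.Injective (toExp : (Fin m → ι → ℕ) → _) := by
  intro J J' h
  funext k i
  simpa [toExp] using DFunLike.congr_fun h (k, i)

/-- The auxiliary polynomial: multihomogeneous, of small height, and balanced after the linear
substitution `V`. -/
theorem exists_balanced_polynomial {O : Type*} [CommRing O] [Nontrivial O] [Module.Finite ℤ O]
    [Module.Free ℤ O] {ι : Type*} [Fintype ι] [DecidableEq ι] [Nonempty ι] (V : Matrix ι ι O)
    {η : ℝ} (hη : 0 < η) : ∃ (m : ℕ) (K : ℝ), 0 < m ∧ 1 ≤ K ∧ ∀ r : Fin m → ℕ, (∀ h, 0 < r h) →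
      ∃ P : MvPolynomial (Fin m × ι) ℤ, P ≠ 0 ∧ BlockHom r P ∧ l1 zNorm P ≤ K ^ ∑ h, r h ∧
        ∀ J ∈ (linSub (fun _ => V) (map (Int.castRingHom O) P)).support, ∀ i,
          |∑ h, (J (h, i) : ℝ) / r h - m / Fintype.card ι| ≤ η * m := by
  obtain ⟨D, b, ν, K₀, hν, hK₀, hb⟩ := exists_ringSeminorm O
  obtain ⟨m, hm⟩ := exists_nat_gt (2 * D * Fintype.card ι / η ^ 2 : ℝ)
  have hm0 : 0 < m := by
    have : (0 : ℝ) < m := lt_of_le_of_lt (by positivity) hm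
    exact_mod_cast this
  rw [div_lt_iff₀ (by positivity)] at hm
  obtain ⟨K₁, hK₁1, hK₁⟩ := exists_one_le_bound fun i => ∑ j, ν (V i j)
  set N := Fintype.card ι
  set K := (2 : ℝ) ^ N * (2 ^ N) * (max 1 K₀ * K₁) with hKdef
  have hK₂ : 1 ≤ max 1 K₀ := le_max_left _ _
  have h2N : (1 : ℝ) ≤ 2 ^ N := one_le_pow₀ (by norm_num)
  have hK1 : 1 ≤ K := one_le_mul_of_one_le_of_one_le (one_le_mul_of_one_le_of_one_le h2N h2N)
    (one_le_mul_of_one_le_of_one_le hK₂ hK₁1)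
  refine ⟨m, K, hm0, hK1, fun r hr => ?_⟩
  set s := ∑ h, r h with hs
  have hs1 : 1 ≤ s := by
    rw [hs]
    exact (Nat.succ_le_of_lt (hr ⟨0, hm0⟩)).trans (Finset.single_le_sum (f := r) (fun _ _ => Nat.zero_le _)
      (Finset.mem_univ _))
  set T := blockExp ι r with hT
  have hTpos : 0 < T.card := card_blockExp_pos r
  set bad := T.filter fun J => ∃ i, η * m < |∑ h, (J h i : ℝ) / r h - m / N| with hbad
  have hcard := card_unbalanced_le (ι := ι) r hr hη
  set F : (Fin m → ι → ℕ) → MvPolynomial (Fin m × ι) O := fun I =>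
    linSub (fun _ => V) (monomial (toExp I) 1) with hF
  have hFb : ∀ I ∈ T, l1 ν (F I) ≤ K₁ ^ s := by
    intro I hI
    refine (l1_linSub_le hν _ (fun _ => K₁) (fun v => (le_abs_self _).trans (hK₁ v.2)) _).trans ?_
    have h1 : (monomial (toExp I) (1 : O)).support = {toExp I} := by
      classical
      rw [support_monomial, if_neg one_ne_zero]
    rw [h1, Finset.sum_singleton, coeff_monomial, if_pos rfl, Finset.prod_pow_eq_pow_sum]
    have h2 : ∑ v, toExp I v = s := by
      rw [Fintype.sum_prod_type, hs]
      exact Finset.sum_congr rfl fun h _ => mem_blockExp.1 hI h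
    rw [h2]
    exact mul_le_of_le_one_left (by positivity) hν
  let M : Matrix (bad × Fin D) T ℤ := fun x I => b.repr ((F I).coeff (toExp x.1.1)) x.2
  have hMb : ∀ x I, |(M x I : ℝ)| ≤ max 1 K₀ * K₁ ^ s := by
    intro x I
    refine (hb _ _).trans ?_
    exact mul_le_mul (le_max_right _ _) ((coeff_le_l1 _ _).trans (hFb I I.2))
      (apply_nonneg _ _) (by positivity)
  have hcardle : 2 * Fintype.card (bad × Fin D) ≤ Fintype.card T := by
    rw [Fintype.card_prod, Fintype.card_coe, Fintype.card_coe, Fintype.card_fin]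
    have h3 : (0 : ℝ) < η ^ 2 * m := by positivity
    have h4 : (η ^ 2 * m) * (2 * (bad.card * D) : ℝ) ≤ (η ^ 2 * m) * T.card := by
      calc (η ^ 2 * m) * (2 * (bad.card * D) : ℝ)
          = 2 * D * (η ^ 2 * m * bad.card : ℝ) := by ring
        _ ≤ 2 * D * (N * T.card : ℝ) := mul_le_mul_of_nonneg_left hcard (by positivity)
        _ = (2 * D * N : ℝ) * T.card := by ring
        _ ≤ (η ^ 2 * m) * T.card := by
          refine mul_le_mul_of_nonneg_right ?_ (by positivity)
          linarith
    exact_mod_cast le_of_mul_le_mul_left h4 h3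
  obtain ⟨t, ht0, ht, htb⟩ := siegel_of_two_mul_le M (by rwa [Fintype.card_coe]) hcardle
    (one_le_mul_of_one_le_of_one_le hK₂ (one_le_pow₀ hK₁1)) hMb
  set P : MvPolynomial (Fin m × ι) ℤ := ∑ I : T, monomial (toExp I.1) (t I) with hP
  have hPc : ∀ I : T, P.coeff (toExp I.1) = t I := by
    intro I
    rw [hP, coeff_sum, Finset.sum_eq_single I]
    · simp
    · intro I' _ hne
      rw [coeff_monomial, if_neg]
      exact fun h => hne (Subtype.ext (toExp_injective h))
    · simp
  have hPh : BlockHom r P := by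
    intro J hJ h
    obtain ⟨I, _, hI⟩ := Finset.mem_biUnion.1 (support_sum hJ)
    have h1 := support_monomial_subset hI
    rw [Finset.mem_singleton] at h1
    rw [h1]
    exact mem_blockExp.1 I.2 h
  refine ⟨P, ?_, hPh, ?_, ?_⟩
  · intro h0
    refine ht0 (funext fun I => ?_)
    rw [← hPc I, h0, coeff_zero, Pi.zero_apply]
  · have hTc : (T.card : ℝ) ≤ (2 ^ N) ^ s := by exact_mod_cast card_blockExp_le (ι := ι) r
    calc l1 zNorm P ≤ ∑ I : T, l1 zNorm (monomial (toExp I.1) (t I)) := l1_sum _ _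
      _ ≤ ∑ I : T, (T.card : ℝ) * (max 1 K₀ * K₁ ^ s) := by
          refine Finset.sum_le_sum fun I _ => (l1_monomial_le _ _).trans ?_
          have := htb I
          rw [Fintype.card_coe] at this
          exact this
      _ = T.card * (T.card * (max 1 K₀ * K₁ ^ s)) := by simp
      _ ≤ (2 ^ N) ^ s * ((2 ^ N) ^ s * (max 1 K₀ ^ s * K₁ ^ s)) := by
          gcongr
          exact le_self_pow₀ hK₂ (by omega)
      _ = K ^ s := by rw [hKdef, mul_pow, mul_pow, mul_pow]; ring
  · intro J hJ i
    have hJh := ((hPh.map (Int.castRingHom O)).linSub fun _ => V) J hJ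
    set J' : Fin m → ι → ℕ := fun h l => J (h, l) with hJ'
    have hJJ : toExp J' = J := by ext v; simp [toExp, hJ']
    have hJT : J' ∈ T := mem_blockExp.2 hJh
    by_contra! hlt
    have hJb : J' ∈ bad := Finset.mem_filter.2 ⟨hJT, i, hlt⟩
    refine mem_support_iff.1 hJ ?_
    have hexp : (linSub (fun _ => V) (map (Int.castRingHom O) P)).coeff J
        = ∑ I : T, t I • (F I).coeff J := by
      rw [hP, map_sum, map_sum, coeff_sum]
      refine Finset.sum_congr rfl fun I _ => ?_
      rw [map_monomial, hF]
      have : monomial (toExp I.1) ((Int.castRingHom O) (t I))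
          = t I • monomial (toExp I.1) (1 : O) := by
        rw [smul_monomial]; simp
      rw [this, map_zsmul, coeff_smul]
    rw [hexp, ← b.repr.map_eq_zero_iff]
    ext k
    have := congr_fun ht (⟨J', hJb⟩, k)
    simp only [Matrix.mulVec, dotProduct, M, hJJ, Pi.zero_apply] at this
    rw [map_sum, Finsupp.finsetSum_apply, Finsupp.coe_zero, Pi.zero_apply, ← this]
    refine Finset.sum_congr rfl fun I _ => ?_
    rw [map_zsmul, Finsupp.smul_apply, smul_eq_mul, mul_comm]

end

section

open MvPolynomial

/-- The absolute value as a ring seminorm on the reals. -/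
noncomputable abbrev rNorm : RingSeminorm ℝ := normRingSeminorm ℝ

theorem rNorm_one : rNorm 1 ≤ 1 := (norm_one (α := ℝ)).le

section
variable {m : ℕ} {ι : Type*} [Fintype ι]

theorem coeff_linSub_diagonal [DecidableEq ι] {R : Type*} [CommRing R] (d : Fin m → ι → R)
    (P : MvPolynomial (Fin m × ι) R) (J : Fin m × ι →₀ ℕ) :
    (linSub (fun h => Matrix.diagonal (d h)) P).coeff J = P.coeff J * ∏ v, d v.1 v.2 ^ J v := by
  have hX : ∀ v : Fin m × ι, ∑ j, C (Matrix.diagonal (d v.1) v.2 j) * X (v.1, j)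
      = (C (d v.1 v.2) * X v : MvPolynomial (Fin m × ι) R) := by
    intro v
    rw [Finset.sum_eq_single v.2]
    · simp
    · intro j _ hj
      rw [Matrix.diagonal_apply_ne _ hj.symm, C_0, zero_mul]
    · simp
  have hmon : ∀ (I : Fin m × ι →₀ ℕ) (a : R), linSub (fun h => Matrix.diagonal (d h)) (monomial I a)
      = monomial I (a * ∏ v, d v.1 v.2 ^ I v) := by
    intro I a
    rw [linSub, aeval_monomial, Finsupp.prod_fintype _ _ (by simp)]
    simp only [hX, mul_pow, Finset.prod_mul_distrib]
    rw [monomial_eq, Finsupp.prod_fintype _ _ (by simp), C_mul, map_prod]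
    simp only [C_pow, MvPolynomial.algebraMap_eq, mul_assoc]
  conv_lhs => rw [P.as_sum, map_sum, coeff_sum]
  simp only [hmon, coeff_monomial]
  rw [Finset.sum_ite_eq']
  split_ifs with h
  · rfl
  · rw [notMem_support_iff.1 h, zero_mul]

theorem balanced_exponent_le [Nonempty ι] {x : Fin m → ι → ℝ} (hx0 : ∀ h i, 0 ≤ x h i)
    (hx1 : ∀ h, ∑ i, x h i = 1) {η : ℝ}
    (hbal : ∀ i, |∑ h, x h i - m / Fintype.card ι| ≤ η * m) {g : ι → ℝ} {B δ : ℝ}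
    (hg : ∀ i, |g i| ≤ B) (hgs : ∑ i, g i ≤ -δ) {Λ : ℝ} (hΛ : 0 ≤ Λ) {L : Fin m → ℝ}
    (hL : ∀ h, Λ ≤ L h) (hL' : ∀ h, L h ≤ (1 + η) * Λ) :
    ∑ h, ∑ i, L h * (g i * x h i)
      ≤ Λ * (m * (-δ / Fintype.card ι + Fintype.card ι * B * η) + η * B * m) := by
  have hN : (0 : ℝ) < Fintype.card ι := by exact_mod_cast Fintype.card_pos (α := ι)
  have h1 : ∑ h, ∑ i, L h * (g i * x h i) = ∑ h, ∑ i, (L h - Λ) * (g i * x h i)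
      + Λ * ∑ i, g i * ∑ h, x h i := by
    rw [show ∑ i, g i * ∑ h, x h i = ∑ h, ∑ i, g i * x h i by
      rw [Finset.sum_comm]; simp only [Finset.mul_sum]]
    simp only [Finset.mul_sum, ← Finset.sum_add_distrib]
    exact Finset.sum_congr rfl fun _ _ => Finset.sum_congr rfl fun _ _ => by ring
  have h2 : ∑ h, ∑ i, (L h - Λ) * (g i * x h i) ≤ ∑ h : Fin m, η * Λ * B := by
    refine Finset.sum_le_sum fun h _ => ?_
    calc ∑ i, (L h - Λ) * (g i * x h i) ≤ ∑ i, η * Λ * (B * x h i) := by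
          refine Finset.sum_le_sum fun i _ => ?_
          have h3 : g i * x h i ≤ B * x h i :=
            mul_le_mul_of_nonneg_right ((le_abs_self _).trans (hg i)) (hx0 h i)
          have h4 : 0 ≤ L h - Λ := sub_nonneg.2 (hL h)
          have h5 : L h - Λ ≤ η * Λ := by linarith [hL' h]
          have h6 : 0 ≤ B * x h i := mul_nonneg ((abs_nonneg _).trans (hg i)) (hx0 h i)
          nlinarith
      _ = η * Λ * B := by rw [← Finset.mul_sum, ← Finset.mul_sum, hx1, mul_one]
  have h3 : ∑ i, g i * ∑ h, x h i ≤ m * (-δ / Fintype.card ι + Fintype.card ι * B * η) := by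
    have h4 : ∑ i, g i * ∑ h, x h i = ∑ i, g i * (∑ h, x h i - m / Fintype.card ι)
        + (∑ i, g i) * (m / Fintype.card ι) := by
      rw [Finset.sum_mul, ← Finset.sum_add_distrib]
      exact Finset.sum_congr rfl fun _ _ => by ring
    have h5 : ∑ i, g i * (∑ h, x h i - m / Fintype.card ι) ≤ ∑ i : ι, B * (η * m) := by
      refine Finset.sum_le_sum fun i _ => (le_abs_self _).trans ?_
      rw [abs_mul]
      exact mul_le_mul (hg i) (hbal i) (abs_nonneg _) ((abs_nonneg _).trans (hg i))
    have h6 : (∑ i, g i) * (m / Fintype.card ι) ≤ -δ * (m / Fintype.card ι) :=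
      mul_le_mul_of_nonneg_right hgs (by positivity)
    rw [Finset.sum_const, Finset.card_univ, nsmul_eq_mul] at h5
    rw [h4]
    calc _ ≤ Fintype.card ι * (B * (η * m)) + -δ * (m / Fintype.card ι) := add_le_add h5 h6
      _ = _ := by ring
  rw [h1]
  rw [Finset.sum_const, Finset.card_univ, Fintype.card_fin, nsmul_eq_mul] at h2
  calc _ ≤ m * (η * Λ * B) + Λ * (m * (-δ / Fintype.card ι + Fintype.card ι * B * η)) :=
        add_le_add h2 (mul_le_mul_of_nonneg_left h3 hΛ)
    _ = _ := by ring

theorem l1_linSub_le_of_blockHom {R : Type*} [CommRing R] {ν : RingSeminorm R} (h1 : ν 1 ≤ 1)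
    {r : Fin m → ℕ} {P : MvPolynomial (Fin m × ι) R} (hP : BlockHom r P)
    (A : Fin m → Matrix ι ι R) {K : ℝ} (hK : ∀ h i, ∑ j, ν (A h i j) ≤ K) :
    l1 ν (linSub A P) ≤ l1 ν P * K ^ ∑ h, r h := by
  refine (l1_linSub_le h1 A (fun _ => K) (fun v => hK v.1 v.2) P).trans_eq ?_
  rw [l1, Finset.sum_mul]
  refine Finset.sum_congr rfl fun J hJ => ?_
  rw [Finset.prod_pow_eq_pow_sum, Fintype.sum_prod_type, Finset.sum_congr rfl fun h _ => hP J hJ h]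

theorem l1_map_intCast_le {σ : Type*} (P : MvPolynomial σ ℤ) :
    l1 rNorm (map (Int.castRingHom ℝ) P) ≤ l1 zNorm P := by
  rw [l1_eq_of_subset _ (support_map_subset _ P), l1]
  refine Finset.sum_le_sum fun J _ => ?_
  rw [coeff_map]
  exact (Int.norm_cast_real _).le

set_option maxHeartbeats 1000000 in
/-- The index of the auxiliary polynomial along the parallelepipeds spanned by the columns of `Z`
other than `j₀` is large. -/
theorem ordGE_of_balanced [DecidableEq ι] [Nonempty ι] {r : Fin m → ℕ} (hr : ∀ h, 0 < r h)
    {P : MvPolynomial (Fin m × ι) ℤ} (hP : BlockHom r P) {K : ℝ} (hK : 1 ≤ K)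
    (hPK : l1 zNorm P ≤ K ^ ∑ h, r h) {η : ℝ} (hη : 0 ≤ η) {W W' : Matrix ι ι ℝ}
    (hWW : W * W' = 1)
    (hbal : ∀ J ∈ (linSub (fun _ => W) (map (Int.castRingHom ℝ) P)).support, ∀ i,
      |∑ h, (J (h, i) : ℝ) / r h - m / Fintype.card ι| ≤ η * m)
    {K₂ K₃ : ℝ} (hK₂ : 1 ≤ K₂) (hK₃ : 1 ≤ K₃) (hW : ∀ i, ∑ j, |W i j| ≤ K₂)
    (hW' : ∀ i j, |W' i j| ≤ K₃) {g : ι → ℝ} {B δ : ℝ} (hg : ∀ i, |g i| ≤ B)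
    (hgs : ∑ i, g i ≤ -δ) {Λ : ℝ} (hΛ : 0 ≤ Λ) {Q : Fin m → ℝ} (hQ : ∀ h, 1 < Q h)
    (hL : ∀ h, Λ ≤ r h * Real.log (Q h)) (hL' : ∀ h, r h * Real.log (Q h) ≤ (1 + η) * Λ)
    (Z : Fin m → Matrix ι ι ℤ) (j₀ κ : Fin m → ι)
    (hZ : ∀ h i j, j ≠ j₀ h → |(W' * (Z h).map (Int.cast : ℤ → ℝ)) i j| ≤ Q h ^ g i) {ε : ℝ}
    (hnum : (∑ h, r h : ℕ) * Real.log (K * K₂ * (Fintype.card ι * K₃)) +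
      Λ * (m * (-δ / Fintype.card ι + Fintype.card ι * B * η) + η * B * m + B * (1 + η) * ε) < 0) :
    OrdGE (fun v : Fin m × ι => if v.2 = j₀ v.1 then 1 / (r v.1 : ℝ) else 0) ε
      (linSub (fun h => (Z h).updateCol (j₀ h) (Pi.single (κ h) 1)) P) := by
  intro J hJ
  by_contra! hlt
  have hN1 : (1 : ℝ) ≤ Fintype.card ι := by exact_mod_cast Fintype.card_pos (α := ι)
  have hB : 0 ≤ B := (abs_nonneg _).trans (hg (Classical.arbitrary ι))
  have hr' : ∀ h, (0 : ℝ) < r h := fun h => by exact_mod_cast hr h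
  have hQ0 : ∀ h, 0 < Q h := fun h => one_pos.trans (hQ h)
  set s := ∑ h, r h with hs
  set Z' : Fin m → Matrix ι ι ℤ := fun h => (Z h).updateCol (j₀ h) (Pi.single (κ h) 1) with hZ'
  set R := linSub Z' P with hR
  set F := linSub (fun _ => W) (map (Int.castRingHom ℝ) P) with hF
  set d : Fin m → ι → ℝ := fun h j => if j = j₀ h then Q h ^ (-B) else 1 with hd
  set Y : Fin m → Matrix ι ι ℝ := fun h =>
    W' * (Z' h).map (Int.cast : ℤ → ℝ) * Matrix.diagonal (d h) with hY
  have hRF : linSub (fun h => Matrix.diagonal (d h)) (map (Int.castRingHom ℝ) R) = linSub Y F := by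
    rw [hR, map_linSub, linSub_linSub, hF, linSub_linSub]
    congr 2
    funext h
    simp only [hY, Matrix.mul_assoc]
    rw [← Matrix.mul_assoc W, hWW, Matrix.one_mul]
    rfl
  have hYb : ∀ v : Fin m × ι, ∑ j, rNorm (Y v.1 v.2 j)
      ≤ Fintype.card ι * K₃ * Q v.1 ^ g v.2 := by
    rintro ⟨h, i⟩
    have h1 : ∀ j, rNorm (Y h i j) ≤ K₃ * Q h ^ g i := by
      intro j
      change |Y h i j| ≤ _
      simp only [hY]
      rw [Matrix.mul_diagonal]
      by_cases hj : j = j₀ h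
      · have e1 : (W' * (Z' h).map (Int.cast : ℤ → ℝ)) i j = W' i (κ h) := by
          rw [Matrix.mul_apply, Finset.sum_eq_single (κ h)]
          · simp [hZ', hj]
          · intro l _ hl
            simp [hZ', hj, hl]
          · simp
        rw [e1, hd, abs_mul]
        simp only [hj, if_true]
        rw [abs_of_pos (Real.rpow_pos_of_pos (hQ0 h) _)]
        refine mul_le_mul (hW' _ _) (Real.rpow_le_rpow_of_exponent_le (hQ h).le ?_)
          (Real.rpow_nonneg (hQ0 h).le _) (by linarith)
        exact (abs_le.1 (hg i)).1
      · have e1 : (W' * (Z' h).map (Int.cast : ℤ → ℝ)) i j = (W' * (Z h).map (Int.cast : ℤ → ℝ)) i j := by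
          rw [Matrix.mul_apply, Matrix.mul_apply]
          refine Finset.sum_congr rfl fun l _ => ?_
          simp [hZ', hj]
        rw [e1, hd]
        simp only [hj, if_false, mul_one]
        refine (hZ h i j hj).trans ?_
        exact le_mul_of_one_le_left (Real.rpow_nonneg (hQ0 h).le _) hK₃
    refine (Finset.sum_le_sum fun j _ => h1 j).trans_eq ?_
    simp [mul_assoc]
  have hFh : BlockHom r F := (hP.map _).linSub _
  have hFl : l1 rNorm F ≤ (K * K₂) ^ s := by
    refine (l1_linSub_le_of_blockHom rNorm_one (hP.map (Int.castRingHom ℝ)) _ (K := K₂)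
      fun _ i => hW i).trans ?_
    rw [mul_pow]
    gcongr
    exact (l1_map_intCast_le P).trans hPK
  set E : ℝ := Λ * (m * (-δ / Fintype.card ι + Fintype.card ι * B * η) + η * B * m) with hE
  have hprod : ∀ J ∈ F.support, ∏ v : Fin m × ι, (Fintype.card ι * K₃ * Q v.1 ^ g v.2) ^ J v
      ≤ (Fintype.card ι * K₃) ^ s * Real.exp E := by
    intro J hJ
    have hJs : ∑ v, J v = s := by
      rw [Fintype.sum_prod_type, hs]
      exact Finset.sum_congr rfl fun h _ => hFh J hJ h
    simp only [mul_pow _ (Q _ ^ g _), Finset.prod_mul_distrib, Finset.prod_pow_eq_pow_sum, hJs]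
    refine mul_le_mul_of_nonneg_left ?_ (by positivity)
    have h1 : ∏ v : Fin m × ι, (Q v.1 ^ g v.2) ^ J v = Real.exp
        (∑ h, ∑ i, (r h * Real.log (Q h)) * (g i * ((J (h, i) : ℝ) / r h))) := by
      rw [← Fintype.sum_prod_type (f := fun v : Fin m × ι =>
        (r v.1 * Real.log (Q v.1)) * (g v.2 * ((J v : ℝ) / r v.1))), Real.exp_sum]
      refine Finset.prod_congr rfl fun v _ => ?_
      rw [Real.rpow_def_of_pos (hQ0 _), ← Real.exp_nat_mul]
      congr 1
      have := (hr' v.1).ne'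
      field_simp
    rw [h1]
    refine Real.exp_le_exp.2 (balanced_exponent_le (fun h i => by positivity) (fun h => ?_)
      (fun i => hbal J hJ i) hg hgs hΛ hL hL')
    rw [← Finset.sum_div, div_eq_one_iff_eq (hr' h).ne']
    exact_mod_cast hFh J hJ h
  have hcoef : |((R.coeff J : ℤ) : ℝ)| * ∏ v : Fin m × ι, d v.1 v.2 ^ J v
      ≤ (K * K₂) ^ s * ((Fintype.card ι * K₃) ^ s * Real.exp E) := by
    have h1 : ‖(linSub (fun h => Matrix.diagonal (d h)) (map (Int.castRingHom ℝ) R)).coeff J‖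
        ≤ l1 rNorm (linSub Y F) := hRF ▸ coeff_le_l1 (ν := rNorm) _ J
    rw [coeff_linSub_diagonal, coeff_map, norm_mul, Real.norm_eq_abs, Real.norm_eq_abs,
      abs_of_nonneg (a := ∏ v : Fin m × ι, d v.1 v.2 ^ J v) (Finset.prod_nonneg fun v _ =>
        pow_nonneg (by simp only [hd]; split_ifs; exacts [Real.rpow_nonneg (hQ0 _).le _,
          zero_le_one]) _)] at h1
    refine h1.trans ((l1_linSub_le rNorm_one Y _ hYb F).trans ?_)
    refine (Finset.sum_le_sum fun J' hJ' => mul_le_mul_of_nonneg_left (hprod J' hJ')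
      (apply_nonneg _ _)).trans ?_
    rw [← Finset.sum_mul]
    exact mul_le_mul_of_nonneg_right hFl (by positivity)
  have hwt : Finsupp.weight (fun v : Fin m × ι => if v.2 = j₀ v.1 then 1 / (r v.1 : ℝ) else 0) J
      = ∑ h, (J (h, j₀ h) : ℝ) / r h := by
    rw [weight_eq_sum, Fintype.sum_prod_type]
    refine Finset.sum_congr rfl fun h _ => ?_
    rw [Finset.sum_eq_single (j₀ h)]
    · simp [div_eq_mul_inv]
    · intro l _ hl
      simp [hl]
    · simp
  have hdp : Real.exp (-(B * ((1 + η) * Λ * ε))) ≤ ∏ v : Fin m × ι, d v.1 v.2 ^ J v := by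
    have h1 : ∏ v : Fin m × ι, d v.1 v.2 ^ J v
        = Real.exp (-(B * ∑ h, (r h * Real.log (Q h)) * ((J (h, j₀ h) : ℝ) / r h))) := by
      rw [Finset.mul_sum, ← Finset.sum_neg_distrib, Real.exp_sum, Fintype.prod_prod_type]
      refine Finset.prod_congr rfl fun h _ => ?_
      rw [Finset.prod_eq_single (j₀ h)]
      · simp only [hd, if_true]
        rw [Real.rpow_def_of_pos (hQ0 _), ← Real.exp_nat_mul]
        congr 1
        have := (hr' h).ne'
        field_simp
      · intro l _ hl
        simp [hd, hl]
      · simp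
    rw [h1]
    refine Real.exp_le_exp.2 (neg_le_neg (mul_le_mul_of_nonneg_left ?_ hB))
    calc _ ≤ ∑ h, ((1 + η) * Λ) * ((J (h, j₀ h) : ℝ) / r h) :=
          Finset.sum_le_sum fun h _ => mul_le_mul_of_nonneg_right (hL' h) (by positivity)
      _ ≤ (1 + η) * Λ * ε := by
          rw [← Finset.mul_sum, ← hwt]
          exact mul_le_mul_of_nonneg_left hlt.le (by positivity)
  have hR1 : (1 : ℝ) ≤ |((R.coeff J : ℤ) : ℝ)| := by exact_mod_cast Int.one_le_abs hJ
  have hkk : 0 < K * K₂ * (Fintype.card ι * K₃) := by positivity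
  have hfin : Real.exp (-(B * ((1 + η) * Λ * ε)))
      ≤ (K * K₂ * (Fintype.card ι * K₃)) ^ s * Real.exp E := by
    calc _ ≤ |((R.coeff J : ℤ) : ℝ)| * ∏ v : Fin m × ι, d v.1 v.2 ^ J v :=
          hdp.trans (le_mul_of_one_le_left ((Real.exp_pos _).le.trans hdp) hR1)
      _ ≤ _ := hcoef
      _ = _ := by rw [mul_pow (K * K₂)]; ring
  rw [← Real.exp_log (pow_pos hkk s), ← Real.exp_add, Real.exp_le_exp, Real.log_pow] at hfin
  rw [hE] at hfin
  nlinarith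
end

end

section

open MvPolynomial Matrix

section
variable {ι : Type*} [Fintype ι] [DecidableEq ι]

/-- If `w` is orthogonal to all columns of `Z` but `j₀`, then the shear matrix attached to `w`
factors through `Z` with its column `j₀` replaced by a basis vector. -/
theorem exists_factor_shear {Z : Matrix ι ι ℚ} (hZ : Z.det ≠ 0) {j₀ κ : ι} {w : ι → ℚ}
    (hwκ : w κ ≠ 0) (hw : ∀ j, j ≠ j₀ → (w ᵥ* Z) j = 0) :
    ∃ Y : Matrix ι ι ℚ, Z.updateCol j₀ (Pi.single κ 1) * Y = (Matrix.of fun i j =>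
      if i = j then 1 else if i = κ then - (w j / w κ) else 0) ∧ Y j₀ = Pi.single κ 1 := by
  set Z' := Z.updateCol j₀ (Pi.single κ 1) with hZ'
  set Φ : Matrix ι ι ℚ := Matrix.of fun i j =>
      if i = j then 1 else if i = κ then - (w j / w κ) else 0 with hΦ
  have hwZ' : w ᵥ* Z' = Pi.single j₀ (w κ) := by
    funext j
    rw [Pi.single_apply]
    split_ifs with h
    · rw [h]
      simp [hZ', Matrix.vecMul, dotProduct, Pi.single_apply]
    · rw [← hw j h]
      simp [hZ', Matrix.vecMul, dotProduct, h]
  have hwΦ : w ᵥ* Φ = Pi.single κ (w κ) := by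
    funext j
    rw [Matrix.vecMul, dotProduct, ← Finset.add_sum_erase _ _ (Finset.mem_univ j), Pi.single_apply]
    split_ifs with h
    · rw [Finset.sum_eq_zero]
      · simp [hΦ, h]
      · intro i hi
        have : i ≠ j := Finset.ne_of_mem_erase hi
        have h2 : i ≠ κ := h ▸ this
        simp [hΦ, this, h2]
    · rw [Finset.sum_eq_single κ]
      · have : κ ≠ j := fun h' => h h'.symm
        simp only [hΦ, Matrix.of_apply, if_true, this, if_false]
        field_simp
        ring
      · intro i hi hiκ
        have : i ≠ j := Finset.ne_of_mem_erase hi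
        simp [hΦ, this, hiκ]
      · intro h'
        exact absurd (Finset.mem_erase.2 ⟨fun h'' => h h''.symm, Finset.mem_univ κ⟩) h'
  have hdet : Z'.det ≠ 0 := by
    intro h0
    obtain ⟨v, hv0, hv⟩ := Matrix.exists_mulVec_eq_zero_iff.2 h0
    have h1 : v j₀ = 0 := by
      have : w ⬝ᵥ (Z' *ᵥ v) = 0 := by rw [hv, dotProduct_zero]
      rw [Matrix.dotProduct_mulVec, hwZ', single_dotProduct] at this
      exact (mul_eq_zero.1 this).resolve_left hwκ
    refine hZ (Matrix.exists_mulVec_eq_zero_iff.1 ⟨v, hv0, ?_⟩)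
    rw [← hv]
    funext i
    rw [Matrix.mulVec, Matrix.mulVec, dotProduct, dotProduct]
    refine Finset.sum_congr rfl fun j _ => ?_
    by_cases hj : j = j₀
    · rw [hj, h1, mul_zero, mul_zero]
    · simp [hZ', hj]
  have hYm : Z' * (Z'⁻¹ * Φ) = Φ := by
    rw [← Matrix.mul_assoc, Matrix.mul_nonsing_inv _ (isUnit_iff_ne_zero.2 hdet), Matrix.one_mul]
  refine ⟨Z'⁻¹ * Φ, hYm, ?_⟩
  have h1 : w ᵥ* (Z' * (Z'⁻¹ * Φ)) = Pi.single κ (w κ) := by rw [hYm, hwΦ]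
  rw [← Matrix.vecMul_vecMul, hwZ'] at h1
  funext j
  have h2 := congr_fun h1 j
  rw [Matrix.vecMul, single_dotProduct] at h2
  have h3 : (Pi.single κ (w κ) : ι → ℚ) j = w κ * (Pi.single κ 1 : ι → ℚ) j := by
    rw [Pi.single_apply, Pi.single_apply]; split_ifs <;> simp
  rw [h3] at h2
  exact mul_left_cancel₀ hwκ h2

theorem ordGE_shear {m : ℕ} {Z : Fin m → Matrix ι ι ℤ} (hZ : ∀ h, (Z h).det ≠ 0)
    {j₀ κ : Fin m → ι} {w : Fin m → ι → ℤ} (hwκ : ∀ h, w h (κ h) ≠ 0)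
    (hw : ∀ h j, j ≠ j₀ h → (w h ᵥ* Z h) j = 0) {u : Fin m → ℝ} (hu : ∀ h, 0 ≤ u h) {ε : ℝ}
    {P : MvPolynomial (Fin m × ι) ℤ}
    (hP : OrdGE (fun v : Fin m × ι => if v.2 = j₀ v.1 then u v.1 else 0) ε
      (linSub (fun h => (Z h).updateCol (j₀ h) (Pi.single (κ h) 1)) P)) :
    OrdGE (fun v : Fin m × ι => if v.2 = κ v.1 then u v.1 else 0) ε
      (shear κ (fun h l => (w h l / w h (κ h) : ℚ)) (map (Int.castRingHom ℚ) P)) := by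
  have hY : ∀ h, ∃ Y : Matrix ι ι ℚ, ((Z h).map (Int.cast : ℤ → ℚ)).updateCol (j₀ h)
      (Pi.single (κ h) 1) * Y = (Matrix.of fun i j => if i = j then 1 else if i = κ h then
        - ((w h j : ℚ) / w h (κ h)) else 0) ∧ Y (j₀ h) = Pi.single (κ h) 1 := by
    intro h
    refine exists_factor_shear (w := fun l => (w h l : ℚ)) ?_ (by exact_mod_cast hwκ h) ?_
    · rw [← Int.cast_det]
      exact_mod_cast hZ h
    · intro j hj
      have := hw h j hj
      simp only [Matrix.vecMul, dotProduct, Matrix.map_apply] at this ⊢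
      exact_mod_cast this
  choose Y hY hYj using hY
  rw [shear_eq_linSub]
  simp only [← hY]
  rw [← linSub_linSub]
  have hmap : linSub (fun h => ((Z h).map (Int.cast : ℤ → ℚ)).updateCol (j₀ h) (Pi.single (κ h) 1))
      (map (Int.castRingHom ℚ) P) = map (Int.castRingHom ℚ)
        (linSub (fun h => (Z h).updateCol (j₀ h) (Pi.single (κ h) 1)) P) := by
    rw [map_linSub]
    congr 2
    funext h
    ext i j
    simp only [Matrix.updateCol_apply, Matrix.map_apply, Pi.single_apply]
    split_ifs <;> simp
  rw [hmap]
  refine OrdGE.aeval (hP.map _) _ fun v => ?_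
  by_cases hv : v.2 = j₀ v.1
  · rw [if_pos hv, hv, hYj, Finset.sum_eq_single (κ v.1)]
    · simp only [Pi.single_eq_same, C_1, one_mul]
      exact OrdGE.X (by simp)
    · intro j _ hj
      simp [hj]
    · simp
  · rw [if_neg hv]
    refine OrdGE.of_nonneg (fun s => ?_) _
    split_ifs
    exacts [hu _, le_rfl]
end

/-- A primitive vector of large height has a quotient of coordinates of large denominator. -/
theorem exists_large_den {ι : Type*} [Fintype ι] [DecidableEq ι] {w : ι → ℤ}
    (hprim : ∀ a : ℤ, (∀ i, a ∣ w i) → IsUnit a) {κ : ι} (hκ : 1 < |w κ|) :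
    ∃ l, l ≠ κ ∧ (|w κ| : ℝ) ≤ ((w l / w κ : ℚ).den : ℝ) ^ Fintype.card ι := by
  have hκ0 : w κ ≠ 0 := by rintro h; simp [h] at hκ
  set q : ι → ℕ := fun l => (w l / w κ : ℚ).den with hq
  have hdvd : w κ ∣ (∏ l ∈ Finset.univ.erase κ, (q l : ℤ)) := by
    have h1 : ∀ i, w κ ∣ (∏ l ∈ Finset.univ.erase κ, (q l : ℤ)) * w i := by
      intro i
      by_cases hi : i = κ
      · rw [hi]; exact dvd_mul_left _ _
      · have h2 : w κ ∣ (q i : ℤ) * w i := by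
          refine ⟨(w i / w κ : ℚ).num, ?_⟩
          have h3 := Rat.mul_den_eq_num (w i / w κ : ℚ)
          have h4 : ((w κ : ℤ) : ℚ) ≠ 0 := by exact_mod_cast hκ0
          have h5 : ((q i : ℤ) * w i : ℚ) = w κ * ((w i / w κ : ℚ).num : ℚ) := by
            rw [← h3]; simp only [hq]; push_cast; field_simp
          exact_mod_cast h5
        rw [← Finset.mul_prod_erase _ _ (Finset.mem_erase.2 ⟨hi, Finset.mem_univ i⟩), mul_right_comm]
        exact h2.mul_right _
    have h2 : w κ ∣ (∏ l ∈ Finset.univ.erase κ, (q l : ℤ)) * Finset.univ.gcd w := by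
      exact (Finset.dvd_gcd fun i _ => h1 i).trans (Finset.gcd_mul_left' Finset.univ w _).dvd
    have h3 : IsUnit (Finset.univ.gcd w) := hprim _ fun i => Finset.gcd_dvd (Finset.mem_univ i)
    exact (h3.dvd_mul_right).1 h2
  have hqpos : ∀ l, 1 ≤ q l := fun l => (w l / w κ : ℚ).den_pos
  have hle : |w κ| ≤ ∏ l ∈ Finset.univ.erase κ, (q l : ℤ) := by
    refine Int.le_of_dvd (Finset.prod_pos fun l _ => ?_) ((abs_dvd _ _).2 hdvd)
    exact_mod_cast hqpos l
  have hne : (Finset.univ.erase κ).Nonempty := by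
    by_contra h
    rw [Finset.not_nonempty_iff_eq_empty] at h
    rw [h, Finset.prod_empty] at hle
    omega
  obtain ⟨l, hl, hmax⟩ := Finset.exists_max_image _ q hne
  refine ⟨l, (Finset.mem_erase.1 hl).1, ?_⟩
  have h1 : ∏ l ∈ Finset.univ.erase κ, q l ≤ q l ^ Fintype.card ι :=
    (Finset.prod_le_pow_card _ _ _ hmax).trans
      (Nat.pow_le_pow_right (hqpos l) (Finset.card_le_univ _))
  have h2 : |w κ| ≤ (q l : ℤ) ^ Fintype.card ι := hle.trans (by exact_mod_cast h1)
  have h3 : ((|w κ| : ℤ) : ℝ) ≤ (q l : ℝ) ^ Fintype.card ι := by exact_mod_cast h2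
  rwa [Int.cast_abs] at h3

end

section

open MvPolynomial Matrix

/-- A property holding for arbitrarily large reals holds along decreasing tuples with large gaps. -/
theorem exists_lacunary {p : ℝ → Prop} (hp : ∀ x, ∃ y, x ≤ y ∧ p y) (x K : ℝ) (m : ℕ) :
    ∃ y : Fin m → ℝ, (∀ h, x ≤ y h ∧ p (y h)) ∧ ∀ i j, i < j → K * y j ≤ y i := by
  induction m with
  | zero => exact ⟨Fin.elim0, fun h => h.elim0, fun i => i.elim0⟩
  | succ m ih =>
    obtain ⟨y, hy, hK⟩ := ih
    obtain ⟨y₀, hy₀, hp₀⟩ := hp (max x (∑ j, |K * y j|))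
    refine ⟨Fin.cons y₀ y, Fin.cases ⟨(le_max_left _ _).trans hy₀, hp₀⟩ hy, ?_⟩
    refine Fin.cases (Fin.cases (fun h => absurd h (lt_irrefl _)) fun j _ => ?_) fun i =>
      Fin.cases (fun h => absurd h (by simp)) fun j hij => ?_
    · simp only [Fin.cons_zero, Fin.cons_succ]
      refine (le_abs_self _).trans (le_trans ?_ ((le_max_right _ _).trans hy₀))
      exact Finset.single_le_sum (f := fun j => |K * y j|) (fun _ _ => abs_nonneg _)
        (Finset.mem_univ j)
    · simpa using hK i j (by simpa using hij)

section
variable {O : Type*} [CommRing O] [Nontrivial O] [Module.Finite ℤ O] [Module.Free ℤ O]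
  {ι : Type} [Fintype ι] [DecidableEq ι] [Nonempty ι]

/-- Approximation data at height `Q`: integer points `Z`, all but the `j₀`-th of which lie in a
box of exponents `g` and in the hyperplane orthogonal to a primitive `w` of height at least
`Q ^ c`. -/
structure ApproxData (W' : Matrix ι ι ℝ) (g : ι → ℝ) (c Q : ℝ) where
  Z : Matrix ι ι ℤ
  j₀ : ι
  w : ι → ℤ
  κ : ι
  det_ne : Z.det ≠ 0
  bound : ∀ i j, j ≠ j₀ → |(W' * Z.map (Int.cast : ℤ → ℝ)) i j| ≤ Q ^ g i
  prim : ∀ a : ℤ, (∀ i, a ∣ w i) → IsUnit a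
  orth : ∀ j, j ≠ j₀ → (w ᵥ* Z) j = 0
  height : Q ^ c ≤ |(w κ : ℝ)|

set_option maxHeartbeats 400000 in
theorem not_unbounded_approxData (φ : O →+* ℝ) (V : Matrix ι ι O) {W' : Matrix ι ι ℝ}
    (hWW : V.map φ * W' = 1) {g : ι → ℝ} (hg : ∑ i, g i < 0) {c : ℝ} (hc : 0 < c) :
    ¬ ∀ x, ∃ y, x ≤ y ∧ Nonempty (ApproxData W' g c (Real.exp y)) := by
  intro hunb
  obtain ⟨B, hB1, hB⟩ := exists_one_le_bound g
  obtain ⟨K₂, hK₂1, hK₂⟩ := exists_one_le_bound fun i => ∑ j, |V.map φ i j|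
  obtain ⟨K₃, hK₃1, hK₃⟩ := exists_one_le_bound fun v : ι × ι => W' v.1 v.2
  set N : ℝ := (Fintype.card ι : ℝ) with hN
  have hN1 : 1 ≤ N := by rw [hN]; exact_mod_cast Fintype.card_pos (α := ι)
  set δ := - ∑ i, g i with hδ
  have hδ0 : 0 < δ := by simpa [hδ] using hg
  set η := min 1 (δ / (4 * N * (N + 1) * B)) with hη
  have hη0 : 0 < η := lt_min one_pos (by positivity)
  have hη1 : η ≤ 1 := min_le_left _ _
  have hη2 : (N + 1) * B * η ≤ δ / (4 * N) := by
    calc (N + 1) * B * η ≤ (N + 1) * B * (δ / (4 * N * (N + 1) * B)) := by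
          gcongr; exact min_le_right _ _
      _ = _ := by field_simp
  obtain ⟨m, K, hm, hK1, hpoly⟩ := exists_balanced_polynomial V hη0
  have hm' : (0 : ℝ) < m := by exact_mod_cast hm
  set ε := m * δ / (8 * N * B) with hε
  have hε0 : 0 < ε := by positivity
  obtain ⟨ω, hω, hroth⟩ := roth_hyperplane m hε0
  set K' := K * K₂ * (N * K₃) with hK'
  have hK'1 : 1 ≤ K' :=
    one_le_mul_of_one_le_of_one_le (one_le_mul_of_one_le_of_one_le hK1 hK₂1)
      (one_le_mul_of_one_le_of_one_le hN1 hK₃1)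
  have hlogK' : 0 ≤ Real.log K' := Real.log_nonneg hK'1
  have hlogK : 0 ≤ Real.log K := Real.log_nonneg hK1
  set A₁ := 4 * N * Real.log K' / δ with hA₁
  set A₂ := 2 * m * N * Real.log K / (ω * c) with hA₂
  set A₃ := 2 * N / (ω * c) with hA₃
  have hA₁0 : 0 ≤ A₁ := by positivity
  have hA₂0 : 0 ≤ A₂ := by positivity
  have hA₃0 : 0 ≤ A₃ := by positivity
  obtain ⟨y, hy, hgap⟩ := exists_lacunary hunb (1 + A₁ + A₂ + A₃) (2 / ω) m
  have hdata : ∀ h, Nonempty (ApproxData W' g c (Real.exp (y h))) := fun h => (hy h).2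
  obtain ⟨𝒟⟩ : Nonempty (∀ h, ApproxData W' g c (Real.exp (y h))) := ⟨fun h => (hdata h).some⟩
  have hy1 : ∀ h, 1 + A₁ + A₂ + A₃ ≤ y h := fun h => (hy h).1
  have hy0 : ∀ h, 0 < y h := fun h => by linarith [hy1 h]
  set Λ := (∑ h, y h + 1) / η with hΛ
  have hΛ0 : 0 < Λ := by
    have : 0 ≤ ∑ h, y h := Finset.sum_nonneg fun h _ => (hy0 h).le
    positivity
  have hyΛ : ∀ h, y h ≤ η * Λ := by
    intro h
    rw [hΛ, mul_div_cancel₀ _ hη0.ne']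
    have := Finset.single_le_sum (f := y) (fun h _ => (hy0 h).le) (Finset.mem_univ h)
    linarith
  set r : Fin m → ℕ := fun h => ⌈Λ / y h⌉₊ with hr
  have hrL : ∀ h, Λ ≤ r h * y h := fun h => by
    rw [← div_le_iff₀ (hy0 h)]; exact Nat.le_ceil _
  have hrL' : ∀ h, r h * y h ≤ (1 + η) * Λ := fun h => by
    have h1 : (r h : ℝ) < Λ / y h + 1 := Nat.ceil_lt_add_one (by have := hy0 h; positivity)
    have h2 := mul_le_mul_of_nonneg_right h1.le (hy0 h).le
    rw [add_mul, div_mul_cancel₀ _ (hy0 h).ne'] at h2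
    linarith [hyΛ h]
  have hr0 : ∀ h, 0 < r h := fun h => Nat.ceil_pos.2 (by have := hy0 h; positivity)
  have hrL2 : ∀ h, r h * y h ≤ 2 * Λ := fun h => (hrL' h).trans (by gcongr; linarith)
  obtain ⟨P, hP0, hPhom, hPK, hPbal⟩ := hpoly r hr0
  have hsum : ∀ A, 0 ≤ A → (∀ h, A ≤ y h) → (∑ h, r h : ℕ) * A ≤ 2 * m * Λ := by
    intro A hA0 hA
    push_cast
    rw [Finset.sum_mul]
    calc _ ≤ ∑ h : Fin m, 2 * Λ := Finset.sum_le_sum fun h _ =>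
          (mul_le_mul_of_nonneg_left (hA h) (Nat.cast_nonneg _)).trans (hrL2 h)
      _ = _ := by simp; ring
  have hφbal : ∀ J ∈ (linSub (fun _ => V.map φ) (map (Int.castRingHom ℝ) P)).support, ∀ i,
      |∑ h, (J (h, i) : ℝ) / r h - m / N| ≤ η * m := by
    intro J hJ
    refine hPbal J ?_
    have h1 : linSub (fun _ : Fin m => V.map φ) (map (Int.castRingHom ℝ) P)
        = map φ (linSub (fun _ => V) (map (Int.castRingHom O) P)) := by
      rw [map_linSub, MvPolynomial.map_map, RingHom.ext_int (φ.comp _) (Int.castRingHom ℝ)]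
    rw [h1] at hJ
    exact support_map_subset _ _ hJ
  have hord := ordGE_of_balanced (ε := ε) (δ := δ) (B := B) hr0 hPhom hK1 hPK hη0.le hWW hφbal hK₂1 hK₃1
    (fun i => (le_abs_self _).trans (hK₂ i)) (fun i j => hK₃ (i, j)) hB (by simp [hδ]) hΛ0.le
    (Q := fun h => Real.exp (y h)) (fun h => Real.one_lt_exp_iff.2 (hy0 h))
    (by simpa using hrL) (by simpa using hrL') (fun h => (𝒟 h).Z) (fun h => (𝒟 h).j₀)
    (fun h => (𝒟 h).κ) (fun h => (𝒟 h).bound) ?_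
  · have hwκ1 : ∀ h, 1 < |(𝒟 h).w (𝒟 h).κ| := by
      intro h
      have h1 : (1 : ℝ) < |((𝒟 h).w (𝒟 h).κ : ℝ)| :=
        (Real.one_lt_rpow (Real.one_lt_exp_iff.2 (hy0 h)) hc).trans_le (𝒟 h).height
      exact_mod_cast h1
    have hwκ : ∀ h, (𝒟 h).w (𝒟 h).κ ≠ 0 := fun h h0 => by
      have := hwκ1 h
      simp [h0] at this
    choose lam hlam hden using fun h => exists_large_den (𝒟 h).prim (hwκ1 h)
    have hsh := ordGE_shear (w := fun h => (𝒟 h).w) (u := fun h => 1 / (r h : ℝ))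
      (fun h => (𝒟 h).det_ne) hwκ (fun h => (𝒟 h).orth) (fun h => by positivity) hord
    refine hroth (fun h => (𝒟 h).κ) lam
      (fun h l => ((𝒟 h).w l / (𝒟 h).w ((𝒟 h).κ) : ℚ)) r P (c * Λ / N) hlam hr0 ?_ hP0 hPhom
      (by positivity) ?_ ?_ ?_ hsh
    · intro i j hij
      have h1 := hgap i j hij
      have h2 : (r i : ℝ) * (2 / ω * y j) ≤ 2 * (r j * y j) :=
        (mul_le_mul_of_nonneg_left h1 (Nat.cast_nonneg _)).trans
          ((hrL2 i).trans (by linarith [hrL j]))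
      have h3 : (r i : ℝ) * (2 / ω * y j) = (r i / ω) * (2 * y j) := by ring
      rw [h3, mul_left_comm 2 (r j : ℝ)] at h2
      have := le_of_mul_le_mul_right h2 (by linarith [hy0 j])
      rwa [div_le_iff₀ hω, mul_comm] at this
    · intro h
      set q := ((𝒟 h).w (lam h) / (𝒟 h).w (𝒟 h).κ : ℚ).den with hq
      have h1 : Real.exp (y h) ^ c ≤ (q : ℝ) ^ Fintype.card ι := (𝒟 h).height.trans (hden h)
      have h2 := Real.log_le_log (by positivity) h1
      rw [Real.log_rpow (Real.exp_pos _), Real.log_exp, Real.log_pow, ← hN] at h2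
      rw [div_le_iff₀ (by positivity)]
      calc c * Λ ≤ c * (r h * y h) := by gcongr; exact hrL h
        _ = r h * (c * y h) := by ring
        _ ≤ r h * (N * Real.log q) := by gcongr
        _ = _ := by ring
    · have h1 : Real.log (l1 zNorm P) ≤ (∑ h, r h : ℕ) * Real.log K := by
        rw [← Real.log_pow]
        exact Real.log_le_log (one_pos.trans_le (one_le_l1 hP0)) hPK
      refine h1.trans ?_
      have h2 := hsum A₂ hA₂0 fun h => by linarith [hy1 h]
      rw [hA₂] at h2
      have h3 : (∑ h, r h : ℕ) * (2 * m * N * Real.log K / (ω * c))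
        = ((∑ h, r h : ℕ) * Real.log K) * N / (ω * c) * (2 * m) := by ring
      rw [h3, mul_comm (2 * (m : ℝ))] at h2
      have h4 := le_of_mul_le_mul_right h2 (by positivity)
      rw [div_le_iff₀ (by positivity)] at h4
      rw [← mul_div_assoc, le_div_iff₀ (by positivity)]
      linarith
    · intro h
      have h1 : r h * A₃ ≤ 2 * Λ :=
        (mul_le_mul_of_nonneg_left (by linarith [hy1 h]) (Nat.cast_nonneg _)).trans (hrL2 h)
      have h3 : r h * A₃ = r h * N / (ω * c) * 2 := by rw [hA₃]; ring
      rw [h3, mul_comm 2 Λ] at h1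
      have h4 := le_of_mul_le_mul_right h1 (by positivity)
      rw [div_le_iff₀ (by positivity)] at h4
      rw [← mul_div_assoc, le_div_iff₀ (by positivity)]
      linarith
  · have h1 : (m : ℝ) * (-δ / N + N * B * η) + η * B * m + B * (1 + η) * ε ≤ - (m * δ / (2 * N)) := by
      have h2 : B * (1 + η) * ε ≤ B * 2 * ε := by gcongr; linarith
      have h3 : B * 2 * ε = m * δ / (4 * N) := by rw [hε]; field_simp; norm_num
      have h4 := mul_le_mul_of_nonneg_left hη2 hm'.le
      have h5 : (m : ℝ) * (-δ / N + N * B * η) + η * B * m = m * ((N + 1) * B * η) - m * δ / N := by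
        ring
      have h6 : (m : ℝ) * (δ / (4 * N)) + m * δ / (4 * N) - m * δ / N = - (m * δ / (2 * N)) := by
        field_simp; norm_num
      linarith
    have h2 : (∑ h, r h : ℕ) * (A₁ + 1) ≤ 2 * m * Λ := hsum (A₁ + 1) (by positivity) fun h => by linarith [hy1 h]
    have hs0 : (0 : ℝ) < (∑ h, r h : ℕ) := by
      have : 0 < ∑ h, r h := Finset.sum_pos (fun h _ => hr0 h) ⟨⟨0, hm⟩, Finset.mem_univ _⟩
      exact_mod_cast this
    have h3 : (∑ h, r h : ℕ) * A₁ < 2 * m * Λ := by linarith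
    have h4 : (∑ h, r h : ℕ) * A₁ = (∑ h, r h : ℕ) * Real.log K' / (δ / (4 * N)) := by
      rw [hA₁]; field_simp
    rw [h4, div_lt_iff₀ (by positivity)] at h3
    have h5 := mul_le_mul_of_nonneg_left h1 hΛ0.le
    have h6 : 2 * m * Λ * (δ / (4 * N)) + Λ * -(m * δ / (2 * N)) = 0 := by field_simp; norm_num
    linarith
end

end

section

open MvPolynomial Matrix Filter

theorem exists_primitive {ι : Type*} [Fintype ι] [Nonempty ι] {u : ι → ℤ} (hu : u ≠ 0) :
    ∃ (a : ℤ) (w : ι → ℤ), a ≠ 0 ∧ u = a • w ∧ ∀ b : ℤ, (∀ i, b ∣ w i) → IsUnit b := by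
  obtain ⟨w, hw, hg⟩ := Finset.extract_gcd u (Finset.univ_nonempty (α := ι))
  refine ⟨Finset.univ.gcd u, w, ?_, ?_, ?_⟩
  · intro h
    rw [Finset.gcd_eq_zero_iff] at h
    exact hu (funext fun i => h i (Finset.mem_univ i))
  · funext i
    simpa using hw i (Finset.mem_univ i)
  · intro b hb
    have : b ∣ Finset.univ.gcd w := Finset.dvd_gcd fun i _ => hb i
    rw [hg] at this
    exact isUnit_of_dvd_one this

section
variable {ι : Type*} [Fintype ι] [DecidableEq ι]

/-- Size of a row of the adjugate of a matrix whose rows have prescribed sizes off one column. -/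
theorem abs_adjugate_le (y : Matrix ι ι ℝ) (j₀ i : ι) {a : ι → ℝ} (ha : ∀ k, 0 ≤ a k)
    (hy : ∀ k j, j ≠ j₀ → |y k j| ≤ a k) :
    |y.adjugate j₀ i| ≤ (Fintype.card ι).factorial * ∏ k ∈ Finset.univ.erase i, a k := by
  rw [adjugate_apply, det_apply]
  refine (Finset.abs_sum_le_sum_abs _ _).trans ?_
  rw [← Fintype.card_perm, ← nsmul_eq_mul]
  refine Finset.sum_le_card_nsmul _ _ _ fun σ _ => ?_
  have hp : 0 ≤ ∏ k ∈ Finset.univ.erase i, a k := Finset.prod_nonneg fun k _ => ha k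
  have hs : |Equiv.Perm.sign σ • ∏ k, (y.updateRow i (Pi.single j₀ 1)) (σ k) k|
      = ∏ k, |(y.updateRow i (Pi.single j₀ 1)) (σ k) k| := by
    rw [← Finset.abs_prod]
    rcases Int.units_eq_one_or (Equiv.Perm.sign σ) with h | h <;> simp [h]
  rw [hs]
  by_cases hσ : σ j₀ = i
  · rw [← Finset.mul_prod_erase _ _ (Finset.mem_univ j₀), hσ]
    simp only [updateRow_self, Pi.single_eq_same, abs_one, one_mul]
    have h2 : ∏ k ∈ Finset.univ.erase i, a k = ∏ k ∈ Finset.univ.erase j₀, a (σ k) := by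
      refine (Finset.prod_bij (fun k _ => σ k) ?_ ?_ ?_ ?_).symm
      · intro k hk
        refine Finset.mem_erase.2 ⟨fun h => Finset.ne_of_mem_erase hk (σ.injective (h.trans hσ.symm)), Finset.mem_univ _⟩
      · intro _ _ _ _ h; exact σ.injective h
      · intro k hk
        refine ⟨σ.symm k, Finset.mem_erase.2 ⟨fun h => Finset.ne_of_mem_erase hk ?_, Finset.mem_univ _⟩, by simp⟩
        rw [← hσ, ← h]; simp
      · simp
    rw [h2]
    refine Finset.prod_le_prod (fun _ _ => abs_nonneg _) fun k hk => ?_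
    have hk' := Finset.ne_of_mem_erase hk
    rw [updateRow_ne fun h => hk' (σ.injective (h.trans hσ.symm))]
    exact hy _ _ hk'
  · refine le_trans (le_of_eq (Finset.prod_eq_zero (Finset.mem_univ (σ.symm i)) ?_)) hp
    have : σ.symm i ≠ j₀ := fun h => hσ (by rw [← h]; simp)
    simp [this]

/-- The primitive normal vector of the hyperplane spanned by all columns but one of an integer
matrix, together with the size of its image under `V`. -/
theorem exists_normal [Nonempty ι] {W W' : Matrix ι ι ℝ} (hWW : W * W' = 1) {Z : Matrix ι ι ℤ}
    (hZ : Z.det ≠ 0) {j₀ : ι} {a : ι → ℝ} (ha : ∀ k, 0 ≤ a k)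
    (hy : ∀ k j, j ≠ j₀ → |(W' * Z.map (Int.cast : ℤ → ℝ)) k j| ≤ a k) :
    ∃ w : ι → ℤ, w ≠ 0 ∧ (∀ b : ℤ, (∀ i, b ∣ w i) → IsUnit b) ∧ (∀ j, j ≠ j₀ → (w ᵥ* Z) j = 0) ∧
      ∀ i, |∑ l, (w l : ℝ) * W l i| ≤
        |W.det| * (Fintype.card ι).factorial * ∏ k ∈ Finset.univ.erase i, a k := by
  set u : ι → ℤ := Z.adjugate j₀ with hu
  have huZ : u ᵥ* Z = Pi.single j₀ Z.det := by
    funext j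
    have := congrFun (congrFun (adjugate_mul Z) j₀) j
    rw [Matrix.mul_apply] at this
    simp only [Matrix.vecMul, dotProduct, hu]
    rw [this]
    simp [Pi.single_apply, Matrix.one_apply, eq_comm]
  have hu0 : u ≠ 0 := by
    intro h
    rw [h, zero_vecMul] at huZ
    exact hZ (by simpa using (congrFun huZ j₀).symm)
  obtain ⟨b, w, hb, huw, hprim⟩ := exists_primitive hu0
  refine ⟨w, ?_, hprim, ?_, ?_⟩
  · rintro rfl
    exact hu0 (by simpa using huw)
  · intro j hj
    have h1 := congrFun huZ j
    rw [huw, smul_vecMul, Pi.smul_apply, Pi.single_eq_of_ne hj, smul_eq_mul] at h1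
    exact (mul_eq_zero.1 h1).resolve_left hb
  · intro i
    set y := W' * Z.map (Int.cast : ℤ → ℝ) with hyd
    have hZy : Z.map (Int.cast : ℤ → ℝ) = W * y := by
      rw [hyd, ← Matrix.mul_assoc, hWW, Matrix.one_mul]
    have h1 : ∑ l, (u l : ℝ) * W l i = W.det * y.adjugate j₀ i := by
      have h2 : (Z.map (Int.cast : ℤ → ℝ)).adjugate * W = W.det • y.adjugate := by
        rw [hZy, adjugate_mul_distrib, Matrix.mul_assoc, adjugate_mul, Matrix.mul_smul, Matrix.mul_one]
      have h3 : (Z.map (Int.cast : ℤ → ℝ)).adjugate = Z.adjugate.map (Int.cast : ℤ → ℝ) :=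
        ((Int.castRingHom ℝ).map_adjugate Z).symm
      have h4 := congrFun (congrFun h2 j₀) i
      rw [h3, Matrix.mul_apply] at h4
      simpa [hu] using h4
    have h2 : ∑ l, (u l : ℝ) * W l i = b * ∑ l, (w l : ℝ) * W l i := by
      rw [Finset.mul_sum, huw]
      exact Finset.sum_congr rfl fun l _ => by simp [mul_assoc]
    have hb1 : (1 : ℝ) ≤ |(b : ℝ)| := by exact_mod_cast Int.one_le_abs hb
    calc |∑ l, (w l : ℝ) * W l i| ≤ |(b : ℝ)| * |∑ l, (w l : ℝ) * W l i| :=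
          le_mul_of_one_le_left (abs_nonneg _) hb1
      _ = |W.det| * |y.adjugate j₀ i| := by rw [← abs_mul, ← h2, h1, abs_mul]
      _ ≤ _ := by
        rw [mul_assoc]
        exact mul_le_mul_of_nonneg_left (abs_adjugate_le y j₀ i ha hy) (abs_nonneg _)
end

/-- Integer points in parallelepipeds of negative total exponent, spanning a hyperplane, span the
same hyperplane eventually. -/
theorem exists_common_normal {O : Type*} [CommRing O] [IsDomain O] [Module.Finite ℤ O]
    [Module.Free ℤ O] {ι : Type} [Fintype ι] [DecidableEq ι] [Nonempty ι] (φ : O →+* ℝ)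
    (hφ : Function.Injective φ) (V : Matrix ι ι O) {W' : Matrix ι ι ℝ} (hWW : V.map φ * W' = 1)
    {g : ι → ℝ} (hg : ∑ i, g i < 0) {Q : ℕ → ℝ} (hQ : Tendsto Q atTop atTop)
    (Z : ℕ → Matrix ι ι ℤ) (hZ : ∀ n, (Z n).det ≠ 0) (j₀ : ℕ → ι)
    (hy : ∀ n i j, j ≠ j₀ n → |(W' * (Z n).map (Int.cast : ℤ → ℝ)) i j| ≤ Q n ^ g i) :
    ∃ w : ι → ℤ, w ≠ 0 ∧ ∀ᶠ n in atTop, ∀ j, j ≠ j₀ n → (w ᵥ* Z n) j = 0 := by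
  set G := ∑ i, g i with hG
  obtain ⟨N₀, hN₀⟩ := (hQ.eventually_ge_atTop 1).exists_forall_of_atTop
  wlog hQ1 : ∀ n, 1 ≤ Q n generalizing Q Z j₀
  · obtain ⟨w, hw, h⟩ := this (Q := fun n => Q (n + N₀)) (hQ.comp (tendsto_add_atTop_nat N₀))
      (fun n => Z (n + N₀)) (fun n => hZ _) (fun n => j₀ (n + N₀)) (fun n => hy _)
      (fun n _ => hN₀ _ (by omega)) (fun n => hN₀ _ (by omega))
    refine ⟨w, hw, ?_⟩
    rw [eventually_atTop] at h ⊢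
    obtain ⟨M, hM⟩ := h
    refine ⟨M + N₀, fun n hn => ?_⟩
    obtain ⟨k, rfl⟩ := Nat.exists_eq_add_of_le' (show N₀ ≤ n by omega)
    exact hM k (by omega)
  have hQ0 : ∀ n, 0 < Q n := fun n => one_pos.trans_le (hQ1 n)
  have hprod : ∀ n i, ∏ k ∈ Finset.univ.erase i, Q n ^ g k = Q n ^ (G - g i) := by
    intro n i
    rw [← Real.rpow_sum_of_pos (hQ0 n), hG, ← Finset.add_sum_erase _ _ (Finset.mem_univ i),
      add_sub_cancel_left]
  have hnorm := fun n => exists_normal hWW (hZ n) (a := fun k => Q n ^ g k)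
    (fun k => (Real.rpow_pos_of_pos (hQ0 n) _).le) (hy n)
  simp only [hprod] at hnorm
  choose w hw0 hprim horth hW using hnorm
  set C := |(V.map φ).det| * (Fintype.card ι).factorial with hC
  have hC0 : 0 < C := by
    have h1 : (V.map φ).det ≠ 0 := by
      intro h
      have := congrArg det hWW
      rw [det_mul, h, zero_mul, det_one] at this
      exact zero_ne_one this
    have := abs_pos.2 h1
    positivity
  have hev : ∀ᶠ n in atTop, ∀ i, G < g i → ∑ l, (w n l : O) * V l i = 0 := by
    rw [eventually_all]
    intro i
    by_cases hgi : G < g i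
    swap
    · exact Eventually.of_forall fun n h => absurd h hgi
    by_contra hfreq
    rw [not_eventually] at hfreq
    obtain ⟨D, c, hc, hD⟩ := exists_liouville φ hφ fun l => V l i
    set e := (g i - G) / (2 * (D + 1)) with he
    have he0 : 0 < e := div_pos (sub_pos.2 hgi) (by positivity)
    refine not_unbounded_approxData φ V hWW hg he0 fun x => ?_
    have hlarge : ∀ᶠ n in atTop, Real.exp x ≤ Q n ∧ C / c ≤ Q n ^ (e * (D + 1)) :=
      (hQ.eventually_ge_atTop _).and
        (((tendsto_rpow_atTop (by positivity)).comp hQ).eventually_ge_atTop _)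
    obtain ⟨n, hn1, hn2, hn3⟩ := (hfreq.and_eventually hlarge).exists
    have hne : ∑ l, (w n l : O) * V l i ≠ 0 := fun h => hn1 fun _ => h
    obtain ⟨κ, -, hκ⟩ := Finset.exists_max_image Finset.univ (fun l => |w n l|) Finset.univ_nonempty
    have hκ0 : w n κ ≠ 0 := by
      intro h
      refine hw0 n (funext fun l => ?_)
      have := hκ l (Finset.mem_univ l)
      simpa [h] using this
    have hH1 : (1 : ℝ) ≤ |(w n κ : ℝ)| := by exact_mod_cast Int.one_le_abs hκ0
    have h1 := hD (w n) |(w n κ : ℝ)| hH1 (fun l => by exact_mod_cast hκ l (Finset.mem_univ l)) hne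
    have h2 : φ (∑ l, (w n l : O) * V l i) = ∑ l, (w n l : ℝ) * V.map φ l i := by simp
    rw [h2] at h1
    have h3 : c ≤ C * Q n ^ (G - g i) * |(w n κ : ℝ)| ^ (D + 1) :=
      h1.trans (mul_le_mul (hW n i) (pow_le_pow_right₀ hH1 (by omega)) (by positivity)
        (mul_nonneg hC0.le (Real.rpow_pos_of_pos (hQ0 n) _).le))
    have h4 : (Q n ^ e) ^ (D + 1) ≤ |(w n κ : ℝ)| ^ (D + 1) := by
      rw [← Real.rpow_natCast (Q n ^ e), ← Real.rpow_mul (hQ0 n).le]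
      push_cast
      set q := Q n ^ (e * (D + 1)) with hq
      have hq0 : 0 < q := Real.rpow_pos_of_pos (hQ0 n) _
      have h5 : Q n ^ (G - g i) = q⁻¹ * q⁻¹ := by
        rw [hq, ← Real.rpow_neg (hQ0 n).le, ← Real.rpow_add (hQ0 n), he]
        congr 1
        field_simp
        ring
      rw [h5] at h3
      rw [div_le_iff₀ hc] at hn3
      set H := |(w n κ : ℝ)| ^ (D + 1)
      have h6 : c * q * q ≤ C * H := by
        have := mul_le_mul_of_nonneg_right h3 (mul_nonneg hq0.le hq0.le)
        calc c * q * q = c * (q * q) := by ring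
          _ ≤ _ := this
          _ = _ := by field_simp
      have h7 : C * q ≤ C * H := le_trans (by nlinarith) h6
      exact le_of_mul_le_mul_left h7 hC0
    have h5 : Q n ^ e ≤ |(w n κ : ℝ)| := le_of_pow_le_pow_left₀ (by omega) (abs_nonneg _) h4
    refine ⟨Real.log (Q n), (Real.le_log_iff_exp_le (hQ0 n)).2 hn2, ?_⟩
    rw [Real.exp_log (hQ0 n)]
    exact ⟨⟨Z n, j₀ n, w n, κ, hZ n, hy n, hprim n, horth n, h5⟩⟩
  obtain ⟨n₁, hn₁⟩ := hev.exists
  refine ⟨w n₁, hw0 n₁, ?_⟩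
  set S := ∑ i, |∑ l, (w n₁ l : ℝ) * V.map φ l i| with hS
  have hsmall : ∀ᶠ n in atTop, S * Q n ^ G < 1 := by
    have h1 : Tendsto (fun n => S * Q n ^ G) atTop (nhds (S * 0)) := by
      refine Tendsto.const_mul _ ?_
      have := (tendsto_rpow_neg_atTop (neg_pos.2 hg)).comp hQ
      simpa [Function.comp_def] using this
    rw [mul_zero] at h1
    exact h1.eventually (gt_mem_nhds one_pos)
  filter_upwards [hsmall] with n hn j hj
  have h1 : ((w n₁ ᵥ* Z n) j : ℝ) = ∑ i, (∑ l, (w n₁ l : ℝ) * V.map φ l i) *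
      (W' * (Z n).map (Int.cast : ℤ → ℝ)) i j := by
    have h2 : (fun l => (w n₁ l : ℝ)) ᵥ* (Z n).map (Int.cast : ℤ → ℝ) =
        ((fun l => (w n₁ l : ℝ)) ᵥ* V.map φ) ᵥ* (W' * (Z n).map (Int.cast : ℤ → ℝ)) := by
      rw [vecMul_vecMul, ← Matrix.mul_assoc, hWW, Matrix.one_mul]
    have h3 := congrFun h2 j
    simp only [vecMul, dotProduct] at h3 ⊢
    push_cast
    exact h3
  have h2 : |((w n₁ ᵥ* Z n) j : ℝ)| < 1 := by
    rw [h1]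
    refine lt_of_le_of_lt ((Finset.abs_sum_le_sum_abs _ _).trans ?_) hn
    rw [hS, Finset.sum_mul]
    refine Finset.sum_le_sum fun i _ => ?_
    rw [abs_mul]
    by_cases hgi : G < g i
    · have h3 : ∑ l, (w n₁ l : ℝ) * V.map φ l i = 0 := by
        have := congrArg φ (hn₁ i hgi)
        simpa using this
      rw [h3]; simp
    · refine mul_le_mul_of_nonneg_left ((hy n i j hj).trans ?_) (abs_nonneg _)
      exact Real.rpow_le_rpow_of_exponent_le (hQ1 n) (not_lt.1 hgi)
  have h3 : |(w n₁ ᵥ* Z n) j| < 1 := by exact_mod_cast h2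
  exact Int.abs_lt_one_iff.1 h3

end

section

open Matrix

/-- A column of a unimodular integer matrix. -/
def IsUnimodularCol {ι : Type*} [Fintype ι] [DecidableEq ι] (z : ι → ℤ) : Prop :=
  ∃ (U : Matrix ι ι ℤ) (j : ι), IsUnit U.det ∧ z = fun i => U i j

theorem exists_smul_unimodularCol {ι : Type*} [Fintype ι] [DecidableEq ι] {z : ι → ℤ}
    (hz : z ≠ 0) : ∃ (a : ℤ) (u : ι → ℤ), a ≠ 0 ∧ IsUnimodularCol u ∧ z = a • u := by
  obtain ⟨n, S⟩ := Submodule.smithNormalForm (Pi.basisFun ℤ ι) (Submodule.span ℤ {z})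
  have hn : n = 1 := by
    have h1 := Module.finrank_eq_card_basis S.bN
    have h2 : LinearIndependent ℤ fun _ : Fin 1 => z :=
      LinearIndependent.of_subsingleton (0 : Fin 1) hz
    have h3 := finrank_span_eq_card h2
    rw [Set.range_const, h1] at h3
    simpa using h3
  subst hn
  have hz' : z = S.bN.repr ⟨z, Submodule.mem_span_singleton_self z⟩ 0 • S.a 0 • S.bM (S.f 0) := by
    have h1 := S.bN.sum_repr ⟨z, Submodule.mem_span_singleton_self z⟩
    rw [Fin.sum_univ_one] at h1
    have h2 := congrArg Subtype.val h1
    rw [Submodule.coe_smul, S.snf 0] at h2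
    exact h2.symm
  rw [smul_smul] at hz'
  refine ⟨_, S.bM (S.f 0), ?_, ⟨(Pi.basisFun ℤ ι).toMatrix S.bM, S.f 0, ?_, ?_⟩, hz'⟩
  · intro h
    rw [h, zero_smul] at hz'
    exact hz hz'
  · have := (Pi.basisFun ℤ ι).invertibleToMatrix S.bM
    exact Matrix.isUnit_det_of_invertible _
  · funext i
    simp [Module.Basis.toMatrix_apply]

theorem IsUnimodularCol.mulVec {ι : Type*} [Fintype ι] [DecidableEq ι] {U : Matrix ι ι ℤ}
    (hU : IsUnit U.det) (j : ι) : IsUnimodularCol fun i => U i j := ⟨U, j, hU, rfl⟩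

/-- Finitely many integer points map into a bounded region under an invertible matrix. -/
theorem finite_setOf_mulVec_le {ι : Type*} [Fintype ι] [DecidableEq ι] {M : Matrix ι ι ℝ}
    (hM : M.det ≠ 0) (R : ℝ) :
    {z : ι → ℤ | ‖M *ᵥ fun i => (z i : ℝ)‖ ≤ R}.Finite := by
  obtain ⟨K, hK1, hK⟩ := exists_one_le_bound fun v : ι × ι => M⁻¹ v.1 v.2
  refine (Set.finite_Icc (fun _ => -⌈Fintype.card ι * (K * R)⌉ : ι → ℤ)
    (fun _ => ⌈Fintype.card ι * (K * R)⌉)).subset fun z hz => ?_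
  have h1 : ∀ i, |(z i : ℝ)| ≤ Fintype.card ι * (K * R) := by
    intro i
    have h2 : (fun i => (z i : ℝ)) = M⁻¹ *ᵥ (M *ᵥ fun i => (z i : ℝ)) := by
      rw [mulVec_mulVec, nonsing_inv_mul _ (isUnit_iff_ne_zero.2 hM), one_mulVec]
    have h3 : (z i : ℝ) = ∑ j, M⁻¹ i j * (M *ᵥ fun i => (z i : ℝ)) j := congrFun h2 i
    rw [h3, ← nsmul_eq_mul]
    refine (Finset.abs_sum_le_sum_abs _ _).trans (Finset.sum_le_card_nsmul _ _ _ fun j _ => ?_)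
    rw [abs_mul]
    exact mul_le_mul (hK (i, j)) ((norm_le_pi_norm (M *ᵥ fun i => (z i : ℝ)) j).trans hz)
      (abs_nonneg _) (by linarith)
  rw [Set.mem_Icc, Pi.le_def, Pi.le_def, ← forall_and]
  intro i
  obtain ⟨h2, h3⟩ := abs_le.1 (h1 i)
  have h4 : (z i : ℝ) ≤ ⌈Fintype.card ι * (K * R)⌉ := h3.trans (Int.le_ceil _)
  have h5 : (-⌈Fintype.card ι * (K * R)⌉ : ℝ) ≤ z i := le_trans (neg_le_neg (Int.le_ceil _)) h2
  exact ⟨by exact_mod_cast h5, by exact_mod_cast h4⟩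

/-- Pivoting: determinant of a matrix in terms of its Schur complement at `(p, 0)`. -/
theorem det_eq_pivot_mul {d : ℕ} (M : Matrix (Fin (d + 1)) (Fin (d + 1)) ℝ) (p : Fin (d + 1))
    (hp : M p 0 ≠ 0) :
    |M.det| = |M p 0| * |(Matrix.of fun i j : Fin d => M (p.succAbove i) j.succ -
      M p j.succ / M p 0 * M (p.succAbove i) 0).det| := by
  set T : Matrix (Fin (d + 1)) (Fin (d + 1)) ℝ :=
    Matrix.of fun i j => if j = 0 then M i 0 else M i j - M p j / M p 0 * M i 0 with hT
  have h1 : M.det = T.det := by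
    rw [← det_transpose M, ← det_transpose T]
    refine det_eq_of_forall_row_eq_smul_add_const (fun j => if j = 0 then 0 else M p j / M p 0)
      0 (by simp) fun j i => ?_
    by_cases hj : j = 0 <;> simp [hT, hj]
  have h2 : T.det = (-1) ^ (p : ℕ) * M p 0 * (T.submatrix p.succAbove Fin.succ).det := by
    rw [det_succ_row T p, Finset.sum_eq_single 0]
    · simp [hT]
    · intro j _ hj
      have : T p j = 0 := by simp [hT, hj, hp]
      rw [this]; simp
    · simp
  rw [h1, h2, abs_mul, abs_mul, abs_pow, abs_neg, abs_one, one_pow, one_mul]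
  congr 3

/-- Reduction theory: an invertible matrix has, up to a unimodular change of basis on the right and
a permutation of the rows, entries controlled by the pivots `μ`. -/
theorem exists_reduced {d : ℕ} (M : Matrix (Fin d) (Fin d) ℝ) (hM : M.det ≠ 0) :
    ∃ (x : Matrix (Fin d) (Fin d) ℤ) (π : Equiv.Perm (Fin d)) (μ : Fin d → ℝ), IsUnit x.det ∧
      (∀ j, 0 < μ j) ∧ ∏ j, μ j = |M.det| ∧ (∀ i j : Fin d, (j : ℕ) = i + 1 → μ i ≤ 2 * μ j) ∧
      (∀ i j, |(M * x.map (Int.cast : ℤ → ℝ)) (π i) j| ≤ ∑ l with l ≤ i ∧ l ≤ j, μ l) ∧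
      ∀ i : Fin d, (i : ℕ) = 0 → ∀ z : Fin d → ℤ, z ≠ 0 → μ i ≤ ‖M *ᵥ fun l => (z l : ℝ)‖ := by
  induction d with
  | zero => exact ⟨1, 1, 1, by simp, by simp, by simp, fun i => i.elim0, fun i => i.elim0,
      fun i => i.elim0⟩
  | succ d ih =>
    set f : (Fin (d + 1) → ℤ) → ℝ := fun z => ‖M *ᵥ fun l => (z l : ℝ)‖ with hf
    obtain ⟨z₀, hz₀, hmin⟩ : ∃ z₀, IsUnimodularCol z₀ ∧ ∀ z, IsUnimodularCol z → f z₀ ≤ f z := by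
      have h1 : IsUnimodularCol (fun i => (1 : Matrix (Fin (d + 1)) (Fin (d + 1)) ℤ) i 0) :=
        ⟨1, 0, by simp, rfl⟩
      obtain ⟨z₀, ⟨hz₀, hz₀'⟩, h2⟩ := Set.exists_min_image
        ({z | f z ≤ f (fun i => (1 : Matrix (Fin (d + 1)) (Fin (d + 1)) ℤ) i 0)} ∩
          {z | IsUnimodularCol z}) f ((finite_setOf_mulVec_le hM _).inter_of_left _) ⟨_, Set.mem_ofPred.2 le_rfl, h1⟩
      refine ⟨z₀, hz₀', fun z hz => ?_⟩
      by_cases h : f z ≤ f (fun i => (1 : Matrix (Fin (d + 1)) (Fin (d + 1)) ℤ) i 0)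
      · exact h2 z ⟨h, hz⟩
      · exact (show f z₀ ≤ _ from hz₀).trans (not_le.1 h).le
    obtain ⟨U, j, hU, hUz⟩ := hz₀
    wlog hj : j = 0 generalizing U j
    · refine this (U.submatrix id (Equiv.swap j 0)) 0 ?_ ?_ rfl
      · rw [det_permute']
        exact ((Units.isUnit _).map (Int.castRingHom ℤ)).mul hU
      · rw [hUz]; funext i; simp
    subst hj
    set M' := M * U.map (Int.cast : ℤ → ℝ) with hM'
    have hdetU : |((U.map (Int.cast : ℤ → ℝ)).det)| = 1 := by
      have h1 : (U.map (Int.cast : ℤ → ℝ)).det = ((U.det : ℤ) : ℝ) := (Int.cast_det U).symm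
      rw [h1]
      have := Int.isUnit_iff_abs_eq.1 hU
      exact_mod_cast this
    have hdetM' : |M'.det| = |M.det| := by rw [hM', det_mul, abs_mul, hdetU, mul_one]
    have hcol : ∀ i, (M *ᵥ fun l => (z₀ l : ℝ)) i = M' i 0 := by
      intro i
      rw [hUz]
      simp [hM', mulVec, dotProduct, Matrix.mul_apply]
    obtain ⟨p, -, hp⟩ := Finset.exists_max_image Finset.univ (fun i => |M' i 0|) Finset.univ_nonempty
    have hfz₀ : f z₀ = |M' p 0| := by
      refine le_antisymm ((pi_norm_le_iff_of_nonneg (abs_nonneg _)).2 fun i => ?_) ?_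
      · rw [hcol]; exact hp i (Finset.mem_univ i)
      · rw [← hcol]; exact norm_le_pi_norm (M *ᵥ fun l => (z₀ l : ℝ)) p
    have hp0 : M' p 0 ≠ 0 := by
      intro h
      have : M'.det = 0 := det_eq_zero_of_column_eq_zero 0 fun i => by
        have := hp i (Finset.mem_univ i)
        simpa [h] using this
      rw [this, abs_zero] at hdetM'
      exact hM (abs_eq_zero.1 hdetM'.symm)
    set M'' : Matrix (Fin d) (Fin d) ℝ := Matrix.of fun i j => M' (p.succAbove i) j.succ -
      M' p j.succ / M' p 0 * M' (p.succAbove i) 0 with hM''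
    have hdet : |M.det| = |M' p 0| * |M''.det| := by
      rw [← hdetM']; exact det_eq_pivot_mul M' p hp0
    have hM''0 : M''.det ≠ 0 := by
      intro h
      rw [h, abs_zero, mul_zero] at hdet
      exact hM (abs_eq_zero.1 hdet)
    obtain ⟨x, π, μ, hx, hμ, hprod, hstep, hbound, -⟩ := ih M'' hM''0
    set t : Fin d → ℝ := fun j => (∑ l, M' p (Fin.succ l) * x l j) / M' p 0 with ht
    set X : Matrix (Fin (d + 1)) (Fin (d + 1)) ℤ := Matrix.of (Fin.cons
      (Fin.cons 1 fun j => - round (t j)) fun i => Fin.cons 0 (x i)) with hX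
    have hXdet : X.det = x.det := by
      rw [det_succ_column_zero, Fin.sum_univ_succ]
      simp [hX]
      congr 1
    have hM'X0 : ∀ i, (M' * X.map (Int.cast : ℤ → ℝ)) i 0 = M' i 0 := by
      intro i
      simp [Matrix.mul_apply, Fin.sum_univ_succ, hX]
    have hM'X : ∀ i j, (M' * X.map (Int.cast : ℤ → ℝ)) i (Fin.succ j)
        = ∑ l, M' i (Fin.succ l) * x l j - M' i 0 * round (t j) := by
      intro i j
      simp [Matrix.mul_apply, Fin.sum_univ_succ, hX]
      ring
    have hrow : ∀ j, |(M' * X.map (Int.cast : ℤ → ℝ)) p (Fin.succ j)| ≤ |M' p 0| / 2 := by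
      intro j
      have h1 : (M' * X.map (Int.cast : ℤ → ℝ)) p (Fin.succ j) = M' p 0 * (t j - round (t j)) := by
        rw [hM'X, mul_sub, ht]
        field_simp
      rw [h1, abs_mul]
      have := abs_sub_round (t j)
      nlinarith [abs_nonneg (M' p 0)]
    have hother : ∀ i j, |(M' * X.map (Int.cast : ℤ → ℝ)) (p.succAbove i) (Fin.succ j)| ≤
        |(M'' * x.map (Int.cast : ℤ → ℝ)) i j| + |M' p 0| / 2 := by
      intro i j
      have h1 : (M' * X.map (Int.cast : ℤ → ℝ)) (p.succAbove i) (Fin.succ j)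
          = (M'' * x.map (Int.cast : ℤ → ℝ)) i j + M' (p.succAbove i) 0 * (t j - round (t j)) := by
        rw [hM'X, Matrix.mul_apply, mul_sub, ht]
        simp only [hM'', Matrix.of_apply, Matrix.map_apply, sub_mul, Finset.sum_sub_distrib]
        have h2 : ∑ l, M' p (Fin.succ l) / M' p 0 * M' (p.succAbove i) 0 * (x l j : ℝ)
          = M' (p.succAbove i) 0 * ((∑ l, M' p (Fin.succ l) * x l j) / M' p 0) := by
          rw [Finset.sum_div, Finset.mul_sum]
          exact Finset.sum_congr rfl fun l _ => by ring
        rw [h2]; ring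
      rw [h1]
      refine (abs_add_le _ _).trans (add_le_add_right ?_ _)
      rw [abs_mul]
      have := abs_sub_round (t j)
      nlinarith [abs_nonneg (M' p 0), abs_nonneg (M' (p.succAbove i) 0), hp (p.succAbove i) (Finset.mem_univ _)]
    have hUX : M * (U * X).map (Int.cast : ℤ → ℝ) = M' * X.map (Int.cast : ℤ → ℝ) := by
      rw [hM', Matrix.mul_assoc]
      congr 1
      ext i j
      exact RingHom.map_matrix_mul U X i j (Int.castRingHom ℝ)
    have hunit : IsUnit (U * X).det := by rw [det_mul, hXdet]; exact hU.mul hx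
    have hinj : Function.Injective (Fin.cons p fun i => p.succAbove (π i) : Fin (d + 1) → Fin (d + 1)) := by
      rw [Fin.cons_injective_iff]
      refine ⟨?_, p.succAbove_right_injective.comp π.injective⟩
      rintro ⟨i, hi⟩
      exact Fin.succAbove_ne _ _ hi
    have hS : ∀ i j : Fin d, ∑ l with l ≤ i.succ ∧ l ≤ j.succ, (Fin.cons |M' p 0| μ : Fin (d + 1) → ℝ) l
        = |M' p 0| + ∑ l with l ≤ i ∧ l ≤ j, μ l := by
      intro i j
      rw [Finset.sum_filter, Fin.sum_univ_succ, Finset.sum_filter]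
      simp
    have hS0 : ∀ i j : Fin (d + 1), |M' p 0| ≤
        ∑ l with l ≤ i ∧ l ≤ j, (Fin.cons |M' p 0| μ : Fin (d + 1) → ℝ) l := by
      intro i j
      refine Finset.single_le_sum (f := (Fin.cons |M' p 0| μ : Fin (d + 1) → ℝ)) (fun l _ => ?_)
        (a := 0) (by simp)
      exact Fin.cases (abs_nonneg _) (fun l => (hμ l).le) l
    refine ⟨U * X, Equiv.ofBijective _ (Finite.injective_iff_bijective.1 hinj),
      Fin.cons |M' p 0| μ, hunit, ?_, ?_, ?_, ?_, ?_⟩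
    · exact Fin.cases (abs_pos.2 hp0) hμ
    · rw [Fin.prod_univ_succ, hdet, ← hprod]; simp
    · refine Fin.cases (Fin.cases (by simp) fun j hj => ?_) fun i => Fin.cases (by simp)
        fun j hj => ?_
      · have hj0 : (j : ℕ) = 0 := by simpa using hj
        simp only [Fin.cons_zero, Fin.cons_succ]
        have h1 := hmin _ (IsUnimodularCol.mulVec hunit j.succ)
        rw [hfz₀] at h1
        have h2 : f (fun i => (U * X) i j.succ) ≤ μ j + |M' p 0| / 2 := by
          refine (pi_norm_le_iff_of_nonneg (add_nonneg (hμ j).le (by positivity))).2 fun i => ?_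
          have h3 : (M *ᵥ fun l => ((U * X) l j.succ : ℝ)) i
              = (M' * X.map (Int.cast : ℤ → ℝ)) i j.succ := by
            rw [← hUX]; rfl
          rw [h3, Real.norm_eq_abs]
          rcases Fin.eq_self_or_eq_succAbove p i with rfl | ⟨k, rfl⟩
          · linarith [hrow j, hμ j]
          · refine (hother k j).trans (add_le_add_left ?_ _)
            have h4 := hbound (π.symm k) j
            rw [Equiv.apply_symm_apply] at h4
            refine h4.trans (le_of_eq (Finset.sum_eq_single_of_mem j ?_ ?_))
            · exact Finset.mem_filter.2 ⟨Finset.mem_univ _, by rw [Fin.le_def]; omega, le_rfl⟩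
            · intro l hl hlj
              refine absurd (Fin.ext ?_) hlj
              have := (Finset.mem_filter.1 hl).2.2
              rw [Fin.le_def] at this
              omega
        linarith
      · simpa using hstep i j (by simpa using hj)
    · intro i j
      rw [hUX]
      simp only [Equiv.ofBijective_apply]
      refine Fin.cases ?_ (fun j => ?_) j
      · rw [hM'X0]
        exact (hp _ (Finset.mem_univ _)).trans (hS0 _ _)
      · refine Fin.cases ?_ (fun i => ?_) i
        · refine le_trans ?_ (hS0 _ _)
          simp only [Fin.cons_zero]
          linarith [hrow j, abs_nonneg (M' p 0)]
        · rw [hS]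
          simp only [Fin.cons_succ]
          linarith [hother (π i) j, hbound i j, abs_nonneg (M' p 0)]
    · intro i hi z hz
      have : i = 0 := Fin.ext hi
      subst this
      obtain ⟨a, u, ha, hu, rfl⟩ := exists_smul_unimodularCol hz
      simp only [Fin.cons_zero]
      rw [← hfz₀]
      refine (hmin u hu).trans ?_
      have h1 : (fun l => ((a • u) l : ℝ)) = (a : ℝ) • fun l => (u l : ℝ) := by
        funext l; simp
      rw [h1, mulVec_smul, norm_smul]
      refine le_mul_of_one_le_left (norm_nonneg _) ?_
      rw [Real.norm_eq_abs]
      exact_mod_cast Int.one_le_abs ha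

/-- Davenport's lemma, with weights increasing along the basis. -/
theorem exists_davenport {d : ℕ} (M : Matrix (Fin d) (Fin d) ℝ) (hM : M.det ≠ 0) :
    ∃ (x : Matrix (Fin d) (Fin d) ℤ) (π : Equiv.Perm (Fin d)) (s : Fin d → ℝ), IsUnit x.det ∧
      (∀ j, 0 < s j) ∧ ∏ j, s j = (∏ j : Fin d, (2 : ℝ) ^ (j : ℕ)) * |M.det| ∧ Monotone s ∧
      (∀ i j, |(M * x.map (Int.cast : ℤ → ℝ)) (π i) j| ≤ d * min (s i) (s j)) ∧
      ∀ i : Fin d, (i : ℕ) = 0 → ∀ z : Fin d → ℤ, z ≠ 0 → s i ≤ ‖M *ᵥ fun l => (z l : ℝ)‖ := by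
  obtain ⟨x, π, μ, hx, hμ, hprod, hstep, hbound, hmin⟩ := exists_reduced M hM
  set s : Fin d → ℝ := fun j => 2 ^ (j : ℕ) * μ j with hs
  have hmono : Monotone s := by
    have key : ∀ n (i j : Fin d), (j : ℕ) = i + n → s i ≤ s j := by
      intro n
      induction n with
      | zero => intro i j h; rw [show i = j from Fin.ext (by omega)]
      | succ n ih =>
        intro i j h
        have hlt : (i : ℕ) + n < d := by have := j.2; omega
        refine (ih i ⟨i + n, hlt⟩ rfl).trans ?_
        have := hstep ⟨i + n, hlt⟩ j (by simp; omega)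
        simp only [hs]
        rw [show (j : ℕ) = i + n + 1 by omega, pow_succ, mul_assoc]
        exact mul_le_mul_of_nonneg_left this (by positivity)
    intro i j hij
    exact key (j - i) i j (by rw [Fin.le_def] at hij; omega)
  have hμs : ∀ j, μ j ≤ s j := fun j =>
    le_mul_of_one_le_left (hμ j).le (one_le_pow₀ one_le_two)
  refine ⟨x, π, s, hx, fun j => mul_pos (by positivity) (hμ j), ?_, hmono, fun i j => ?_, ?_⟩
  · rw [← hprod, ← Finset.prod_mul_distrib]
  · refine (hbound i j).trans ?_
    have hm0 : 0 ≤ min (s i) (s j) := le_min ((hμ i).le.trans (hμs i)) ((hμ j).le.trans (hμs j))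
    refine (Finset.sum_le_card_nsmul _ _ (min (s i) (s j)) fun l hl => ?_).trans ?_
    · obtain ⟨h1, h2⟩ := (Finset.mem_filter.1 hl).2
      exact (hμs l).trans (le_min (hmono h1) (hmono h2))
    · rw [nsmul_eq_mul]
      refine mul_le_mul_of_nonneg_right ?_ hm0
      exact_mod_cast (Finset.card_le_univ _).trans_eq (Fintype.card_fin d)
  · intro i hi z hz
    simpa [hs, hi] using hmin i hi z hz

end

section

open Matrix

/-- The `k`-th compound matrix: its entries are the `k × k` minors. -/
def compound {R : Type*} [CommRing R] {d : ℕ} (k : ℕ) (A : Matrix (Fin d) (Fin d) R) :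
    Matrix (Fin k ↪o Fin d) (Fin k ↪o Fin d) R :=
  Matrix.of fun I J => (A.submatrix I J).det

theorem compound_apply {R : Type*} [CommRing R] {d k : ℕ} (A : Matrix (Fin d) (Fin d) R)
    (I J : Fin k ↪o Fin d) : compound k A I J = (A.submatrix I J).det := rfl

theorem compound_eq_toMatrix {R : Type*} [CommRing R] {d k : ℕ} (A : Matrix (Fin d) (Fin d) R) :
    compound k A = LinearMap.toMatrix
      (((Pi.basisFun R (Fin d)).exteriorPower k).reindex Set.powersetCard.ofFinEmbEquiv.symm)
      (((Pi.basisFun R (Fin d)).exteriorPower k).reindex Set.powersetCard.ofFinEmbEquiv.symm)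
      (exteriorPower.map k (Matrix.toLin' A)) := by
  ext I J
  rw [compound_apply, LinearMap.toMatrix_apply, Module.Basis.reindex_apply, Equiv.symm_symm,
    Module.Basis.repr_reindex_apply, Equiv.symm_symm, exteriorPower.basis_repr_apply,
    exteriorPower.basis_apply, exteriorPower.ιMulti_family, exteriorPower.map_apply_ιMulti,
    exteriorPower.ιMultiDual_apply_ιMulti, Equiv.symm_apply_apply, Equiv.symm_apply_apply,
    ← det_transpose]
  congr 1
  ext a b
  simp

theorem compound_mul {R : Type*} [CommRing R] {d k : ℕ} (A B : Matrix (Fin d) (Fin d) R) :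
    compound k (A * B) = compound k A * compound k B := by
  rw [compound_eq_toMatrix, compound_eq_toMatrix, compound_eq_toMatrix, ← LinearMap.toMatrix_mul,
    toLin'_mul]
  congr 1
  exact exteriorPower.map_comp (toLin' B) (toLin' A)

theorem compound_smul_one {R : Type*} [CommRing R] {d k : ℕ} (c : R) :
    compound k (c • (1 : Matrix (Fin d) (Fin d) R)) = c ^ k • 1 := by
  ext I J
  have h : (c • (1 : Matrix (Fin d) (Fin d) R)).submatrix I J
      = c • (1 : Matrix (Fin d) (Fin d) R).submatrix I J := rfl
  rw [compound_apply, h, det_smul, Fintype.card_fin, Matrix.smul_apply, smul_eq_mul]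
  congr 1
  have h1 : compound k (1 : Matrix (Fin d) (Fin d) R) = 1 := by
    rw [compound_eq_toMatrix, toLin'_one, exteriorPower.map_id, LinearMap.toMatrix_id]
  rw [← h1]
  rfl

theorem compound_one {R : Type*} [CommRing R] {d k : ℕ} :
    compound k (1 : Matrix (Fin d) (Fin d) R) = 1 := by
  simpa using compound_smul_one (d := d) (k := k) (1 : R)

theorem compound_map {R S : Type*} [CommRing R] [CommRing S] {d k : ℕ} (φ : R →+* S)
    (A : Matrix (Fin d) (Fin d) R) : compound k (A.map φ) = (compound k A).map φ := by
  ext I J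
  rw [compound_apply, map_apply, compound_apply, RingHom.map_det]
  rfl

theorem abs_det_le_of_le_mul {n : ℕ} (M : Matrix (Fin n) (Fin n) ℝ) {a b : Fin n → ℝ}
    (h : ∀ i j, |M i j| ≤ a i * b j) :
    |M.det| ≤ n.factorial * ((∏ i, a i) * ∏ j, b j) := by
  rw [det_apply]
  refine (Finset.abs_sum_le_sum_abs _ _).trans ?_
  have hc : (n.factorial : ℝ) = (Finset.univ : Finset (Equiv.Perm (Fin n))).card := by
    rw [Finset.card_univ, Fintype.card_perm, Fintype.card_fin]
  rw [hc, ← nsmul_eq_mul]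
  refine Finset.sum_le_card_nsmul _ _ _ fun σ _ => ?_
  have hs : |Equiv.Perm.sign σ • ∏ k, M (σ k) k| = ∏ k, |M (σ k) k| := by
    rw [← Finset.abs_prod]
    rcases Int.units_eq_one_or (Equiv.Perm.sign σ) with h | h <;> simp [h]
  rw [hs, ← Equiv.prod_comp σ a, ← Finset.prod_mul_distrib]
  exact Finset.prod_le_prod (fun _ _ => abs_nonneg _) fun k _ => h _ _

theorem abs_adjugate_le_mul {n : ℕ} (y : Matrix (Fin n) (Fin n) ℝ) (j i : Fin n) {a b : Fin n → ℝ}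
    (ha : ∀ k, 0 < a k) (hb : ∀ k, 0 < b k) (hy : ∀ k j, |y k j| ≤ a k * b j) :
    |y.adjugate j i| ≤ n.factorial * ((∏ k, a k) * ∏ k, b k) * ((a i)⁻¹ * (b j)⁻¹) := by
  have h1 := abs_adjugate_le (y * diagonal fun k => (b k)⁻¹) j i (fun k => (ha k).le)
    (fun k l _ => by
      rw [mul_diagonal, abs_mul, abs_of_pos (inv_pos.2 (hb l)), ← div_eq_mul_inv,
        div_le_iff₀ (hb l)]
      exact hy k l)
  rw [adjugate_mul_distrib, adjugate_diagonal, diagonal_mul, Fintype.card_fin, abs_mul,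
    Finset.prod_inv_distrib, abs_inv, abs_of_pos (Finset.prod_pos fun k _ => hb k),
    inv_mul_le_iff₀ (Finset.prod_pos fun k _ => hb k)] at h1
  refine h1.trans (le_of_eq ?_)
  rw [← Finset.mul_prod_erase _ a (Finset.mem_univ i),
    ← Finset.mul_prod_erase _ b (Finset.mem_univ j)]
  have := (ha i).ne'
  have := (hb j).ne'
  field_simp

theorem sum_orderEmbedding_sum (d k : ℕ) : ∃ c : ℕ, ∀ f : Fin d → ℝ,
    ∑ I : Fin k ↪o Fin d, ∑ a, f (I a) = c * ∑ i, f i := by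
  rcases k.eq_zero_or_pos with rfl | hk
  · exact ⟨0, fun f => by simp⟩
  refine ⟨(d - 1).choose (k - 1), fun f => ?_⟩
  have h1 : ∀ I : Fin k ↪o Fin d, ∑ a, f (I a)
      = ∑ i, if i ∈ (Set.powersetCard.ofFinEmbEquiv I : Finset (Fin d)) then f i else 0 := by
    intro I
    rw [Finset.sum_ite_mem, Finset.univ_inter]
    refine Finset.sum_bij (fun a _ => I a) ?_ (fun _ _ _ _ h => I.injective h) ?_ fun _ _ => rfl
    · intro a _
      exact (Set.powersetCard.mem_ofFinEmbEquiv_iff_mem_range I (I a)).2 ⟨a, rfl⟩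
    · intro i hi
      obtain ⟨a, ha⟩ := (Set.powersetCard.mem_ofFinEmbEquiv_iff_mem_range I i).1 hi
      exact ⟨a, Finset.mem_univ _, ha⟩
  simp only [h1]
  rw [Finset.sum_comm, Finset.mul_sum]
  refine Finset.sum_congr rfl fun i _ => ?_
  rw [← Finset.sum_filter, Finset.sum_const, nsmul_eq_mul]
  congr 2
  have h2 := Finset.card_filter_powersetCard_subset {i} (Finset.univ : Finset (Fin d)) k
    (Finset.subset_univ _)
  rw [Finset.card_singleton, Finset.card_univ, Fintype.card_fin] at h2
  rw [← h2 (by omega)]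
  refine Finset.card_bij (fun I _ => (Set.powersetCard.ofFinEmbEquiv I : Finset (Fin d))) ?_ ?_ ?_
  · intro I hI
    simpa using (Finset.mem_filter.1 hI).2
  · intro I _ J _ h
    exact Set.powersetCard.ofFinEmbEquiv.injective (Subtype.ext h)
  · intro S hS
    obtain ⟨h3, h4⟩ := Finset.mem_filter.1 hS
    refine ⟨Set.powersetCard.ofFinEmbEquiv.symm ⟨S, (Finset.mem_powersetCard.1 h3).2⟩, ?_, by simp⟩
    simpa using h4

theorem mul_prod_le_prod_of_ne {d k : ℕ} (hk : k < d) {s : Fin d → ℝ} (hs : ∀ j, 0 < s j)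
    (hmono : Monotone s) {q : ℝ}
    (hgap : ∀ j : Fin d, (j : ℕ) + 1 = k → q * s j ≤ s ⟨k, hk⟩) (J : Fin k ↪o Fin d)
    (hJ : J ≠ Fin.castLEOrderEmb hk.le) :
    q * ∏ a, s (Fin.castLEOrderEmb hk.le a) ≤ ∏ a, s (J a) := by
  have hle : ∀ a : Fin k, (a : ℕ) ≤ J a := by
    rintro ⟨a, ha⟩
    induction a with
    | zero => simp
    | succ a ih =>
      have h1 := ih (by omega)
      have h2 : J ⟨a, by omega⟩ < J ⟨a + 1, ha⟩ := J.strictMono (by simp [Fin.lt_def])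
      rw [Fin.lt_def] at h2
      simp only at h1 ⊢
      omega
  obtain ⟨a₀, ha₀⟩ : ∃ a : Fin k, (a : ℕ) ≠ J a := by
    by_contra! h
    exact hJ (RelEmbedding.ext fun a => Fin.ext (h a).symm)
  have hlt : ∀ b : ℕ, ∀ hb : b < k, (a₀ : ℕ) ≤ b → b + 1 ≤ J ⟨b, hb⟩ := by
    intro b hb hab
    induction b, hab using Nat.le_induction with
    | base => exact lt_of_le_of_ne (hle a₀) ha₀
    | succ b hab ih =>
      have h1 := ih (by omega)
      have h2 : J ⟨b, by omega⟩ < J ⟨b + 1, hb⟩ := J.strictMono (by simp [Fin.lt_def])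
      rw [Fin.lt_def] at h2
      omega
  have hk0 : 0 < k := a₀.pos
  have hlast := hlt (k - 1) (by omega) (by omega)
  rw [← Finset.mul_prod_erase _ _ (Finset.mem_univ (⟨k - 1, by omega⟩ : Fin k)),
    ← Finset.mul_prod_erase _ (fun a => s (J a)) (Finset.mem_univ (⟨k - 1, by omega⟩ : Fin k)),
    ← mul_assoc]
  refine mul_le_mul ?_ ?_ (Finset.prod_nonneg fun _ _ => (hs _).le) (hs _).le
  · refine (hgap _ (by simp; omega)).trans (hmono ?_)
    rw [Fin.le_def]
    simp only
    omega
  · exact Finset.prod_le_prod (fun _ _ => (hs _).le) fun a _ => hmono (Fin.le_def.2 (hle a))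

theorem exists_compound_ne_zero {d k : ℕ} {y : Matrix (Fin d) (Fin d) ℝ}
    (hy : y.det ≠ 0) (l₀ : Fin d) (J : Fin k ↪o Fin d) (j : Fin k) (hj : y l₀ (J j) ≠ 0) :
    ∃ I : Fin k ↪o Fin d, (∃ a, I a = l₀) ∧ compound k y I J ≠ 0 := by
  by_contra! hzero
  have hgen : ∀ c : Fin k → Fin d, (∃ a, c a = l₀) → (y.submatrix c J).det = 0 := by
    intro c ⟨a, ha⟩
    by_cases hc : Function.Injective c
    · have hm : StrictMono (c ∘ Tuple.sort c) :=
        (Tuple.monotone_sort c).strictMono_of_injective (hc.comp (Tuple.sort c).injective)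
      have h1 := hzero (OrderEmbedding.ofStrictMono _ hm) ⟨(Tuple.sort c).symm a, by simp [ha]⟩
      rw [compound_apply] at h1
      have h2 : y.submatrix (OrderEmbedding.ofStrictMono _ hm) J
          = (y.submatrix c J).submatrix (Tuple.sort c) id := rfl
      rw [h2, det_permute] at h1
      refine (mul_eq_zero.1 h1).resolve_left ?_
      rcases Int.units_eq_one_or (Equiv.Perm.sign (Tuple.sort c)) with h | h <;> simp [h]
    · obtain ⟨a, b, hab, hne⟩ : ∃ a b, c a = c b ∧ a ≠ b := by
        simpa [Function.Injective] using hc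
      exact det_zero_of_row_eq hne (by ext l; simp [hab])
  obtain ⟨I, hI⟩ : ∃ I, compound k y I J ≠ 0 := by
    by_contra! h
    have h1 : compound k y⁻¹ * compound k y = 1 := by
      rw [← compound_mul, nonsing_inv_mul _ (isUnit_iff_ne_zero.2 hy), compound_one]
    have h2 := congrFun (congrFun h1 J) J
    rw [mul_apply, one_apply_eq] at h2
    simp [h] at h2
  rw [compound_apply] at hI
  set B := y.submatrix I J
  have hcr : Bᵀ.cramer (fun b => y l₀ (J b)) = 0 := by
    ext a
    rw [cramer_transpose_apply]
    have : B.updateRow a (fun b => y l₀ (J b)) = y.submatrix (Function.update I a l₀) J := by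
      ext b e
      rcases eq_or_ne b a with rfl | hba
      · simp
      · simp [hba, B]
    rw [this]
    exact hgen _ ⟨a, by simp⟩
  have h3 := mulVec_cramer Bᵀ (fun b => y l₀ (J b))
  rw [hcr, mulVec_zero, det_transpose] at h3
  have h4 := congrFun h3 j
  simp only [Pi.zero_apply, Pi.smul_apply, smul_eq_mul] at h4
  exact mul_ne_zero hI hj h4.symm

end

section

open Matrix Filter

theorem exists_strictMono_fiber {X : Type*} {S : Set X} (hS : S.Finite) {f : ℕ → X}
    (hf : ∃ᶠ n in atTop, f n ∈ S) : ∃ x ∈ S, ∃ ψ : ℕ → ℕ, StrictMono ψ ∧ ∀ n, f (ψ n) = x := by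
  have h : ∃ x ∈ S, ∃ᶠ n in atTop, f n = x := by
    by_contra! h
    have h1 : ∀ᶠ n in atTop, ∀ x ∈ S, f n ≠ x :=
      (eventually_all_finite hS).2 h
    obtain ⟨n, hn, hn'⟩ := (hf.and_eventually h1).exists
    exact hn' _ hn rfl
  obtain ⟨x, hx, hfx⟩ := h
  obtain ⟨ψ, hψ, h1⟩ := extraction_of_frequently_atTop hfx
  exact ⟨x, hx, ψ, hψ, h1⟩

/-- Version of `exists_common_normal` with varying exponents. -/
theorem exists_frequently_normal {O : Type*} [CommRing O] [IsDomain O] [Module.Finite ℤ O]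
    [Module.Free ℤ O] {ι : Type} [Fintype ι] [DecidableEq ι] [Nonempty ι] (φ : O →+* ℝ)
    (hφ : Function.Injective φ) (V : Matrix ι ι O) {W' : Matrix ι ι ℝ} (hWW : V.map φ * W' = 1)
    {Q : ℕ → ℝ} (hQ : Tendsto Q atTop atTop) {b : ℕ → ι → ℝ} (hb : ∀ n i, 0 < b n i) {K γ : ℝ}
    (hγ : 0 < γ) (hbK : ∀ᶠ n in atTop, ∀ i, |Real.log (b n i)| ≤ K * Real.log (Q n))
    (hbγ : ∀ᶠ n in atTop, ∑ i, Real.log (b n i) ≤ -γ * Real.log (Q n))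
    (Z : ℕ → Matrix ι ι ℤ) (hZ : ∀ n, (Z n).det ≠ 0) (j₀ : ℕ → ι)
    (hy : ∀ n i j, j ≠ j₀ n → |(W' * (Z n).map (Int.cast : ℤ → ℝ)) i j| ≤ b n i) :
    ∃ w : ι → ℤ, w ≠ 0 ∧ ∃ᶠ n in atTop, ∀ j, j ≠ j₀ n → (w ᵥ* Z n) j = 0 := by
  set δ : ℝ := γ / (2 * Fintype.card ι) with hδ
  have hcard : (0 : ℝ) < Fintype.card ι := Nat.cast_pos.2 Fintype.card_pos
  have hδ0 : 0 < δ := by positivity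
  set m : ℕ → ι → ℤ := fun n i => ⌈Real.log (b n i) / (δ * Real.log (Q n))⌉ with hm
  set S : Set (ι → ℤ) := Set.Icc (fun _ => -⌈K / δ⌉) (fun _ => ⌈K / δ⌉)
  have hQ1 : ∀ᶠ n in atTop, 1 < Q n := hQ.eventually_gt_atTop 1
  have hev : ∀ᶠ n in atTop, m n ∈ S ∧ (∀ i, b n i ≤ Q n ^ (δ * m n i)) ∧
      ∑ i, δ * (m n i : ℝ) < 0 := by
    filter_upwards [hbK, hbγ, hQ1] with n h1 h2 h3
    have hl : 0 < Real.log (Q n) := Real.log_pos h3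
    have hl' : 0 < δ * Real.log (Q n) := by positivity
    have hKabs : ∀ i, |Real.log (b n i) / (δ * Real.log (Q n))| ≤ K / δ := by
      intro i
      rw [abs_div, abs_of_pos hl', div_le_div_iff₀ hl' hδ0]
      calc _ ≤ K * Real.log (Q n) * δ := by gcongr; exact h1 i
        _ = _ := by ring
    refine ⟨⟨fun i => ?_, fun i => ?_⟩, fun i => ?_, ?_⟩
    · have := (abs_le.1 (hKabs i)).1
      refine Int.cast_le.1 ((?_ : ((-⌈K / δ⌉ : ℤ) : ℝ) ≤ _).trans (Int.le_ceil _))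
      push_cast
      linarith [Int.le_ceil (K / δ)]
    · exact Int.ceil_le_ceil (abs_le.1 (hKabs i)).2
    · rw [← Real.log_le_log_iff (hb n i) (Real.rpow_pos_of_pos (by linarith) _),
        Real.log_rpow (by linarith)]
      have := Int.le_ceil (Real.log (b n i) / (δ * Real.log (Q n)))
      rw [div_le_iff₀ hl'] at this
      calc _ ≤ _ := this
        _ = _ := by ring
    · have h4 : ∀ i, δ * (m n i : ℝ) ≤ Real.log (b n i) / Real.log (Q n) + δ := by
        intro i
        have := (Int.ceil_lt_add_one (Real.log (b n i) / (δ * Real.log (Q n)))).le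
        have h5 := mul_le_mul_of_nonneg_left this hδ0.le
        refine h5.trans (le_of_eq ?_)
        field_simp
      calc ∑ i, δ * (m n i : ℝ) ≤ ∑ i, (Real.log (b n i) / Real.log (Q n) + δ) :=
            Finset.sum_le_sum fun i _ => h4 i
        _ = (∑ i, Real.log (b n i)) / Real.log (Q n) + Fintype.card ι * δ := by
            rw [Finset.sum_add_distrib, Finset.sum_div, Finset.sum_const, Finset.card_univ,
              nsmul_eq_mul]
        _ ≤ -γ + γ / 2 := by
            refine add_le_add ((div_le_iff₀ hl).2 h2) (le_of_eq ?_)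
            rw [hδ]; field_simp
        _ < 0 := by linarith
  obtain ⟨N, hN⟩ := eventually_atTop.1 hev
  obtain ⟨g, -, ψ, hψ, hg⟩ := exists_strictMono_fiber (S := S) (Set.finite_Icc _ _)
    (f := fun n => m (n + N)) (Eventually.frequently (Eventually.of_forall fun n => (hN _ (by omega)).1))
  have hψ' : Tendsto (fun n => ψ n + N) atTop atTop :=
    (tendsto_add_atTop_nat N).comp hψ.tendsto_atTop
  obtain ⟨w, hw, h⟩ := exists_common_normal φ hφ V hWW (g := fun i => δ * (g i : ℝ))
    (by rw [← hg 0]; exact (hN _ (by omega)).2.2) (hQ.comp hψ') (fun n => Z (ψ n + N))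
    (fun n => hZ _) (fun n => j₀ (ψ n + N)) (fun n i j hj => (hy _ i j hj).trans (by
      have := (hN (ψ n + N) (by omega)).2.1 i
      rw [show m (ψ n + N) = g from hg n] at this
      exact this))
  exact ⟨w, hw, hψ'.frequently h.frequently⟩

end

section

open Matrix Filter

theorem exists_weighted_basis {d : ℕ} {L : Matrix (Fin d) (Fin d) ℝ} (hL : L.det ≠ 0)
    {A : Fin d → ℝ} (hA : ∀ i, 0 < A i) (hprod : ∏ i, A i = 1) :
    ∃ (x : Matrix (Fin d) (Fin d) ℤ) (π : Equiv.Perm (Fin d)) (s : Fin d → ℝ), IsUnit x.det ∧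
      (∀ j, 0 < s j) ∧ ∏ j, s j = (∏ j : Fin d, (2 : ℝ) ^ (j : ℕ)) * |L.det| ∧ Monotone s ∧
      (∀ i j, |(L * x.map (Int.cast : ℤ → ℝ)) i j| ≤ d * (A i * s (π i))) ∧
      (∀ i j, |(L * x.map (Int.cast : ℤ → ℝ)) i j| ≤ d * (A i * s j)) ∧
      ∀ i : Fin d, (i : ℕ) = 0 → ∀ z : Fin d → ℤ, z ≠ 0 → ∀ q : ℝ, 0 ≤ q →
        (∀ i, |(L *ᵥ fun l => (z l : ℝ)) i| ≤ A i * q) → s i ≤ q := by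
  have hdet : (diagonal (fun i => (A i)⁻¹) * L).det = L.det := by
    rw [det_mul, det_diagonal, Finset.prod_inv_distrib, hprod, inv_one, one_mul]
  obtain ⟨x, π, s, hx, hs, hsprod, hmono, hbd, hmin⟩ :=
    exists_davenport (diagonal (fun i => (A i)⁻¹) * L) (by rwa [hdet])
  rw [hdet] at hsprod
  have hbd' : ∀ i j, |(L * x.map (Int.cast : ℤ → ℝ)) i j| ≤ A i * (d * min (s (π.symm i)) (s j)) := by
    intro i j
    have h1 := hbd (π.symm i) j
    rw [Equiv.apply_symm_apply, Matrix.mul_assoc, diagonal_mul, abs_mul,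
      abs_of_pos (inv_pos.2 (hA i)), inv_mul_le_iff₀ (hA i)] at h1
    exact h1
  refine ⟨x, π.symm, s, hx, hs, hsprod, hmono, fun i j => ?_, fun i j => ?_, ?_⟩
  · refine (hbd' i j).trans ?_
    rw [mul_left_comm]
    have := (hA i).le
    gcongr
    exact min_le_left _ _
  · refine (hbd' i j).trans ?_
    rw [mul_left_comm]
    have := (hA i).le
    gcongr
    exact min_le_right _ _
  · intro i hi z hz q hq h
    refine (hmin i hi z hz).trans ((pi_norm_le_iff_of_nonneg hq).2 fun l => ?_)
    rw [← mulVec_mulVec, mulVec_diagonal, Real.norm_eq_abs, abs_mul,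
      abs_of_pos (inv_pos.2 (hA l)), inv_mul_le_iff₀ (hA l)]
    exact h l

/-- Entries of the compound of the dual basis. -/
theorem abs_compound_dual_le {d k : ℕ} {L : Matrix (Fin d) (Fin d) ℝ} (hL : L.det ≠ 0)
    {x : Matrix (Fin d) (Fin d) ℤ} {a b : Fin d → ℝ} (ha : ∀ i, 0 < a i) (hb : ∀ j, 0 < b j)
    (h : ∀ i j, |(L * x.map (Int.cast : ℤ → ℝ)) i j| ≤ d * (a i * b j)) (I J : Fin k ↪o Fin d) :
    |compound k ((x.map (Int.cast : ℤ → ℝ)).adjugate * L⁻¹) J I|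
      ≤ k.factorial * ((|L.det|⁻¹ * (d.factorial * (d ^ d * ((∏ i, a i) * ∏ j, b j)))) ^ k
        * ((∏ i, (a (I i))⁻¹) * ∏ j, (b (J j))⁻¹)) := by
  rcases d.eq_zero_or_pos with rfl | hd
  · obtain rfl : k = 0 := Nat.eq_zero_of_not_pos fun h => (I ⟨0, h⟩).elim0
    simp [compound_apply]
  have hd1 : (1 : ℝ) ≤ d := by exact_mod_cast hd
  set C := |L.det|⁻¹ * (d.factorial * (d ^ d * ((∏ i, a i) * ∏ j, b j))) with hC
  have hE : (x.map (Int.cast : ℤ → ℝ)).adjugate * L⁻¹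
      = L.det⁻¹ • (L * x.map (Int.cast : ℤ → ℝ)).adjugate := by
    rw [adjugate_mul_distrib, inv_def, Ring.inverse_eq_inv', Matrix.mul_smul]
  have hC0 : 0 ≤ C := by
    have := Finset.prod_nonneg fun i (_ : i ∈ Finset.univ) => (ha i).le
    have := Finset.prod_nonneg fun i (_ : i ∈ Finset.univ) => (hb i).le
    positivity
  have hentry : ∀ j i, |((x.map (Int.cast : ℤ → ℝ)).adjugate * L⁻¹) j i|
      ≤ C * ((a i)⁻¹ * (b j)⁻¹) := by
    intro j i
    have h1 := abs_adjugate_le_mul (L * x.map (Int.cast : ℤ → ℝ)) j i (a := fun i => d * a i)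
      (b := b) (fun i => mul_pos (by linarith) (ha i)) hb (fun i j => by rw [mul_assoc]; exact h i j)
    rw [Finset.prod_mul_distrib, Finset.prod_const, Finset.card_univ, Fintype.card_fin] at h1
    rw [hE, Matrix.smul_apply, smul_eq_mul, abs_mul, abs_inv, hC, mul_assoc]
    refine mul_le_mul_of_nonneg_left (h1.trans ?_) (by positivity)
    rw [mul_assoc ((d : ℝ) ^ d)]
    have h2 := Finset.prod_nonneg fun i (_ : i ∈ Finset.univ) => (ha i).le
    have h3 := Finset.prod_nonneg fun i (_ : i ∈ Finset.univ) => (hb i).le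
    have h4 := ha i
    have h5 := hb j
    gcongr
    exact le_mul_of_one_le_left h4.le hd1
  rw [compound_apply]
  refine (abs_det_le_of_le_mul _ (a := fun l => C * (b (J l))⁻¹) (b := fun l => (a (I l))⁻¹)
    fun i j => ?_).trans (le_of_eq ?_)
  · rw [submatrix_apply]
    refine (hentry _ _).trans (le_of_eq (by ring))
  · rw [Finset.prod_mul_distrib, Finset.prod_const, Finset.card_univ, Fintype.card_fin]
    ring

theorem exists_gap {d : ℕ} {s : Fin d → ℝ} (hs : ∀ j, 0 < s j) {q κ : ℝ} (hq : 1 ≤ q)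
    (hprod : ∏ j, s j = κ) (h0 : ∀ i : Fin d, (i : ℕ) = 0 → s i * q ^ d < min 1 κ) (hd : 0 < d) :
    ∃ k, 0 < k ∧ ∃ hk : k < d, ∀ j : Fin d, (j : ℕ) + 1 = k → q * s j ≤ s ⟨k, hk⟩ := by
  by_contra! hcon
  have hq0 : 0 < q := by linarith
  have hle : ∀ j (hj : j < d), s ⟨j, hj⟩ ≤ s ⟨0, hd⟩ * q ^ j := by
    intro j
    induction j with
    | zero => intro hj; simp
    | succ j ih =>
      intro hj
      obtain ⟨i, hi, h⟩ := hcon (j + 1) (by omega) hj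
      rw [show i = ⟨j, by omega⟩ from Fin.ext (by simpa using hi)] at h
      refine h.le.trans ?_
      rw [pow_succ, ← mul_assoc, mul_comm]
      exact mul_le_mul_of_nonneg_right (ih (by omega)) hq0.le
  have hlt : ∀ j, s j < min 1 κ := fun j =>
    ((hle j j.2).trans (mul_le_mul_of_nonneg_left (pow_le_pow_right₀ hq j.2.le) (hs _).le)).trans_lt
      (h0 ⟨0, hd⟩ rfl)
  have h1 : ∏ j, s j ≤ s ⟨0, hd⟩ := by
    rw [← Finset.mul_prod_erase _ _ (Finset.mem_univ (⟨0, hd⟩ : Fin d))]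
    refine mul_le_of_le_one_right (hs _).le (Finset.prod_le_one (fun _ _ => (hs _).le) fun j _ => ?_)
    exact ((hlt j).trans_le (min_le_left _ _)).le
  have h2 := (hlt ⟨0, hd⟩).trans_le (min_le_right _ _)
  rw [hprod] at h1
  linarith

theorem exists_orderEmbedding_prod_eq {d k : ℕ} (J : Fin k ↪o Fin d) (π : Equiv.Perm (Fin d)) :
    ∃ I : Fin k ↪o Fin d, ∀ f : Fin d → ℝ, ∏ a, f (π (I a)) = ∏ a, f (J a) := by
  set c : Fin k → Fin d := fun a => π.symm (J a)
  have hc : Function.Injective c := π.symm.injective.comp J.injective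
  have hm : StrictMono (c ∘ Tuple.sort c) :=
    (Tuple.monotone_sort c).strictMono_of_injective (hc.comp (Tuple.sort c).injective)
  refine ⟨OrderEmbedding.ofStrictMono _ hm, fun f => ?_⟩
  rw [← Equiv.prod_comp (Tuple.sort c) fun a => f (J a)]
  exact Finset.prod_congr rfl fun a _ => by simp [c]

theorem abs_le_of_sum_eq {d : ℕ} {f : Fin d → ℝ} {t v : ℝ} (ht : 0 ≤ t) (hf : ∀ i, -t ≤ f i)
    (hsum : ∑ i, f i = v) (i : Fin d) : |f i| ≤ |v| + d * t := by
  have hd : (1 : ℝ) ≤ d := by exact_mod_cast i.pos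
  have h1 : f i + t ≤ ∑ i, (f i + t) :=
    Finset.single_le_sum (f := fun i => f i + t) (fun j _ => by linarith [hf j]) (Finset.mem_univ i)
  rw [Finset.sum_add_distrib, hsum, Finset.sum_const, Finset.card_univ, Fintype.card_fin,
    nsmul_eq_mul] at h1
  have h2 : t ≤ d * t := le_mul_of_one_le_left ht hd
  rw [abs_le]
  exact ⟨by linarith [hf i, abs_nonneg v], by linarith [le_abs_self v]⟩

theorem prod_castLE_le {d k : ℕ} (hk : k < d) {s : Fin d → ℝ} (hs : ∀ j, 0 < s j)
    (hmono : Monotone s) : ∏ a : Fin k, s (Fin.castLEOrderEmb hk.le a) ≤ max 1 (∏ j, s j) := by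
  by_cases h1 : ∏ a : Fin k, s (Fin.castLEOrderEmb hk.le a) ≤ 1
  · exact h1.trans (le_max_left _ _)
  refine le_trans ?_ (le_max_right _ _)
  obtain ⟨a, ha⟩ : ∃ a : Fin k, 1 < s (Fin.castLEOrderEmb hk.le a) := by
    by_contra! h
    exact h1 (Finset.prod_le_one (fun _ _ => (hs _).le) fun a _ => h a)
  have h2 : ∏ a : Fin k, s (Fin.castLEOrderEmb hk.le a)
      = ∏ j ∈ Finset.univ.map (Fin.castLEOrderEmb hk.le).toEmbedding, s j := by
    rw [Finset.prod_map]; rfl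
  rw [h2]
  rw [← Finset.prod_mul_prod_compl (Finset.univ.map (Fin.castLEOrderEmb hk.le).toEmbedding) s]
  refine le_mul_of_one_le_right (Finset.prod_nonneg fun _ _ => (hs _).le) ?_
  have h3 := Finset.prod_le_prod
    (s := (Finset.univ.map (Fin.castLEOrderEmb hk.le).toEmbedding)ᶜ) (f := fun _ => (1 : ℝ)) (g := s)
    (fun _ _ => zero_le_one) fun j hj => ?_
  · simpa using h3
  refine ha.le.trans (hmono (Fin.le_def.2 ?_))
  by_contra! h
  refine Finset.mem_compl.1 hj (Finset.mem_map.2 ⟨⟨j, ?_⟩, Finset.mem_univ _, Fin.ext rfl⟩)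
  have : ((Fin.castLEOrderEmb hk.le a : Fin d) : ℕ) = a := rfl
  omega

theorem prod_le_rpow_neg {d k : ℕ} (hk : k < d) {A : Fin d → ℝ} (hA : ∀ i, 0 < A i)
    (hprod : ∏ i, A i = 1) {l₀ : Fin d} {q : ℝ} (hq : 1 ≤ q) (hAq : ∀ i, i ≠ l₀ → q ≤ A i)
    (I : Fin k ↪o Fin d) (hI : ∃ a, I a = l₀) : ∏ a, A (I a) ≤ q⁻¹ := by
  have h2 : ∏ a : Fin k, A (I a) = ∏ j ∈ Finset.univ.map I.toEmbedding, A j := by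
    rw [Finset.prod_map]; rfl
  set S := Finset.univ.map I.toEmbedding with hS
  have hl₀ : l₀ ∈ S := by
    obtain ⟨a, ha⟩ := hI
    exact Finset.mem_map.2 ⟨a, Finset.mem_univ _, ha⟩
  obtain ⟨i, hi⟩ : (Sᶜ).Nonempty := by
    rw [← Finset.card_pos, Finset.card_compl, hS, Finset.card_map]
    simpa using hk
  have h3 : q ≤ ∏ j ∈ Sᶜ, A j := by
    rw [← Finset.mul_prod_erase _ _ hi]
    have hne : ∀ j ∈ Sᶜ, j ≠ l₀ := fun j hj h => Finset.mem_compl.1 hj (h ▸ hl₀)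
    have h4 := Finset.prod_le_prod (s := (Sᶜ).erase i) (f := fun _ => (1 : ℝ)) (g := A)
      (fun _ _ => zero_le_one) fun j hj =>
        hq.trans (hAq j (hne j (Finset.mem_of_mem_erase hj)))
    rw [Finset.prod_const_one] at h4
    exact (hAq i (hne i hi)).trans (le_mul_of_one_le_right (hA i).le h4)
  rw [h2, ← one_div, le_div_iff₀ (by linarith), ← hprod, ← Finset.prod_mul_prod_compl S A]
  exact mul_le_mul_of_nonneg_left h3 (Finset.prod_nonneg fun _ _ => (hA _).le)

end

section

open Matrix Filter

theorem exists_compound_col_eq {d k : ℕ} {x : Matrix (Fin d) (Fin d) ℤ} (hx : IsUnit x.det)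
    {w : (Fin k ↪o Fin d) → ℤ} (hw : w ≠ 0) (J : Fin k ↪o Fin d)
    (h : ∀ I, I ≠ J → (w ᵥ* (compound k x.adjugate)ᵀ) I = 0) (L : Matrix (Fin d) (Fin d) ℝ) :
    ∃ c : ℤ, c ≠ 0 ∧ (∃ I, |c| ≤ |w I|) ∧ ∀ I, |(compound k L *ᵥ fun l => (w l : ℝ)) I|
      = |(c : ℝ)| * |compound k (L * x.map (Int.cast : ℤ → ℝ)) I J| := by
  set u := compound k x.adjugate *ᵥ w with hu
  have hu' : u = Pi.single J (u J) := by
    ext I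
    rcases eq_or_ne I J with rfl | hI
    · simp
    · have := h I hI
      rw [vecMul_transpose] at this
      rw [Pi.single_eq_of_ne hI, hu]
      exact this
  have hxw : (x.det ^ k) • w = fun I => compound k x I J * u J := by
    have h1 : compound k x *ᵥ u = (x.det ^ k) • w := by
      rw [hu, mulVec_mulVec, ← compound_mul, mul_adjugate, compound_smul_one, smul_mulVec,
        one_mulVec]
    rw [← h1, hu']
    ext I
    simp [mulVec_single]
  have habs : |x.det ^ k| = 1 := by
    rw [abs_pow, Int.isUnit_iff_abs_eq.1 hx, one_pow]
  have hwabs : ∀ I, |w I| = |compound k x I J| * |u J| := by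
    intro I
    rw [← abs_mul, ← congrFun hxw I, Pi.smul_apply, smul_eq_mul, abs_mul, habs, one_mul]
  obtain ⟨I₀, hI₀⟩ : ∃ I, w I ≠ 0 := by
    by_contra! h0
    exact hw (funext h0)
  have hI₁ := hwabs I₀
  have hI₂ : 0 < |w I₀| := abs_pos.2 hI₀
  have hne : compound k x I₀ J ≠ 0 := by
    intro h0
    rw [h0, abs_zero, zero_mul] at hI₁
    omega
  refine ⟨u J, ?_, ⟨I₀, ?_⟩, fun I => ?_⟩
  · intro h0
    rw [h0, abs_zero, mul_zero] at hI₁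
    omega
  · rw [hI₁]
    exact le_mul_of_one_le_left (abs_nonneg _) (Int.one_le_abs hne)
  · have h2 : ((x.det : ℝ) ^ k) • (compound k L *ᵥ fun l => (w l : ℝ))
        = fun I => compound k (L * x.map (Int.cast : ℤ → ℝ)) I J * (u J : ℝ) := by
      rw [← mulVec_smul]
      have h3 : ((x.det : ℝ) ^ k • fun l => (w l : ℝ))
          = fun I => (compound k (x.map (Int.cast : ℤ → ℝ)) I J) * (u J : ℝ) := by
        ext I
        have h4 := congrArg (Int.cast : ℤ → ℝ) (congrFun hxw I)
        have h5 : compound k (x.map (Int.cast : ℤ → ℝ)) I J = ((compound k x I J : ℤ) : ℝ) :=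
          congrFun (congrFun (compound_map (Int.castRingHom ℝ) x) I) J
        rw [h5]
        simpa using h4
      rw [h3, compound_mul]
      ext I
      simp only [mulVec, dotProduct, Matrix.mul_apply]
      rw [Finset.sum_mul]
      exact Finset.sum_congr rfl fun l _ => by ring
    have h6 := congrArg abs (congrFun h2 I)
    have h7 : |(x.det : ℝ) ^ k| = 1 := by exact_mod_cast congrArg (Int.cast : ℤ → ℝ) habs
    rw [Pi.smul_apply, smul_eq_mul, abs_mul, h7, one_mul, abs_mul] at h6
    rw [h6, mul_comm]

/-- There is no sequence of reduced bases with a gap in the successive minima. -/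
theorem not_gap_sequence {O : Type*} [CommRing O] [IsDomain O] [Module.Finite ℤ O]
    [Module.Free ℤ O] (φ : O →+* ℝ) (hφ : Function.Injective φ) {d : ℕ}
    (L : Matrix (Fin d) (Fin d) O) (hL : (L.map φ).det ≠ 0) (l₀ : Fin d)
    (hl₀ : ∀ z : Fin d → ℤ, z ≠ 0 → (L.map φ *ᵥ fun l => (z l : ℝ)) l₀ ≠ 0)
    {Q : ℕ → ℝ} (hQ : Tendsto Q atTop atTop) (hQ1 : ∀ n, 1 ≤ Q n) {A : ℕ → Fin d → ℝ}
    (hA : ∀ n i, 0 < A n i) (hprod : ∀ n, ∏ i, A n i = 1) {ρ B γ : ℝ} (hρ : 0 < ρ) (hB : 0 ≤ B)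
    (hγ : 0 < γ)
    (hAρ : ∀ n i, i ≠ l₀ → Q n ^ ρ ≤ A n i) (hAB : ∀ n i, A n i ≤ Q n ^ B)
    {k : ℕ} (hk0 : 0 < k) (hk : k < d)
    {x : ℕ → Matrix (Fin d) (Fin d) ℤ} {π : ℕ → Equiv.Perm (Fin d)} {s : ℕ → Fin d → ℝ} {κ : ℝ}
    (hκ : 0 < κ) (hx : ∀ n, IsUnit (x n).det) (hs : ∀ n j, 0 < s n j)
    (hsκ : ∀ n, ∏ j, s n j = κ)
    (hmono : ∀ n, Monotone (s n))
    (hrow : ∀ n i j, |(L.map φ * (x n).map (Int.cast : ℤ → ℝ)) i j| ≤ d * (A n i * s n (π n i)))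
    (hcol : ∀ n i j, |(L.map φ * (x n).map (Int.cast : ℤ → ℝ)) i j| ≤ d * (A n i * s n j))
    (hgap : ∀ n, ∀ j : Fin d, (j : ℕ) + 1 = k → Q n ^ γ * s n j ≤ s n ⟨k, hk⟩) : False := by
  set Lr := L.map φ with hLr
  have hd : 0 < d := by omega
  have hd1 : (1 : ℝ) ≤ d := by exact_mod_cast hd
  have hQ0 : ∀ n, 0 < Q n := fun n => one_pos.trans_le (hQ1 n)
  set J₀ : Fin k ↪o Fin d := Fin.castLEOrderEmb hk.le with hJ₀
  choose I₀ hI₀ using fun n => exists_orderEmbedding_prod_eq J₀ (π n)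
  set C₀ : ℝ := |Lr.det|⁻¹ * (d.factorial * (d ^ d * κ)) with hC₀
  have hC₀0 : 0 < C₀ := by
    have := abs_pos.2 hL
    positivity
  set K₀ : ℝ := k.factorial * C₀ ^ k with hK₀
  have hK₀0 : 0 < K₀ := by positivity
  set b : ℕ → (Fin k ↪o Fin d) → ℝ := fun n I =>
    K₀ * (∏ a, (A n (I a) * s n (π n (I a)))⁻¹) * (if I = I₀ n then Q n ^ (-γ) else 1) with hb
  have hAs : ∀ n i, 0 < A n i * s n (π n i) := fun n i => mul_pos (hA n i) (hs n _)
  have hb0 : ∀ n I, 0 < b n I := by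
    intro n I
    refine mul_pos (mul_pos hK₀0 (Finset.prod_pos fun a _ => inv_pos.2 (hAs n _))) ?_
    split_ifs
    · exact Real.rpow_pos_of_pos (hQ0 n) _
    · exact one_pos
  set Z : ℕ → Matrix (Fin k ↪o Fin d) (Fin k ↪o Fin d) ℤ :=
    fun n => (compound k (x n).adjugate)ᵀ with hZ
  have hZdet : ∀ n, (Z n).det ≠ 0 := by
    intro n
    rw [hZ, det_transpose]
    have h1 : compound k (x n) * compound k (x n).adjugate = ((x n).det ^ k) • 1 := by
      rw [← compound_mul, mul_adjugate, compound_smul_one]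
    have h2 := congrArg det h1
    rw [det_mul, det_smul, det_one, mul_one] at h2
    intro h3
    rw [h3, mul_zero] at h2
    exact pow_ne_zero _ (pow_ne_zero _ (hx n).ne_zero) h2.symm
  have hentry : ∀ n I J, ((compound k Lr⁻¹)ᵀ * (Z n).map (Int.cast : ℤ → ℝ)) I J
      = compound k (((x n).map (Int.cast : ℤ → ℝ)).adjugate * Lr⁻¹) J I := by
    intro n I J
    have h1 : (compound k (x n).adjugate).map (Int.cast : ℤ → ℝ)
        = compound k ((x n).map (Int.cast : ℤ → ℝ)).adjugate := by
      have h2 := compound_map (k := k) (Int.castRingHom ℝ) (x n).adjugate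
      have h3 := RingHom.map_adjugate (Int.castRingHom ℝ) (x n)
      simp only [RingHom.mapMatrix_apply] at h3
      rw [h3] at h2
      exact h2.symm
    rw [compound_mul, ← h1, ← transpose_apply (_ * _), transpose_mul]
    rfl
  have hy : ∀ n I J, J ≠ J₀ →
      |((compound k Lr⁻¹)ᵀ * (Z n).map (Int.cast : ℤ → ℝ)) I J| ≤ b n I := by
    intro n I J hJ
    rw [hentry]
    by_cases hI : I = I₀ n
    · have h1 := abs_compound_dual_le hL (hA n) (hs n) (hcol n) I J
      rw [hprod n, hsκ n, one_mul, ← hC₀, ← mul_assoc, ← hK₀] at h1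
      refine h1.trans ?_
      have h2 := mul_prod_le_prod_of_ne hk (hs n) (hmono n) (hgap n) J hJ
      rw [← hJ₀, ← hI₀ n] at h2
      have h3 : ∏ j, (s n (J j))⁻¹ ≤ Q n ^ (-γ) * ∏ a, (s n (π n (I a)))⁻¹ := by
        rw [Finset.prod_inv_distrib, Finset.prod_inv_distrib, Real.rpow_neg (hQ0 n).le, ← mul_inv,
          hI]
        exact inv_anti₀ (mul_pos (Real.rpow_pos_of_pos (hQ0 n) _)
          (Finset.prod_pos fun _ _ => hs n _)) h2
      calc _ ≤ K₀ * ((∏ i, (A n (I i))⁻¹) * (Q n ^ (-γ) * ∏ a, (s n (π n (I a)))⁻¹)) := by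
            have := Finset.prod_nonneg fun i (_ : i ∈ Finset.univ) => (inv_pos.2 (hA n (I i))).le
            gcongr
        _ = b n I := by
            simp only [hb, hI, if_true, mul_inv, Finset.prod_mul_distrib]
            ring
    · have h1 := abs_compound_dual_le hL (hAs n) (b := fun _ => 1) (fun _ => one_pos)
        (fun i j => by rw [mul_one]; exact hrow n i j) I J
      rw [Finset.prod_mul_distrib, hprod n, Equiv.prod_comp (π n) (s n), hsκ n, one_mul,
        Finset.prod_const_one, mul_one, ← hC₀, ← mul_assoc, ← hK₀] at h1
      refine h1.trans (le_of_eq ?_)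
      simp only [hb, hI, if_false, inv_one, Finset.prod_const_one, mul_one]
  have hlogb : ∀ n I, Real.log (b n I) = Real.log K₀
      - ∑ a, (Real.log (A n (I a)) + Real.log (s n (π n (I a))))
      + (if I = I₀ n then -γ * Real.log (Q n) else 0) := by
    intro n I
    have h1 : (∏ a, (A n (I a) * s n (π n (I a)))⁻¹) ≠ 0 :=
      (Finset.prod_pos fun a _ => inv_pos.2 (hAs n _)).ne'
    have h2 : (if I = I₀ n then Q n ^ (-γ) else 1) ≠ 0 := by
      split_ifs
      · exact (Real.rpow_pos_of_pos (hQ0 n) _).ne'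
      · exact one_ne_zero
    simp only [hb]
    rw [Real.log_mul (mul_ne_zero hK₀0.ne' h1) h2, Real.log_mul hK₀0.ne' h1,
      Real.log_prod fun a _ => (inv_pos.2 (hAs n (I a))).ne']
    have h3 : ∀ a, Real.log (A n (I a) * s n (π n (I a)))⁻¹
        = -(Real.log (A n (I a)) + Real.log (s n (π n (I a)))) := fun a => by
      rw [Real.log_inv, Real.log_mul (hA n _).ne' (hs n _).ne']
    rw [Finset.sum_congr rfl fun a _ => h3 a, Finset.sum_neg_distrib]
    split_ifs
    · rw [Real.log_rpow (hQ0 n)]; ring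
    · rw [Real.log_one]; ring
  have hlogQ0 : ∀ n, 0 ≤ Real.log (Q n) := fun n => Real.log_nonneg (hQ1 n)
  have hlogA : ∀ n i, |Real.log (A n i)| ≤ d * (B * Real.log (Q n)) := by
    intro n i
    have h1 := abs_le_of_sum_eq (f := fun i => -Real.log (A n i)) (v := 0)
      (mul_nonneg hB (hlogQ0 n)) (fun i => by
        rw [neg_le_neg_iff, ← Real.log_rpow (hQ0 n)]
        exact Real.log_le_log (hA n i) (hAB n i))
      (by
        rw [Finset.sum_neg_distrib, ← Real.log_prod fun i _ => (hA n i).ne', hprod n, Real.log_one,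
          neg_zero]) i
    simpa using h1
  obtain ⟨c₁, hc₁, hs₁⟩ : ∃ c₁ : ℝ, 0 ≤ c₁ ∧ ∀ n j, -(c₁ + B * Real.log (Q n)) ≤ Real.log (s n j) := by
    obtain ⟨K, hK1, hK⟩ := exists_one_le_bound fun p : Fin d × Fin d => Lr⁻¹ p.1 p.2
    refine ⟨Real.log (d * (K * d)), Real.log_nonneg ?_, fun n j => ?_⟩
    · exact one_le_mul_of_one_le_of_one_le hd1 (one_le_mul_of_one_le_of_one_le hK1 hd1)
    have hQB : 0 < Q n ^ B := Real.rpow_pos_of_pos (hQ0 n) _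
    obtain ⟨i, hi⟩ : ∃ i, x n i j ≠ 0 := by
      by_contra! h0
      exact (hx n).ne_zero (det_eq_zero_of_column_eq_zero j h0)
    have h1 : (x n).map (Int.cast : ℤ → ℝ) = Lr⁻¹ * (Lr * (x n).map (Int.cast : ℤ → ℝ)) := by
      rw [← Matrix.mul_assoc, nonsing_inv_mul _ (isUnit_iff_ne_zero.2 hL), Matrix.one_mul]
    have h2 : (1 : ℝ) ≤ |((x n).map (Int.cast : ℤ → ℝ)) i j| := by
      rw [map_apply]
      exact_mod_cast Int.one_le_abs hi
    rw [h1, Matrix.mul_apply] at h2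
    have h3 : (1 : ℝ) ≤ (d * (K * d)) * Q n ^ B * s n j := by
      refine h2.trans ((Finset.abs_sum_le_sum_abs _ _).trans ?_)
      refine (Finset.sum_le_card_nsmul _ _ (K * (d * (Q n ^ B * s n j))) fun l _ => ?_).trans
        (le_of_eq ?_)
      · rw [abs_mul]
        refine mul_le_mul (hK (i, l)) ((hcol n l j).trans ?_) (abs_nonneg _) (by linarith)
        have := (hs n j).le
        have := hAB n l
        gcongr
      · rw [Finset.card_univ, Fintype.card_fin, nsmul_eq_mul]
        ring
    have h4 := Real.log_nonneg h3
    have h5 : (d : ℝ) * (K * d) ≠ 0 := by positivity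
    rw [Real.log_mul (mul_ne_zero h5 hQB.ne') (hs n j).ne', Real.log_mul h5 hQB.ne',
      Real.log_rpow (hQ0 n)] at h4
    linarith
  have hlogs : ∀ n j, |Real.log (s n j)| ≤ |Real.log κ| + d * (c₁ + B * Real.log (Q n)) := by
    intro n j
    refine abs_le_of_sum_eq (f := fun j => Real.log (s n j))
      (add_nonneg hc₁ (mul_nonneg hB (hlogQ0 n))) (hs₁ n) ?_ j
    rw [← Real.log_prod fun i _ => (hs n i).ne', hsκ n]
  have hlogQ : Tendsto (fun n => Real.log (Q n)) atTop atTop := Real.tendsto_log_atTop.comp hQ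
  obtain ⟨c, hc⟩ := sum_orderEmbedding_sum d k
  have hsumlog : ∀ n, ∑ I, Real.log (b n I)
      = (Fintype.card (Fin k ↪o Fin d) * Real.log K₀ - c * Real.log κ) - γ * Real.log (Q n) := by
    intro n
    simp only [hlogb]
    rw [Finset.sum_add_distrib, Finset.sum_sub_distrib,
      hc fun i => Real.log (A n i) + Real.log (s n (π n i)), Finset.sum_add_distrib,
      Equiv.sum_comp (π n) fun i => Real.log (s n i), ← Real.log_prod fun i _ => (hA n i).ne',
      ← Real.log_prod fun i _ => (hs n i).ne', hprod n, hsκ n, Finset.sum_const, Finset.card_univ,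
      nsmul_eq_mul, Finset.sum_ite_eq' Finset.univ (I₀ n), Real.log_one, zero_add,
      if_pos (Finset.mem_univ _)]
    ring
  have hbγ : ∀ᶠ n in atTop, ∑ I, Real.log (b n I) ≤ -(γ / 2) * Real.log (Q n) := by
    filter_upwards [hlogQ.eventually_ge_atTop
      ((Fintype.card (Fin k ↪o Fin d) * Real.log K₀ - c * Real.log κ) / (γ / 2))] with n hn
    rw [hsumlog]
    rw [div_le_iff₀ (by positivity)] at hn
    linarith
  have hbK : ∀ᶠ n in atTop, ∀ I, |Real.log (b n I)|
      ≤ (1 + k * (d * B + (1 + d * (1 + B))) + γ) * Real.log (Q n) := by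
    filter_upwards [hlogQ.eventually_ge_atTop |Real.log K₀|, hlogQ.eventually_ge_atTop |Real.log κ|,
      hlogQ.eventually_ge_atTop c₁] with n h1 h2 h3 I
    rw [hlogb]
    have h4 : |∑ a, (Real.log (A n (I a)) + Real.log (s n (π n (I a))))|
        ≤ k * ((d * B + (1 + d * (1 + B))) * Real.log (Q n)) := by
      refine (Finset.abs_sum_le_sum_abs _ _).trans ((Finset.sum_le_card_nsmul _ _
        ((d * B + (1 + d * (1 + B))) * Real.log (Q n)) fun a _ => ?_).trans (le_of_eq ?_))
      · have h5 := hlogA n (I a)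
        have h6 := hlogs n (π n (I a))
        have h7 : d * (c₁ + B * Real.log (Q n)) ≤ d * (Real.log (Q n) + B * Real.log (Q n)) := by
          gcongr
        calc _ ≤ _ := abs_add_le _ _
          _ ≤ d * (B * Real.log (Q n)) +
              (Real.log (Q n) + d * (Real.log (Q n) + B * Real.log (Q n))) :=
            add_le_add h5 (h6.trans (add_le_add h2 h7))
          _ = _ := by ring
      · rw [Finset.card_univ, Fintype.card_fin, nsmul_eq_mul]
    have h8 : |if I = I₀ n then -γ * Real.log (Q n) else 0| ≤ γ * Real.log (Q n) := by
      have := mul_nonneg hγ.le (hlogQ0 n)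
      split_ifs
      · rw [neg_mul, abs_neg, abs_of_nonneg this]
      · rwa [abs_zero]
    calc _ ≤ |Real.log K₀| + |∑ a, (Real.log (A n (I a)) + Real.log (s n (π n (I a))))|
          + |if I = I₀ n then -γ * Real.log (Q n) else 0| :=
            (abs_add_le _ _).trans (add_le_add_left (abs_sub _ _) _)
      _ ≤ Real.log (Q n) + k * ((d * B + (1 + d * (1 + B))) * Real.log (Q n))
          + γ * Real.log (Q n) := add_le_add (add_le_add h1 h4) h8
      _ = _ := by ring
  have hWW : ((compound k L)ᵀ).map φ * (compound k Lr⁻¹)ᵀ = 1 := by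
    have h1 : ((compound k L)ᵀ).map φ = (compound k Lr)ᵀ := by
      rw [hLr, compound_map, transpose_map]
    rw [h1, ← transpose_mul, ← compound_mul, nonsing_inv_mul _ (isUnit_iff_ne_zero.2 hL),
      compound_one, transpose_one]
  have : Nonempty (Fin k ↪o Fin d) := ⟨J₀⟩
  obtain ⟨w, hw, hfreq⟩ := exists_frequently_normal φ hφ (compound k L)ᵀ hWW hQ hb0
    (half_pos hγ) hbK hbγ Z hZdet (fun _ => J₀) hy
  obtain ⟨Wb, hWb1, hWb⟩ := exists_one_le_bound fun I => (w I : ℝ)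
  have hzero : ∀ I : Fin k ↪o Fin d, (∃ a, I a = l₀) →
      (compound k Lr *ᵥ fun l => (w l : ℝ)) I = 0 := by
    intro I hI
    by_contra hne
    have hlim : Tendsto (fun n => Wb * (k.factorial * (d ^ k * max 1 κ)) * Q n ^ (-ρ)) atTop
        (nhds 0) := by
      have := ((tendsto_rpow_neg_atTop hρ).comp hQ).const_mul
        (Wb * (k.factorial * (d ^ k * max 1 κ)))
      rw [mul_zero] at this
      exact this
    obtain ⟨n, hn, hn'⟩ := (hfreq.and_eventually (hlim.eventually_lt_const (abs_pos.2 hne))).exists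
    obtain ⟨e, -, ⟨I', hI'⟩, he⟩ := exists_compound_col_eq (hx n) hw J₀ hn Lr
    rw [he I] at hn'
    have h1 : |(e : ℝ)| ≤ Wb := le_trans (by exact_mod_cast hI') (hWb I')
    have h2 : |compound k (Lr * (x n).map (Int.cast : ℤ → ℝ)) I J₀|
        ≤ k.factorial * (d ^ k * max 1 κ) * Q n ^ (-ρ) := by
      rw [compound_apply]
      refine (abs_det_le_of_le_mul _ (a := fun l => d * A n (I l)) (b := fun l => s n (J₀ l))
        fun i j => by rw [mul_assoc]; exact hcol n _ _).trans ?_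
      rw [Finset.prod_mul_distrib, Finset.prod_const, Finset.card_univ, Fintype.card_fin]
      have h3 := prod_le_rpow_neg hk (hA n) (hprod n) (Real.one_le_rpow (hQ1 n) hρ.le) (hAρ n) I hI
      rw [← Real.rpow_neg (hQ0 n).le] at h3
      have h4 := prod_castLE_le hk (hs n) (hmono n)
      rw [hsκ n] at h4
      have h5 := Finset.prod_nonneg fun i (_ : i ∈ Finset.univ) => (hs n (J₀ i)).le
      have h7 := Real.rpow_nonneg (hQ0 n).le (-ρ)
      calc _ ≤ k.factorial * (d ^ k * Q n ^ (-ρ) * max 1 κ) := by gcongr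
        _ = _ := by ring
    have h6 : |(e : ℝ)| * |compound k (Lr * (x n).map (Int.cast : ℤ → ℝ)) I J₀|
        ≤ Wb * (k.factorial * (d ^ k * max 1 κ) * Q n ^ (-ρ)) :=
      mul_le_mul h1 h2 (abs_nonneg _) (by linarith)
    linarith
  obtain ⟨n, hn⟩ := hfreq.exists
  obtain ⟨e, he0, -, he⟩ := exists_compound_col_eq (hx n) hw J₀ hn Lr
  have hydet : (Lr * (x n).map (Int.cast : ℤ → ℝ)).det ≠ 0 := by
    rw [det_mul]
    refine mul_ne_zero hL ?_
    have h1 := RingHom.map_det (Int.castRingHom ℝ) (x n)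
    have h2 : ((x n).map (Int.cast : ℤ → ℝ)).det = ((x n).det : ℝ) := h1.symm
    rw [h2]
    exact_mod_cast (hx n).ne_zero
  obtain ⟨I, hI, hI'⟩ := exists_compound_ne_zero hydet l₀ J₀ ⟨0, hk0⟩ (by
    refine hl₀ (fun l => x n l (J₀ ⟨0, hk0⟩)) fun h0 => ?_
    exact (hx n).ne_zero (det_eq_zero_of_column_eq_zero _ fun i => congrFun h0 i))
  have h1 := he I
  rw [hzero I hI, abs_zero] at h1
  refine mul_ne_zero ?_ (abs_ne_zero.2 hI') h1.symm
  simpa using he0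

/-- A sequence of weights with short lattice vectors cannot exist. -/
theorem not_short_vectors {O : Type*} [CommRing O] [IsDomain O] [Module.Finite ℤ O]
    [Module.Free ℤ O] (φ : O →+* ℝ) (hφ : Function.Injective φ) {d : ℕ}
    (L : Matrix (Fin d) (Fin d) O) (hL : (L.map φ).det ≠ 0) (l₀ : Fin d)
    (hl₀ : ∀ z : Fin d → ℤ, z ≠ 0 → (L.map φ *ᵥ fun l => (z l : ℝ)) l₀ ≠ 0)
    {Q : ℕ → ℝ} (hQ : Tendsto Q atTop atTop) (hQ1 : ∀ n, 1 ≤ Q n) {A : ℕ → Fin d → ℝ}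
    (hA : ∀ n i, 0 < A n i) (hprod : ∀ n, ∏ i, A n i = 1) {ρ B : ℝ} (hρ : 0 < ρ) (hB : 0 ≤ B)
    (hAρ : ∀ n i, i ≠ l₀ → Q n ^ ρ ≤ A n i) (hAB : ∀ n i, A n i ≤ Q n ^ B)
    {z : ℕ → Fin d → ℤ} (hz : ∀ n, z n ≠ 0)
    (hzA : ∀ n i, |(L.map φ *ᵥ fun l => (z n l : ℝ)) i| ≤ A n i * Q n ^ (-ρ)) : False := by
  have hd : 0 < d := l₀.pos
  have hQ0 : ∀ n, 0 < Q n := fun n => one_pos.trans_le (hQ1 n)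
  choose x π s hx hs hsκ hmono hrow hcol hmin using
    fun n => exists_weighted_basis hL (hA n) (hprod n)
  set κ : ℝ := (∏ j : Fin d, (2 : ℝ) ^ (j : ℕ)) * |(L.map φ).det| with hκ
  have hκ0 : 0 < κ := mul_pos (Finset.prod_pos fun _ _ => by positivity) (abs_pos.2 hL)
  set γ : ℝ := ρ / (2 * d) with hγ
  have hγ0 : 0 < γ := by positivity
  have hev : ∀ᶠ n in atTop, ∃ k ∈ Set.Iio d, 0 < k ∧ ∃ hk : k < d, ∀ j : Fin d, (j : ℕ) + 1 = k →
      Q n ^ γ * s n j ≤ s n ⟨k, hk⟩ := by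
    have hlim := (tendsto_rpow_neg_atTop (half_pos hρ)).comp hQ
    filter_upwards [hlim.eventually_lt_const (lt_min one_pos hκ0)] with n hn
    obtain ⟨k, h1, hk, h2⟩ := exists_gap (hs n) (Real.one_le_rpow (hQ1 n) hγ0.le) (hsκ n)
      (fun i hi => by
        refine lt_of_le_of_lt ?_ hn
        have h1 := hmin n i hi (z n) (hz n) _ (Real.rpow_nonneg (hQ0 n).le _) (hzA n)
        have h2 : Q n ^ (-(ρ / 2)) = Q n ^ (-ρ) * (Q n ^ γ) ^ d := by
          rw [← Real.rpow_natCast, ← Real.rpow_mul (hQ0 n).le, ← Real.rpow_add (hQ0 n), hγ]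
          congr 1
          have : (d : ℝ) ≠ 0 := by positivity
          field_simp
          ring
        rw [Function.comp_apply, h2]
        exact mul_le_mul_of_nonneg_right h1 (pow_nonneg (Real.rpow_nonneg (hQ0 n).le _) _)) hd
    exact ⟨k, hk, h1, hk, h2⟩
  obtain ⟨k, hk, hk0, hfreq⟩ : ∃ k, ∃ hk : k < d, 0 < k ∧ ∃ᶠ n in atTop, ∀ j : Fin d,
      (j : ℕ) + 1 = k → Q n ^ γ * s n j ≤ s n ⟨k, hk⟩ := by
    by_contra! h
    have h1 : ∀ᶠ n in atTop, ∀ k ∈ Set.Iio d, ∀ hk : k < d, 0 < k →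
        ¬ ∀ j : Fin d, (j : ℕ) + 1 = k → Q n ^ γ * s n j ≤ s n ⟨k, hk⟩ := by
      refine (eventually_all_finite (Set.finite_Iio d)).2 fun k hk => ?_
      rcases k.eq_zero_or_pos with rfl | hk0
      · exact Eventually.of_forall fun n _ h0 => absurd h0 (lt_irrefl 0)
      · filter_upwards [h k hk hk0] with n hn _ _ hall
        obtain ⟨j, hj, hlt⟩ := hn
        exact absurd (hall j hj) (not_le.2 hlt)
    obtain ⟨n, ⟨k, hk, hk0, hk', hgap⟩, hn⟩ := (hev.and h1).exists
    exact hn k hk hk' hk0 hgap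
  obtain ⟨ψ, hψ, hgap⟩ := extraction_of_frequently_atTop hfreq
  exact not_gap_sequence φ hφ L hL l₀ hl₀ (hQ.comp hψ.tendsto_atTop) (fun n => hQ1 (ψ n))
    (fun n => hA (ψ n)) (fun n => hprod (ψ n)) hρ hB hγ0 (fun n => hAρ (ψ n)) (fun n => hAB (ψ n))
    hk0 hk hκ0 (fun n => hx (ψ n)) (fun n => hs (ψ n)) (fun n => hsκ (ψ n)) (fun n => hmono (ψ n))
    (fun n => hrow (ψ n)) (fun n => hcol (ψ n)) hgap

end

section

open Matrix Filter

theorem sum_int_mul_ne_zero {d : ℕ} {α : Fin d → ℝ} (hli : LinearIndependent ℚ α)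
    {n : Fin d → ℤ} (hn : n ≠ 0) : ∑ k, (n k : ℝ) * α k ≠ 0 := by
  intro h
  refine hn (funext fun k => ?_)
  have h1 := Fintype.linearIndependent_iff.1 hli (fun k => (n k : ℚ))
    (by rw [← h]; exact Finset.sum_congr rfl fun k _ => by rw [Rat.smul_def]; simp) k
  exact_mod_cast h1

theorem exists_schmidt_bound_of_isIntegral {d : ℕ} {α : Fin d → ℝ}
    (hint : ∀ i, IsIntegral ℤ (α i)) (hli : LinearIndependent ℚ α) :
    ∃ c : ℝ, 0 < c ∧ ∀ n : Fin d → ℤ, n ≠ 0 → ∀ l, c * max 1 |(n l : ℝ)| ^ (1 / 2 : ℝ)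
      ≤ |∑ k, (n k : ℝ) * α k| * ∏ k, max 1 |(n k : ℝ)| := by
  by_contra! hcon
  have hseq : ∀ m : ℕ, ∃ n : Fin d → ℤ, n ≠ 0 ∧ ∃ l, (∀ k, |n k| ≤ |n l|) ∧
      |∑ k, (n k : ℝ) * α k| * ∏ k, max 1 |(n k : ℝ)|
        < ((m : ℝ) + 1)⁻¹ * |(n l : ℝ)| ^ (1 / 2 : ℝ) := by
    intro m
    obtain ⟨n, hn, l', h⟩ := hcon ((m : ℝ) + 1)⁻¹ (by positivity)
    have : Nonempty (Fin d) := ⟨l'⟩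
    obtain ⟨l, hl⟩ := Finite.exists_max fun k => |n k|
    refine ⟨n, hn, l, hl, h.trans_le ?_⟩
    have h1 : (1 : ℝ) ≤ |(n l : ℝ)| := by
      obtain ⟨k, hk⟩ : ∃ k, n k ≠ 0 := by
        by_contra! h0
        exact hn (funext h0)
      exact_mod_cast (Int.one_le_abs hk).trans (hl k)
    have h2 : |(n l' : ℝ)| ≤ |(n l : ℝ)| := by exact_mod_cast hl l'
    gcongr
    exact max_le h1 h2
  choose n hn l hl hlt using hseq
  have hd : 0 < d := (l 0).pos
  have hQ1' : ∀ m, (1 : ℝ) ≤ |(n m (l m) : ℝ)| := by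
    intro m
    obtain ⟨k, hk⟩ : ∃ k, n m k ≠ 0 := by
      by_contra! h0
      exact hn m (funext h0)
    exact_mod_cast (Int.one_le_abs hk).trans (hl m k)
  have hlim : Tendsto (fun m => |(n m (l m) : ℝ)|) atTop atTop := by
    rw [tendsto_atTop]
    intro R
    have hfin : (Set.Icc (fun _ => -⌈R⌉) (fun _ => ⌈R⌉) : Set (Fin d → ℤ)).Finite :=
      Set.finite_Icc _ _
    have hev : ∀ᶠ m : ℕ in atTop, ∀ v ∈ (Set.Icc (fun _ => -⌈R⌉) (fun _ => ⌈R⌉) : Set (Fin d → ℤ)),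
        v ≠ 0 → ((m : ℝ) + 1)⁻¹ * |R| ^ (1 / 2 : ℝ) < |∑ k, (v k : ℝ) * α k| := by
      refine (eventually_all_finite hfin).2 fun v _ => ?_
      by_cases hv : v = 0
      · exact Eventually.of_forall fun m h => absurd hv h
      have h1 : Tendsto (fun m : ℕ => ((m : ℝ) + 1)⁻¹ * |R| ^ (1 / 2 : ℝ)) atTop (nhds 0) := by
        have := (tendsto_one_div_add_atTop_nhds_zero_nat (𝕜 := ℝ)).mul_const (|R| ^ (1 / 2 : ℝ))
        simpa using this
      filter_upwards [h1.eventually_lt_const (abs_pos.2 (sum_int_mul_ne_zero hli hv))] with m hm _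
      exact hm
    filter_upwards [hev] with m hm
    by_contra! hlt'
    have hmem : ∀ k, |n m k| ≤ ⌈R⌉ := by
      intro k
      have h0 : ((|n m (l m)| : ℤ) : ℝ) ≤ (⌈R⌉ : ℤ) := by
        push_cast
        exact hlt'.le.trans (Int.le_ceil R)
      exact (hl m k).trans (by exact_mod_cast h0)
    have h2 := hm (n m) ⟨fun k => (abs_le.1 (hmem k)).1, fun k => (abs_le.1 (hmem k)).2⟩ (hn m)
    have h3 := hlt m
    have h4 : |∑ k, (n m k : ℝ) * α k|
        ≤ |∑ k, (n m k : ℝ) * α k| * ∏ k, max 1 |(n m k : ℝ)| := by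
      refine le_mul_of_one_le_right (abs_nonneg _) ?_
      have := Finset.prod_le_prod (s := Finset.univ) (f := fun _ : Fin d => (1 : ℝ))
        (g := fun k => max 1 |(n m k : ℝ)|) (fun _ _ => zero_le_one) fun k _ => le_max_left _ _
      simpa using this
    have h5 : ((m : ℝ) + 1)⁻¹ * |(n m (l m) : ℝ)| ^ (1 / 2 : ℝ)
        ≤ ((m : ℝ) + 1)⁻¹ * |R| ^ (1 / 2 : ℝ) := by
      exact mul_le_mul_of_nonneg_left (Real.rpow_le_rpow (abs_nonneg _)
        (hlt'.le.trans (le_abs_self R)) (by norm_num)) (by positivity)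
    linarith
  obtain ⟨l₀, -, ψ, hψ, hψl⟩ := exists_strictMono_fiber (S := Set.univ) Set.finite_univ (f := l)
    (Eventually.of_forall fun _ => Set.mem_univ _).frequently
  set O := Algebra.adjoin ℤ (Set.range α) with hO
  have hfin : Module.Finite ℤ O := Module.Finite.iff_fg.2
    (fg_adjoin_of_finite (Set.finite_range α) (by rintro _ ⟨i, rfl⟩; exact hint i))
  set a : Fin d → O := fun i => ⟨α i, Algebra.subset_adjoin ⟨i, rfl⟩⟩
  set φ : O →+* ℝ := O.val.toRingHom with hφ
  set L : Matrix (Fin d) (Fin d) O := updateRow 1 l₀ a with hL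
  have hLr : L.map φ = updateRow 1 l₀ α := by
    rw [hL, map_updateRow, Matrix.map_one _ (map_zero φ) (map_one φ)]
    rfl
  have hLv0 : ∀ v : Fin d → ℝ, (L.map φ *ᵥ v) l₀ = ∑ k, v k * α k := by
    intro v
    rw [hLr]
    simp [mulVec, dotProduct, mul_comm]
  have hLv : ∀ v : Fin d → ℝ, ∀ i, i ≠ l₀ → (L.map φ *ᵥ v) i = v i := by
    intro v i hi
    rw [hLr]
    simp [mulVec, dotProduct, hi, Matrix.one_apply]
  have hdet : (L.map φ).det ≠ 0 := by
    rw [hLr, ← cramer_transpose_apply, transpose_one, cramer_one]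
    exact hli.ne_zero l₀
  set Q : ℕ → ℝ := fun m => |(n (ψ m) l₀ : ℝ)| with hQ
  have hQl : ∀ m, |(n (ψ m) (l (ψ m)) : ℝ)| = Q m := fun m => by rw [hψl]
  have hQ1 : ∀ m, 1 ≤ Q m := fun m => by rw [← hQl]; exact hQ1' _
  have hQ0 : ∀ m, 0 < Q m := fun m => one_pos.trans_le (hQ1 m)
  have hQlim : Tendsto Q atTop atTop :=
    (hlim.comp hψ.tendsto_atTop).congr fun m => hQl m
  set ρ : ℝ := 1 / (2 * d) with hρ
  have hρ0 : 0 < ρ := by positivity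
  set P : ℕ → Fin d → ℝ := fun m i => max 1 |(n (ψ m) i : ℝ)| with hP
  have hP1 : ∀ m i, 1 ≤ P m i := fun m i => le_max_left _ _
  have hPQ : ∀ m i, P m i ≤ Q m := by
    intro m i
    refine max_le (hQ1 m) ?_
    rw [← hQl]
    exact_mod_cast hl (ψ m) i
  set E : ℕ → ℝ := fun m => ∏ i ∈ Finset.univ.erase l₀, P m i * Q m ^ ρ with hE
  have hPpos : ∀ m i, 0 < P m i * Q m ^ ρ := fun m i =>
    mul_pos (one_pos.trans_le (hP1 m i)) (Real.rpow_pos_of_pos (hQ0 m) _)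
  have hE0 : ∀ m, 0 < E m := fun m => Finset.prod_pos fun i _ => hPpos m i
  have hge : ∀ m i, Q m ^ ρ ≤ P m i * Q m ^ ρ := fun m i =>
    le_mul_of_one_le_left (Real.rpow_nonneg (hQ0 m).le _) (hP1 m i)
  have hE1 : ∀ m, 1 ≤ E m := by
    intro m
    have := Finset.prod_le_prod (s := Finset.univ.erase l₀) (f := fun _ : Fin d => (1 : ℝ))
      (g := fun i => P m i * Q m ^ ρ) (fun _ _ => zero_le_one)
      fun i _ => (Real.one_le_rpow (hQ1 m) hρ0.le).trans (hge m i)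
    simpa [hE] using this
  refine not_short_vectors φ Subtype.val_injective L hdet l₀ (fun z hz => ?_) hQlim hQ1
    (A := fun m => Function.update (fun i => P m i * Q m ^ ρ) l₀ (E m)⁻¹) ?_ ?_ hρ0
    (B := 1 + ρ) (by positivity) ?_ ?_ (z := fun m => n (ψ m)) (fun m => hn _) ?_
  · rw [hLv0]
    exact sum_int_mul_ne_zero hli hz
  · intro m i
    rcases eq_or_ne i l₀ with rfl | hi
    · simpa using hE0 m
    · simpa [hi] using hPpos m i
  · intro m
    rw [← Finset.mul_prod_erase _ _ (Finset.mem_univ l₀), Function.update_self]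
    rw [Finset.prod_congr rfl fun i hi => Function.update_of_ne (Finset.ne_of_mem_erase hi) _ _]
    exact inv_mul_cancel₀ (hE0 m).ne'
  · intro m i hi
    simp only [Function.update_of_ne hi]
    exact hge m i
  · intro m i
    rcases eq_or_ne i l₀ with rfl | hi
    · rw [Function.update_self]
      exact (inv_le_one_of_one_le₀ (hE1 m)).trans (Real.one_le_rpow (hQ1 m) (by positivity))
    · rw [Function.update_of_ne hi, Real.rpow_add (hQ0 m), Real.rpow_one]
      exact mul_le_mul_of_nonneg_right (hPQ m i) (Real.rpow_nonneg (hQ0 m).le _)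
  · intro m i
    rcases eq_or_ne i l₀ with rfl | hi
    · rw [Function.update_self, hLv0]
      have h1 := hlt (ψ m)
      rw [hQl, ← Finset.mul_prod_erase _ _ (Finset.mem_univ i)] at h1
      have h2 : (E m)⁻¹ * Q m ^ (-ρ)
          = Q m ^ (-(1 / 2) : ℝ) * (∏ k ∈ Finset.univ.erase i, P m k)⁻¹ := by
        rw [hE]
        simp only
        rw [Finset.prod_mul_distrib, Finset.prod_const, Finset.card_erase_of_mem (Finset.mem_univ i),
          Finset.card_univ, Fintype.card_fin, mul_inv, mul_assoc, mul_comm, Real.rpow_neg (hQ0 m).le,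
          ← mul_inv, ← pow_succ, Nat.sub_add_cancel hd, ← Real.rpow_natCast,
          ← Real.rpow_mul (hQ0 m).le, ← Real.rpow_neg (hQ0 m).le, hρ]
        congr 2
        have : (d : ℝ) ≠ 0 := by positivity
        field_simp
      have h3 : 0 < ∏ k ∈ Finset.univ.erase i, P m k :=
        Finset.prod_pos fun k _ => one_pos.trans_le (hP1 m k)
      rw [h2, ← div_eq_mul_inv, le_div_iff₀ h3]
      have h4 : P m i = Q m := max_eq_right (hQ1 m)
      have h5 : |∑ k, (n (ψ m) k : ℝ) * α k| * (∏ k ∈ Finset.univ.erase i, P m k) * Q m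
          ≤ Q m ^ (1 / 2 : ℝ) := by
        calc _ = |∑ k, (n (ψ m) k : ℝ) * α k| * (P m i * ∏ k ∈ Finset.univ.erase i, P m k) := by
              rw [h4]; ring
          _ ≤ (((ψ m : ℕ) : ℝ) + 1)⁻¹ * Q m ^ (1 / 2 : ℝ) := h1.le
          _ ≤ _ := by
              refine mul_le_of_le_one_left (Real.rpow_nonneg (hQ0 m).le _)
                (inv_le_one_of_one_le₀ ?_)
              have : (0 : ℝ) ≤ (ψ m : ℕ) := Nat.cast_nonneg _
              linarith
      rw [← mul_le_mul_iff_left₀ (hQ0 m)]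
      refine h5.trans (le_of_eq ?_)
      nth_rewrite 3 [← Real.rpow_one (Q m)]
      rw [← Real.rpow_add (hQ0 m)]
      norm_num
    · rw [Function.update_of_ne hi, hLv _ _ hi, mul_assoc, ← Real.rpow_add (hQ0 m), add_neg_cancel,
        Real.rpow_zero, mul_one]
      exact le_max_right _ _

/-- Schmidt's lower bound for linear forms with algebraic coefficients. -/
theorem exists_schmidt_bound {d : ℕ} {α : Fin d → ℝ} (halg : ∀ i, IsAlgebraic ℚ (α i))
    (hli : LinearIndependent ℚ α) :
    ∃ c : ℝ, 0 < c ∧ ∀ n : Fin d → ℤ, n ≠ 0 → ∀ l, c * max 1 |(n l : ℝ)| ^ (1 / 2 : ℝ)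
      ≤ |∑ k, (n k : ℝ) * α k| * ∏ k, max 1 |(n k : ℝ)| := by
  choose D hD0 hD using fun i =>
    ((IsFractionRing.isAlgebraic_iff ℤ ℚ ℝ).2 (halg i)).exists_integral_multiple
  set q : ℤ := ∏ i, D i with hq
  have hq0 : (q : ℝ) ≠ 0 := by exact_mod_cast Finset.prod_ne_zero_iff.2 fun i _ => hD0 i
  have hint : ∀ i, IsIntegral ℤ ((q : ℝ) * α i) := by
    intro i
    have h1 : (q : ℝ) * α i = ((∏ j ∈ Finset.univ.erase i, D j : ℤ) : ℝ) * (D i • α i) := by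
      rw [hq, ← Finset.mul_prod_erase _ _ (Finset.mem_univ i), zsmul_eq_mul]
      push_cast
      ring
    rw [h1]
    exact (isIntegral_algebraMap (R := ℤ) (A := ℝ)).mul (hD i)
  have hli' : LinearIndependent ℚ fun i => (q : ℝ) * α i := by
    have h1 := hli.map' (LinearMap.mulLeft ℚ (q : ℝ))
      (LinearMap.ker_eq_bot.2 (mul_right_injective₀ hq0))
    exact h1
  obtain ⟨c, hc, h⟩ := exists_schmidt_bound_of_isIntegral hint hli'
  refine ⟨c / |(q : ℝ)|, div_pos hc (abs_pos.2 hq0), fun n hn l => ?_⟩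
  have h1 := h n hn l
  have h2 : ∑ k, (n k : ℝ) * ((q : ℝ) * α k) = q * ∑ k, (n k : ℝ) * α k := by
    rw [Finset.mul_sum]
    exact Finset.sum_congr rfl fun k _ => by ring
  rw [h2, abs_mul] at h1
  rw [div_mul_eq_mul_div, div_le_iff₀ (abs_pos.2 hq0)]
  linarith

end

section

open Filter

theorem one_le_prod_max_one {d : ℕ} (n : Fin d → ℤ) : (1 : ℝ) ≤ ∏ k, max 1 |(n k : ℝ)| := by
  have := Finset.prod_le_prod (s := Finset.univ) (f := fun _ : Fin d => (1 : ℝ))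
    (g := fun k => max 1 |(n k : ℝ)|) (fun _ _ => zero_le_one) fun k _ => le_max_left _ _
  simpa using this

theorem exists_power_bound {d : ℕ} {α : Fin d → ℝ} (halg : ∀ i, IsAlgebraic ℚ (α i))
    (hli : LinearIndependent ℚ α) :
    ∃ c κ : ℝ, 0 < c ∧ 0 < κ ∧ κ < 1 ∧ ∀ n : Fin d → ℤ, n ≠ 0 →
      c ≤ |∑ k, (n k : ℝ) * α k| * (∏ k, max 1 |(n k : ℝ)|) ^ (1 - κ) := by
  obtain ⟨c, hc, h⟩ := exists_schmidt_bound halg hli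
  rcases Nat.eq_zero_or_pos d with rfl | hd
  · exact ⟨1, 1 / 2, one_pos, by norm_num, by norm_num, fun n hn => absurd (Subsingleton.elim n 0) hn⟩
  have hd' : (1 : ℝ) ≤ d := by exact_mod_cast hd
  refine ⟨c, 1 / (2 * d), hc, by positivity, ?_, fun n hn => ?_⟩
  · rw [div_lt_one (by positivity)]; linarith
  have : Nonempty (Fin d) := ⟨⟨0, hd⟩⟩
  obtain ⟨l, hl⟩ := Finite.exists_max fun k => max 1 |(n k : ℝ)|
  set P := ∏ k, max 1 |(n k : ℝ)| with hP
  have hP1 : 1 ≤ P := one_le_prod_max_one n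
  have hP0 : 0 < P := by linarith
  have h1 : P ≤ (max 1 |(n l : ℝ)|) ^ d := by
    have := Finset.prod_le_prod (s := Finset.univ) (fun k _ => by positivity) fun k _ => hl k
    simpa using this
  have h2 : P ^ (1 / (2 * d) : ℝ) ≤ max 1 |(n l : ℝ)| ^ (1 / 2 : ℝ) := by
    refine (Real.rpow_le_rpow hP0.le h1 (by positivity)).trans_eq ?_
    rw [← Real.rpow_natCast, ← Real.rpow_mul (by positivity)]
    congr 1
    field_simp
  rw [Real.rpow_sub hP0, Real.rpow_one, ← mul_div_assoc, le_div_iff₀ (by positivity)]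
  exact (mul_le_mul_of_nonneg_left h2 hc.le).trans (h n hn l)

/-- Sum of negative powers over a separated family of reals bounded away from zero. -/
theorem sum_rpow_neg_le_of_separated {ι : Type*} (B : Finset ι) (x : ι → ℝ) {γ p : ℝ}
    (hγ : 0 < γ) (hp : 1 < p) (hx : ∀ i ∈ B, γ ≤ |x i|)
    (hsep : ∀ i ∈ B, ∀ j ∈ B, i ≠ j → γ ≤ |x i - x j|) :
    ∑ i ∈ B, |x i| ^ (-p) ≤ (2 / γ) ^ p * ∑' j : ℤ, |(j : ℝ)| ^ (-p) := by
  have hS := Real.summable_abs_int_rpow hp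
  have hinj : Set.InjOn (fun i => ⌊x i / γ⌋) B := by
    intro i hi j hj hij
    by_contra hne
    have h1 := Int.abs_sub_lt_one_of_floor_eq_floor hij
    rw [← sub_div, abs_div, abs_of_pos hγ, div_lt_one hγ] at h1
    exact absurd (hsep i hi j hj hne) (not_le.2 h1)
  have hterm : ∀ i ∈ B, |x i| ^ (-p) ≤ (2 / γ) ^ p * |((⌊x i / γ⌋ : ℤ) : ℝ)| ^ (-p) := by
    intro i hi
    have hxi := hx i hi
    have hx0 : 0 < |x i| := hγ.trans_le hxi
    have h1 : 1 ≤ |x i / γ| := by rw [abs_div, abs_of_pos hγ, one_le_div hγ]; exact hxi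
    have hf0 : 0 < |((⌊x i / γ⌋ : ℤ) : ℝ)| := by
      rw [abs_pos]
      intro h0
      have h0' : ⌊x i / γ⌋ = 0 := by exact_mod_cast h0
      rw [Int.floor_eq_zero_iff] at h0'
      rw [abs_of_nonneg h0'.1] at h1
      exact absurd h0'.2 (not_lt.2 h1)
    have h2 : |((⌊x i / γ⌋ : ℤ) : ℝ)| ≤ 2 / γ * |x i| := by
      have h3 : |((⌊x i / γ⌋ : ℤ) : ℝ)| ≤ |x i / γ| + 1 := by
        have ha := Int.floor_le (x i / γ)
        have hb := Int.lt_floor_add_one (x i / γ)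
        rw [abs_le]
        constructor
        · linarith [neg_abs_le (x i / γ)]
        · linarith [le_abs_self (x i / γ)]
      have h4 : 2 / γ * |x i| = 2 * |x i / γ| := by
        rw [abs_div, abs_of_pos hγ]; ring
      linarith
    have h5 := Real.rpow_le_rpow_of_nonpos hf0 h2 (by linarith : -p ≤ 0)
    rw [Real.mul_rpow (by positivity) hx0.le, Real.rpow_neg (by positivity)] at h5
    have h6 : 0 < (2 / γ) ^ p := by positivity
    rw [inv_mul_le_iff₀ h6] at h5
    exact h5
  refine (Finset.sum_le_sum hterm).trans ?_
  rw [← Finset.mul_sum]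
  refine mul_le_mul_of_nonneg_left ?_ (by positivity)
  rw [← Finset.sum_image (f := fun j : ℤ => |(j : ℝ)| ^ (-p)) hinj]
  exact hS.sum_le_tsum _ fun j _ => by positivity

theorem abs_lt_two_pow_size (z : ℤ) : |(z : ℝ)| < 2 ^ z.natAbs.size := by
  have h := Nat.lt_size_self z.natAbs
  have h2 : ((z.natAbs : ℕ) : ℝ) < 2 ^ z.natAbs.size := by exact_mod_cast h
  rwa [Nat.cast_natAbs, Int.cast_abs] at h2

theorem two_pow_size_le (z : ℤ) : (2 : ℝ) ^ z.natAbs.size ≤ 2 * max 1 |(z : ℝ)| := by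
  rcases Nat.eq_zero_or_pos z.natAbs with h | h
  · rw [h]; simp; linarith [le_max_left 1 |(z : ℝ)|]
  · have hs : 0 < z.natAbs.size := Nat.size_pos.2 h
    have h1 : 2 ^ (z.natAbs.size - 1) ≤ z.natAbs := Nat.lt_size.1 (by omega)
    have h2 : (2 : ℝ) ^ (z.natAbs.size - 1) ≤ |(z : ℝ)| := by
      have : ((2 ^ (z.natAbs.size - 1) : ℕ) : ℝ) ≤ (z.natAbs : ℕ) := by exact_mod_cast h1
      rw [Nat.cast_natAbs, Int.cast_abs] at this
      simpa using this
    obtain ⟨m, hm⟩ : ∃ m, z.natAbs.size = m + 1 := ⟨_, (Nat.succ_pred_eq_of_pos hs).symm⟩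
    rw [hm] at h2 ⊢
    rw [pow_succ]
    simp at h2
    linarith [le_max_right 1 |(z : ℝ)|]

theorem sum_le_of_block_bound {d : ℕ} {ι : Type*} (u : Finset ι) (F : ι → ℝ) (e : ι → Fin d → ℕ)
    {r C : ℝ} (hr0 : 0 ≤ r) (hr1 : r < 1) (hC : 0 ≤ C)
    (h : ∀ v, ∑ i ∈ u with e i = v, F i ≤ C * ∏ k, r ^ v k) :
    ∑ i ∈ u, F i ≤ C * ((1 - r)⁻¹) ^ d := by
  classical
  rw [← Finset.sum_fiberwise_of_maps_to (t := u.image e) (g := e)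
    fun i hi => Finset.mem_image_of_mem e hi]
  refine (Finset.sum_le_sum fun v _ => h v).trans ?_
  rw [← Finset.mul_sum]
  refine mul_le_mul_of_nonneg_left ?_ hC
  set N := (u.image e).sup fun v => Finset.univ.sup v
  have hsub : u.image e ⊆ Fintype.piFinset fun _ : Fin d => Finset.range (N + 1) := by
    intro v hv
    rw [Fintype.mem_piFinset]
    intro k
    rw [Finset.mem_range, Nat.lt_succ_iff]
    exact (Finset.le_sup (f := v) (Finset.mem_univ k)).trans
      (Finset.le_sup (f := fun v : Fin d → ℕ => Finset.univ.sup v) hv)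
  refine (Finset.sum_le_sum_of_subset_of_nonneg hsub fun v _ _ => by positivity).trans ?_
  rw [← Finset.prod_univ_sum (fun _ : Fin d => Finset.range (N + 1)) fun _ j => r ^ j]
  rw [Finset.prod_const, Finset.card_univ, Fintype.card_fin]
  refine pow_le_pow_left₀ (Finset.sum_nonneg fun _ _ => by positivity) ?_ _
  rw [← tsum_geometric_of_lt_one hr0 hr1]
  exact (summable_geometric_of_lt_one hr0 hr1).sum_le_tsum _ fun _ _ => by positivity

theorem exists_sum_inv_le {d : ℕ} {α : Fin d → ℝ} (halg : ∀ i, IsAlgebraic ℚ (α i))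
    (hli : LinearIndependent ℚ α) :
    ∃ C : ℝ, 0 ≤ C ∧ ∀ u : Finset (Fin d → ℤ),
      ∑ n ∈ u, (|∑ k, (n k : ℝ) * α k| * ∏ k, max 1 |(n k : ℝ)|)⁻¹ ≤ C := by
  classical
  obtain ⟨c, κ, hc, hκ, hκ1, h⟩ := exists_power_bound halg hli
  set a : ℝ := ∑ k, |α k| with ha
  have ha0 : 0 ≤ a := Finset.sum_nonneg fun _ _ => abs_nonneg _
  set p : ℝ := 1 + κ / 2 with hp
  have hp1 : 1 < p := by linarith
  set S : ℝ := ∑' j : ℤ, |(j : ℝ)| ^ (-p) with hS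
  have hS0 : 0 ≤ S := tsum_nonneg fun _ => by positivity
  set r : ℝ := 2 ^ (-(κ ^ 2 / 2)) with hr
  have hr0 : 0 < r := by positivity
  have hr1 : r < 1 := Real.rpow_lt_one_of_one_lt_of_neg (by norm_num) (by nlinarith)
  set K : ℝ := 2 ^ d * a ^ (κ / 2) * ((2 / c) ^ p * ((2 ^ d) ^ (1 - κ)) ^ p * S) with hK
  have hK0 : 0 ≤ K := by positivity
  refine ⟨K * ((1 - r)⁻¹) ^ d, by have : 0 < 1 - r := by linarith
                                  positivity, fun u => ?_⟩
  rw [← Finset.sum_filter_of_ne (p := fun n : Fin d → ℤ => n ≠ 0) (by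
    rintro n _ hne rfl
    simp at hne)]
  refine sum_le_of_block_bound _ _ (fun n k => (n k).natAbs.size) hr0.le hr1 hK0 fun v => ?_
  set B := (u.filter fun n => n ≠ 0).filter fun n => (fun k => (n k).natAbs.size) = v with hB
  set Y : ℝ := ∏ k, (2 : ℝ) ^ v k with hY
  have hY1 : 1 ≤ Y := by
    have := Finset.prod_le_prod (s := Finset.univ) (f := fun _ : Fin d => (1 : ℝ))
      (g := fun k => (2 : ℝ) ^ v k) (fun _ _ => zero_le_one) fun k _ => one_le_pow₀ (by norm_num)
    simpa using this
  have hY0 : 0 < Y := by linarith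
  have hmem : ∀ n ∈ B, n ≠ 0 ∧ ∀ k, (n k).natAbs.size = v k := by
    intro n hn
    rw [hB, Finset.mem_filter, Finset.mem_filter] at hn
    exact ⟨hn.1.2, fun k => congrFun hn.2 k⟩
  set γ : ℝ := c / (2 ^ d * Y) ^ (1 - κ) with hγ
  have hγ0 : 0 < γ := by positivity
  have key : ∀ m : Fin d → ℤ, m ≠ 0 → (∀ k, |(m k : ℝ)| ≤ 2 * 2 ^ v k) →
      γ ≤ |∑ k, (m k : ℝ) * α k| := by
    intro m hm hmv
    rw [hγ, div_le_iff₀ (by positivity)]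
    refine (h m hm).trans (mul_le_mul_of_nonneg_left (Real.rpow_le_rpow ?_ ?_ (by linarith))
      (abs_nonneg _))
    · linarith [one_le_prod_max_one m]
    · have : (2 : ℝ) ^ d * Y = ∏ k : Fin d, 2 * 2 ^ v k := by
        rw [Finset.prod_mul_distrib]; simp [hY]
      rw [this]
      refine Finset.prod_le_prod (fun _ _ => by positivity) fun k _ => max_le ?_ (hmv k)
      have : (1 : ℝ) ≤ 2 ^ v k := one_le_pow₀ (by norm_num)
      linarith
  have hsize : ∀ n ∈ B, ∀ k, |(n k : ℝ)| < 2 ^ v k := by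
    intro n hn k
    rw [← (hmem n hn).2 k]
    exact abs_lt_two_pow_size _
  have hx : ∀ n ∈ B, γ ≤ |∑ k, (n k : ℝ) * α k| := fun n hn => key n (hmem n hn).1 fun k => by
    have := hsize n hn k
    have : (0 : ℝ) < 2 ^ v k := by positivity
    linarith
  have hsum := sum_rpow_neg_le_of_separated B (fun n => ∑ k, (n k : ℝ) * α k) hγ0 hp1 hx (by
    intro n hn n' hn' hne
    have := key (n - n') (sub_ne_zero.2 hne) fun k => by
      have h1 := hsize n hn k
      have h2 := hsize n' hn' k
      have h3 := abs_sub (n k : ℝ) (n' k)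
      push_cast [Pi.sub_apply]
      linarith
    simpa [sub_mul, Finset.sum_sub_distrib] using this)
  have hterm : ∀ n ∈ B, (|∑ k, (n k : ℝ) * α k| * ∏ k, max 1 |(n k : ℝ)|)⁻¹
      ≤ 2 ^ d * Y⁻¹ * (a * Y) ^ (κ / 2) * |∑ k, (n k : ℝ) * α k| ^ (-p) := by
    intro n hn
    set x := |∑ k, (n k : ℝ) * α k| with hxdef
    have hx0 : 0 < x := hγ0.trans_le (hx n hn)
    have hP : Y ≤ 2 ^ d * ∏ k, max 1 |(n k : ℝ)| := by
      have : (2 : ℝ) ^ d * ∏ k, max 1 |(n k : ℝ)| = ∏ k, 2 * max 1 |(n k : ℝ)| := by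
        rw [Finset.prod_mul_distrib]; simp
      rw [this]
      refine Finset.prod_le_prod (fun _ _ => by positivity) fun k _ => ?_
      rw [← (hmem n hn).2 k]
      exact two_pow_size_le _
    have hP0 : 0 < ∏ k, max 1 |(n k : ℝ)| := by linarith [one_le_prod_max_one n]
    have hxa : x ≤ a * Y := by
      refine (Finset.abs_sum_le_sum_abs _ _).trans ?_
      rw [ha, Finset.sum_mul]
      refine Finset.sum_le_sum fun k _ => ?_
      rw [abs_mul, mul_comm]
      refine mul_le_mul_of_nonneg_left ((hsize n hn k).le.trans ?_) (abs_nonneg _)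
      rw [hY, Finset.prod_pow_eq_pow_sum]
      exact pow_le_pow_right₀ (by norm_num)
        (Finset.single_le_sum (f := v) (fun _ _ => Nat.zero_le _) (Finset.mem_univ k))
    have h1 : (∏ k, max 1 |(n k : ℝ)|)⁻¹ ≤ 2 ^ d * Y⁻¹ := by
      rw [inv_le_iff_one_le_mul₀ hP0, mul_assoc, mul_comm Y⁻¹, ← mul_assoc,
        ← div_eq_mul_inv, one_le_div hY0]
      exact hP
    have h2 : x⁻¹ ≤ (a * Y) ^ (κ / 2) * x ^ (-p) := by
      have : x⁻¹ = x ^ (κ / 2) * x ^ (-p) := by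
        rw [← Real.rpow_add hx0, ← Real.rpow_neg_one]
        congr 1
        rw [hp]; ring
      rw [this]
      exact mul_le_mul_of_nonneg_right (Real.rpow_le_rpow hx0.le hxa (by linarith)) (by positivity)
    rw [mul_inv, mul_comm]
    calc _ ≤ 2 ^ d * Y⁻¹ * ((a * Y) ^ (κ / 2) * x ^ (-p)) :=
          mul_le_mul h1 h2 (by positivity) (by positivity)
      _ = _ := by ring
  refine (Finset.sum_le_sum hterm).trans ?_
  rw [← Finset.mul_sum]
  refine (mul_le_mul_of_nonneg_left hsum (by positivity)).trans_eq ?_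
  have hrY : ∏ k, r ^ v k = Y ^ (-(κ ^ 2 / 2)) := by
    rw [hY, ← Real.finsetProd_rpow _ _ fun _ _ => by positivity]
    refine Finset.prod_congr rfl fun k _ => ?_
    rw [hr, ← Real.rpow_natCast (2 : ℝ) (v k), ← Real.rpow_mul_natCast (by norm_num),
      ← Real.rpow_mul (by norm_num), mul_comm]
  have hγp : (2 / γ) ^ p = (2 / c) ^ p * ((2 ^ d) ^ (1 - κ)) ^ p * Y ^ ((1 - κ) * p) := by
    have : 2 / γ = 2 / c * (2 ^ d) ^ (1 - κ) * Y ^ (1 - κ) := by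
      rw [hγ, Real.mul_rpow (by positivity) hY0.le]
      field_simp
    rw [this, Real.mul_rpow (by positivity) (by positivity),
      Real.mul_rpow (by positivity) (by positivity), ← Real.rpow_mul hY0.le]
  rw [hrY, hγp, Real.mul_rpow ha0 hY0.le, hK]
  have hYe : Y ^ (-(κ ^ 2 / 2)) = Y⁻¹ * Y ^ (κ / 2) * Y ^ ((1 - κ) * p) := by
    rw [← Real.rpow_neg_one, ← Real.rpow_add hY0, ← Real.rpow_add hY0]
    congr 1
    rw [hp]; ring
  rw [hYe]
  ring

end

section

open Filter MeasureTheory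

theorem norm_integral_exp_le {y : ℝ} (hy : y ≠ 0) (T : ℝ) :
    ‖∫ t in (0 : ℝ)..T, Complex.exp (2 * Real.pi * Complex.I * y * t)‖ ≤ |y|⁻¹ := by
  have hpi : (Real.pi : ℂ) ≠ 0 := Complex.ofReal_ne_zero.2 Real.pi_ne_zero
  have hyc : (y : ℂ) ≠ 0 := Complex.ofReal_ne_zero.2 hy
  have hw : 2 * Real.pi * Complex.I * y ≠ (0 : ℂ) := by simp [hy, Real.pi_ne_zero]
  rw [integral_exp_mul_complex hw, norm_div]
  have h1 : ∀ u : ℝ, ‖Complex.exp (2 * Real.pi * Complex.I * y * u)‖ = 1 := fun u => by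
    rw [show 2 * Real.pi * Complex.I * y * u = ((2 * Real.pi * y * u : ℝ) : ℂ) * Complex.I by
      push_cast; ring]
    exact Complex.norm_exp_ofReal_mul_I _
  have h2 := norm_sub_le (Complex.exp (2 * Real.pi * Complex.I * y * T))
    (Complex.exp (2 * Real.pi * Complex.I * y * (0 : ℝ)))
  rw [h1, h1] at h2
  have h3 : ‖2 * Real.pi * Complex.I * (y : ℂ)‖ = 2 * Real.pi * |y| := by
    simp [abs_of_pos Real.pi_pos]
  have hy0 : 0 < |y| := abs_pos.2 hy
  rw [h3, div_le_iff₀ (by positivity)]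
  have h4 : |y|⁻¹ * (2 * Real.pi * |y|) = 2 * Real.pi := by field_simp
  rw [h4]
  linarith [Real.pi_gt_three]

theorem prod_trig_sum_eq {d : ℕ} (c : Fin d → ℤ → ℂ) (A : Finset ℤ) (s α : Fin d → ℝ) (t : ℝ) :
    ∏ k, ∑ n ∈ A, c k n * Complex.exp (2 * Real.pi * Complex.I * n * (s k + t * α k : ℝ))
      = ∑ n ∈ Fintype.piFinset fun _ => A,
        (∏ k, c k (n k) * Complex.exp (2 * Real.pi * Complex.I * n k * s k))
          * Complex.exp (2 * Real.pi * Complex.I * (∑ k, (n k : ℝ) * α k : ℝ) * t) := by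
  rw [Finset.prod_univ_sum]
  refine Finset.sum_congr rfl fun n _ => ?_
  have : Complex.exp (2 * Real.pi * Complex.I * (∑ k, (n k : ℝ) * α k : ℝ) * t)
      = ∏ k, Complex.exp (2 * Real.pi * Complex.I * n k * (t * α k)) := by
    rw [← Complex.exp_sum]
    congr 1
    push_cast
    rw [Finset.mul_sum, Finset.sum_mul]
    exact Finset.sum_congr rfl fun k _ => by ring
  rw [this, ← Finset.prod_mul_distrib]
  refine Finset.prod_congr rfl fun k _ => ?_
  rw [mul_assoc (c k (n k)), ← Complex.exp_add]
  congr 2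
  push_cast
  ring

theorem norm_exp_two_pi_int_mul (n : ℤ) (x : ℝ) :
    ‖Complex.exp (2 * Real.pi * Complex.I * n * x)‖ = 1 := by
  rw [show 2 * Real.pi * Complex.I * n * x = ((2 * Real.pi * n * x : ℝ) : ℂ) * Complex.I by
    push_cast; ring]
  exact Complex.norm_exp_ofReal_mul_I _

theorem norm_integral_prod_trig_sub_le {d : ℕ} {α : Fin d → ℝ} {C : ℝ}
    (hα : ∀ n : Fin d → ℤ, n ≠ 0 → ∑ k, (n k : ℝ) * α k ≠ 0)
    (hC : ∀ u : Finset (Fin d → ℤ),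
      ∑ n ∈ u, (|∑ k, (n k : ℝ) * α k| * ∏ k, max 1 |(n k : ℝ)|)⁻¹ ≤ C)
    (c : Fin d → ℤ → ℂ) (hc : ∀ k n, ‖c k n‖ ≤ 2 * (max 1 |(n : ℝ)|)⁻¹) (s : Fin d → ℝ)
    (A : Finset ℤ) (hA : 0 ∈ A) (T : ℝ) :
    ‖(∫ t in (0 : ℝ)..T, ∏ k, ∑ n ∈ A, c k n *
        Complex.exp (2 * Real.pi * Complex.I * n * (s k + t * α k : ℝ))) - T * ∏ k, c k 0‖
      ≤ 2 ^ d * C := by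
  classical
  simp_rw [prod_trig_sum_eq]
  rw [intervalIntegral.integral_finsetSum fun n _ =>
    Continuous.intervalIntegrable (by fun_prop) _ _]
  simp_rw [intervalIntegral.integral_const_mul]
  have h0 : (0 : Fin d → ℤ) ∈ Fintype.piFinset fun _ : Fin d => A :=
    Fintype.mem_piFinset.2 fun _ => hA
  rw [← Finset.add_sum_erase _ _ h0]
  have hz : (∏ k, c k ((0 : Fin d → ℤ) k) * Complex.exp (2 * Real.pi * Complex.I *
      ((0 : Fin d → ℤ) k : ℤ) * s k)) * ∫ t in (0 : ℝ)..T, Complex.exp (2 * Real.pi * Complex.I *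
        (∑ k, (((0 : Fin d → ℤ) k : ℤ) : ℝ) * α k : ℝ) * t) = T * ∏ k, c k 0 := by
    simp [mul_comm]
  rw [hz, add_sub_cancel_left]
  refine (norm_sum_le _ _).trans ?_
  refine le_trans ?_ (mul_le_mul_of_nonneg_left
    (hC ((Fintype.piFinset fun _ : Fin d => A).erase 0)) (by positivity))
  rw [Finset.mul_sum]
  refine Finset.sum_le_sum fun n hn => ?_
  rw [norm_mul, mul_inv, mul_left_comm, norm_prod, mul_comm]
  refine mul_le_mul (norm_integral_exp_le (hα n (Finset.ne_of_mem_erase hn)) T) ?_ (by positivity)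
    (by positivity)
  have : (2 : ℝ) ^ d * (∏ k, max 1 |(n k : ℝ)|)⁻¹ = ∏ k, 2 * (max 1 |(n k : ℝ)|)⁻¹ := by
    rw [Finset.prod_mul_distrib]; simp
  rw [this]
  refine Finset.prod_le_prod (fun _ _ => norm_nonneg _) fun k _ => ?_
  rw [norm_mul, norm_exp_two_pi_int_mul, mul_one]
  exact hc k (n k)

theorem norm_integral_prod_sub_le {d : ℕ} {α : Fin d → ℝ} {C : ℝ}
    (hα : ∀ n : Fin d → ℤ, n ≠ 0 → ∑ k, (n k : ℝ) * α k ≠ 0)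
    (hC : ∀ u : Finset (Fin d → ℤ),
      ∑ n ∈ u, (|∑ k, (n k : ℝ) * α k| * ∏ k, max 1 |(n k : ℝ)|)⁻¹ ≤ C)
    (c : Fin d → ℤ → ℂ) (hc : ∀ k n, ‖c k n‖ ≤ 2 * (max 1 |(n : ℝ)|)⁻¹)
    (hcs : ∀ k, Summable fun n => ‖c k n‖) (g : Fin d → ℝ → ℝ)
    (hg : ∀ k (x : ℝ), HasSum (fun n : ℤ => c k n * Complex.exp (2 * Real.pi * Complex.I * n * x))
      (g k x : ℂ))
    (s : Fin d → ℝ) (T : ℝ) :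
    ‖((∫ t in (0 : ℝ)..T, ∏ k, g k (s k + t * α k) : ℝ) : ℂ) - T * ∏ k, c k 0‖ ≤ 2 ^ d * C := by
  have hlim : Tendsto (fun A : Finset ℤ => ∫ t in (0 : ℝ)..T, ∏ k, ∑ n ∈ A, c k n *
      Complex.exp (2 * Real.pi * Complex.I * n * (s k + t * α k : ℝ))) atTop
      (nhds (∫ t in (0 : ℝ)..T, ((∏ k, g k (s k + t * α k) : ℝ) : ℂ))) := by
    refine intervalIntegral.tendsto_integral_filter_of_dominated_convergence
      (fun _ => ∏ k, ∑' n, ‖c k n‖) ?_ ?_ ?_ ?_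
    · exact Eventually.of_forall fun A => (Continuous.aestronglyMeasurable (by fun_prop))
    · refine Eventually.of_forall fun A => ae_of_all _ fun t _ => ?_
      rw [norm_prod]
      refine Finset.prod_le_prod (fun _ _ => norm_nonneg _) fun k _ => ?_
      refine (norm_sum_le _ _).trans ?_
      simp_rw [norm_mul, norm_exp_two_pi_int_mul, mul_one]
      exact (hcs k).sum_le_tsum _ fun _ _ => norm_nonneg _
    · exact intervalIntegrable_const
    · refine ae_of_all _ fun t _ => ?_
      rw [Complex.ofReal_prod]
      exact tendsto_finsetProd _ fun k _ => hg k (s k + t * α k)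
  rw [intervalIntegral.integral_ofReal] at hlim
  refine le_of_tendsto (hlim.sub_const _).norm ?_
  filter_upwards [eventually_ge_atTop ({0} : Finset ℤ)] with A hA
  exact norm_integral_prod_trig_sub_le hα hC c hc s A (hA (Finset.mem_singleton_self 0)) T

theorem continuous_of_hasSum_exp {c : ℤ → ℂ} (hcs : Summable fun n => ‖c n‖) {g : ℝ → ℝ}
    (hg : ∀ x : ℝ, HasSum (fun n : ℤ => c n * Complex.exp (2 * Real.pi * Complex.I * n * x))
      (g x : ℂ)) :
    Continuous g := by
  have h1 : Continuous fun x : ℝ => ∑' n : ℤ, c n * Complex.exp (2 * Real.pi * Complex.I * n * x) :=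
    continuous_tsum (fun n => by fun_prop) hcs fun n x => by
      rw [norm_mul, norm_exp_two_pi_int_mul, mul_one]
  have h2 : g = fun x : ℝ => (∑' n : ℤ, c n * Complex.exp (2 * Real.pi * Complex.I * n * x)).re := by
    funext x
    rw [(hg x).tsum_eq, Complex.ofReal_re]
  rw [h2]
  exact Complex.continuous_re.comp h1

end

section

open Filter

/-- The primitive of the floor function vanishing at zero. -/
noncomputable def floorPrimitive (y : ℝ) : ℝ := ⌊y⌋ * y - ⌊y⌋ * (⌊y⌋ + 1) / 2

theorem floorPrimitive_eq_fract (y : ℝ) :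
    floorPrimitive y = y ^ 2 / 2 - y / 2 - (Int.fract y ^ 2 - Int.fract y) / 2 := by
  unfold floorPrimitive Int.fract
  ring

theorem floorPrimitive_eq {y : ℝ} {m : ℤ} (h1 : (m : ℝ) ≤ y) (h2 : y ≤ m + 1) :
    floorPrimitive y = m * y - m * (m + 1) / 2 := by
  unfold floorPrimitive
  rcases h2.lt_or_eq with h | h
  · rw [Int.floor_eq_iff.2 ⟨h1, h⟩]
  · have : ⌊y⌋ = m + 1 := by rw [h]; simp
    rw [this, h]; push_cast; ring

theorem le_floorPrimitive (y : ℝ) (m : ℤ) : m * y - m * (m + 1) / 2 ≤ floorPrimitive y := by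
  unfold floorPrimitive
  have h1 := Int.floor_le y
  have h2 := Int.lt_floor_add_one y
  set j := ⌊y⌋
  rcases lt_trichotomy m j with h | h | h
  · have h3 : (m : ℝ) + 1 ≤ j := by exact_mod_cast h
    nlinarith
  · rw [h]
  · have h3 : (j : ℝ) + 1 ≤ m := by exact_mod_cast h
    nlinarith

theorem floorPrimitive_subgradient {y : ℝ} {m : ℤ} (h1 : (m : ℝ) ≤ y) (h2 : y ≤ m + 1) (w : ℝ) :
    floorPrimitive y + m * (w - y) ≤ floorPrimitive w := by
  rw [floorPrimitive_eq h1 h2]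
  linarith [le_floorPrimitive w m]

/-- A mollified indicator of the arc `[a, b]` modulo one: a majorant for positive `h` and
a minorant for negative `h`. -/
noncomputable def smoothArc (a b h x : ℝ) : ℝ :=
  (floorPrimitive (x - a + h) - floorPrimitive (x - a) - floorPrimitive (x - b)
    + floorPrimitive (x - b - h)) / h

theorem smoothArc_nonneg {a b h : ℝ} (hab : a ≤ b) (hh : 0 < h) (x : ℝ) :
    0 ≤ smoothArc a b h x := by
  refine div_nonneg ?_ hh.le
  have h1 := floorPrimitive_subgradient (Int.floor_le (x - a)) (Int.lt_floor_add_one _).le (x - a + h)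
  have h2 := floorPrimitive_subgradient (Int.floor_le (x - b)) (Int.lt_floor_add_one _).le (x - b - h)
  have h3 : (⌊x - b⌋ : ℝ) ≤ ⌊x - a⌋ := by exact_mod_cast Int.floor_mono (by linarith)
  nlinarith

theorem one_le_smoothArc {a b h : ℝ} (ha : 0 ≤ a) (hb : b ≤ 1) (hh : 0 < h) {x : ℝ}
    (hax : a ≤ Int.fract x) (hbx : Int.fract x ≤ b) : 1 ≤ smoothArc a b h x := by
  unfold smoothArc
  rw [one_le_div hh]
  have hx := Int.floor_add_fract x
  have hx1 := Int.fract_lt_one x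
  have hx0 := Int.fract_nonneg x
  have h1 := floorPrimitive_subgradient (y := x - a) (m := ⌊x⌋) (by linarith) (by linarith) (x - a + h)
  have h2 := floorPrimitive_subgradient (y := x - b) (m := ⌊x⌋ - 1) (by push_cast; linarith)
    (by push_cast; linarith) (x - b - h)
  push_cast at h2
  linarith

theorem smoothArc_neg_nonneg {a b h : ℝ} (hab : 2 * h ≤ b - a) (hh : 0 < h) (x : ℝ) :
    0 ≤ smoothArc a b (-h) x := by
  refine div_nonneg_of_nonpos ?_ (by linarith)
  have h1 := floorPrimitive_subgradient (Int.floor_le (x - a + -h)) (Int.lt_floor_add_one _).le (x - a)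
  have h2 := floorPrimitive_subgradient (Int.floor_le (x - b - -h)) (Int.lt_floor_add_one _).le (x - b)
  have h3 : (⌊x - b - -h⌋ : ℝ) ≤ ⌊x - a + -h⌋ := by exact_mod_cast Int.floor_mono (by linarith)
  nlinarith

theorem smoothArc_neg_le_of_slopes {a b h x : ℝ} (hh : 0 < h) {m m' : ℤ}
    (h1 : (m : ℝ) ≤ x - a) (h2 : x - a ≤ m + 1) (h3 : (m' : ℝ) ≤ x - b) (h4 : x - b ≤ m' + 1) :
    smoothArc a b (-h) x ≤ m - m' := by
  unfold smoothArc
  rw [div_le_iff_of_neg (by linarith)]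
  have h5 := floorPrimitive_subgradient h1 h2 (x - a + -h)
  have h6 := floorPrimitive_subgradient h3 h4 (x - b - -h)
  linarith

theorem smoothArc_neg_le_one {a b h : ℝ} (ha : 0 ≤ a) (hb : b ≤ 1) (hh : 0 < h) {x : ℝ}
    (hax : a ≤ Int.fract x) (hbx : Int.fract x ≤ b) : smoothArc a b (-h) x ≤ 1 := by
  have hx := Int.floor_add_fract x
  have hx1 := Int.fract_lt_one x
  have hx0 := Int.fract_nonneg x
  have := smoothArc_neg_le_of_slopes (a := a) (b := b) (x := x) hh (m := ⌊x⌋) (m' := ⌊x⌋ - 1)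
    (by linarith) (by linarith) (by push_cast; linarith) (by push_cast; linarith)
  push_cast at this
  linarith

theorem smoothArc_neg_nonpos {a b h : ℝ} (ha : 0 ≤ a) (ha1 : a ≤ 1) (hb : b ≤ 1) (hb0 : 0 ≤ b)
    (hab : a ≤ b) (hh : 0 < h) {x : ℝ} (hx : ¬(a ≤ Int.fract x ∧ Int.fract x ≤ b)) :
    smoothArc a b (-h) x ≤ 0 := by
  have hxx := Int.floor_add_fract x
  have hx1 := Int.fract_lt_one x
  have hx0 := Int.fract_nonneg x
  rcases lt_or_ge (Int.fract x) a with h1 | h1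
  · have := smoothArc_neg_le_of_slopes (a := a) (b := b) (x := x) hh (m := ⌊x⌋ - 1) (m' := ⌊x⌋ - 1)
      (by push_cast; linarith) (by push_cast; linarith) (by push_cast; linarith)
      (by push_cast; linarith)
    linarith
  · have h2 : b < Int.fract x := not_le.1 fun h => hx ⟨h1, h⟩
    have := smoothArc_neg_le_of_slopes (a := a) (b := b) (x := x) hh (m := ⌊x⌋) (m' := ⌊x⌋)
      (by linarith) (by linarith) (by linarith) (by linarith)
    linarith

theorem hasSum_exp_div_sq (y : ℝ) :
    HasSum (fun n : ℤ => 1 / (n : ℂ) ^ 2 * Complex.exp (2 * Real.pi * Complex.I * n * y))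
      ((2 * Real.pi ^ 2 * (Int.fract y ^ 2 - Int.fract y + 6⁻¹) : ℝ) : ℂ) := by
  have h := hasSum_one_div_pow_mul_fourier_mul_bernoulliFun (k := 2) le_rfl
    (x := Int.fract y) ⟨Int.fract_nonneg y, (Int.fract_lt_one y).le⟩
  rw [bernoulliFun_two] at h
  convert h using 1
  · funext n
    rw [fourier_coe_apply]
    congr 1
    rw [Complex.exp_eq_exp_iff_exists_int]
    refine ⟨n * ⌊y⌋, ?_⟩
    have : (y : ℂ) = ⌊y⌋ + (Int.fract y : ℝ) := by
      exact_mod_cast (Int.floor_add_fract y).symm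
    rw [this]
    push_cast
    ring
  · push_cast
    rw [mul_pow, Complex.I_sq, show ((Nat.factorial 2 : ℕ) : ℂ) = 2 by norm_num [Nat.factorial]]
    ring

/-- The Fourier coefficients of `smoothArc`. -/
noncomputable def smoothArcCoeff (a b h : ℝ) (n : ℤ) : ℂ :=
  (if n = 0 then ((b - a + h : ℝ) : ℂ) else 0) + -(1 / (4 * Real.pi ^ 2 * h)) * (1 / (n : ℂ) ^ 2 *
    (Complex.exp (2 * Real.pi * Complex.I * n * (h - a : ℝ))
      - Complex.exp (2 * Real.pi * Complex.I * n * (-a : ℝ))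
      - Complex.exp (2 * Real.pi * Complex.I * n * (-b : ℝ))
      + Complex.exp (2 * Real.pi * Complex.I * n * (-b - h : ℝ))))

theorem smoothArcCoeff_zero (a b h : ℝ) : smoothArcCoeff a b h 0 = ((b - a + h : ℝ) : ℂ) := by
  simp [smoothArcCoeff]

theorem hasSum_smoothArc {a b h : ℝ} (hh : h ≠ 0) (x : ℝ) :
    HasSum (fun n : ℤ => smoothArcCoeff a b h n * Complex.exp (2 * Real.pi * Complex.I * n * x))
      (smoothArc a b h x : ℂ) := by
  have h0 := hasSum_ite_eq (0 : ℤ) ((b - a + h : ℝ) : ℂ)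
  have h1 := ((((hasSum_exp_div_sq (x - a + h)).sub (hasSum_exp_div_sq (x - a))).sub
    (hasSum_exp_div_sq (x - b))).add (hasSum_exp_div_sq (x - b - h))).mul_left
      (-(1 / (4 * Real.pi ^ 2 * h)) : ℂ)
  convert h0.add h1 using 1
  · funext n
    have hexp : ∀ u v : ℝ, Complex.exp (2 * Real.pi * Complex.I * n * (u + v : ℝ))
        = Complex.exp (2 * Real.pi * Complex.I * n * u)
          * Complex.exp (2 * Real.pi * Complex.I * n * v) := fun u v => by
      rw [← Complex.exp_add]; congr 1; push_cast; ring
    rw [show x - a + h = (h - a) + x by ring, show x - a = -a + x by ring,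
      show x - b = -b + x by ring, show -b + x - h = (-b - h) + x by ring, hexp, hexp, hexp, hexp]
    unfold smoothArcCoeff
    split_ifs with hn
    · subst hn; simp
    · ring
  · rw [smoothArc, floorPrimitive_eq_fract, floorPrimitive_eq_fract, floorPrimitive_eq_fract,
      floorPrimitive_eq_fract]
    have hpi : (Real.pi : ℂ) ≠ 0 := Complex.ofReal_ne_zero.2 Real.pi_ne_zero
    have hhc : (h : ℂ) ≠ 0 := Complex.ofReal_ne_zero.2 hh
    push_cast
    field_simp
    ring

theorem norm_exp_two_pi_sub_one_le (n : ℤ) (h : ℝ) :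
    ‖Complex.exp (2 * Real.pi * Complex.I * n * h) - 1‖ ≤ 2 * Real.pi * |(n : ℝ)| * |h| := by
  have := Real.norm_exp_I_mul_ofReal_sub_one_le (x := 2 * Real.pi * n * h)
  rw [Real.norm_eq_abs, abs_mul, abs_mul, abs_of_pos Real.two_pi_pos] at this
  convert this using 3
  congr 1
  push_cast
  ring

theorem norm_smoothArcCoeff_le {a b h : ℝ} (hh : h ≠ 0) (h0 : |b - a + h| ≤ 2) (n : ℤ) :
    ‖smoothArcCoeff a b h n‖ ≤ 2 * (max 1 |(n : ℝ)|)⁻¹ := by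
  rcases eq_or_ne n 0 with rfl | hn
  · rw [smoothArcCoeff_zero, Complex.norm_real]
    simpa using h0
  have hn1 : (1 : ℝ) ≤ |(n : ℝ)| := by exact_mod_cast Int.one_le_abs hn
  have hn0 : 0 < |(n : ℝ)| := by linarith
  have hh0 : 0 < |h| := abs_pos.2 hh
  rw [max_eq_right hn1, smoothArcCoeff, if_neg hn, zero_add, norm_mul, norm_mul]
  have hexp : ∀ u v : ℝ, Complex.exp (2 * Real.pi * Complex.I * n * (u + v : ℝ))
      = Complex.exp (2 * Real.pi * Complex.I * n * u)
        * Complex.exp (2 * Real.pi * Complex.I * n * v) := fun u v => by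
    rw [← Complex.exp_add]; congr 1; push_cast; ring
  set E := Complex.exp (2 * Real.pi * Complex.I * n * h) - 1 with hE
  have h1 : Complex.exp (2 * Real.pi * Complex.I * n * (h - a : ℝ))
      - Complex.exp (2 * Real.pi * Complex.I * n * (-a : ℝ))
      - Complex.exp (2 * Real.pi * Complex.I * n * (-b : ℝ))
      + Complex.exp (2 * Real.pi * Complex.I * n * (-b - h : ℝ))
      = E * Complex.exp (2 * Real.pi * Complex.I * n * (-a : ℝ))
        - E * Complex.exp (2 * Real.pi * Complex.I * n * (-b - h : ℝ)) := by
    rw [show h - a = h + -a by ring, hexp h,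
      show Complex.exp (2 * Real.pi * Complex.I * n * (-b : ℝ))
        = Complex.exp (2 * Real.pi * Complex.I * n * (h + (-b - h) : ℝ)) by
          congr 2; push_cast; ring, hexp h (-b - h), hE]
    ring
  have h2 : ‖Complex.exp (2 * Real.pi * Complex.I * n * (h - a : ℝ))
      - Complex.exp (2 * Real.pi * Complex.I * n * (-a : ℝ))
      - Complex.exp (2 * Real.pi * Complex.I * n * (-b : ℝ))
      + Complex.exp (2 * Real.pi * Complex.I * n * (-b - h : ℝ))‖
      ≤ 2 * (2 * Real.pi * |(n : ℝ)| * |h|) := by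
    rw [h1]
    refine (norm_sub_le _ _).trans ?_
    rw [norm_mul, norm_mul, norm_exp_two_pi_int_mul, norm_exp_two_pi_int_mul]
    linarith [norm_exp_two_pi_sub_one_le n h]
  have h3 : ‖-(1 / (4 * Real.pi ^ 2 * h) : ℂ)‖ = 1 / (4 * Real.pi ^ 2 * |h|) := by
    simp [abs_of_pos Real.pi_pos]
  have h4 : ‖(1 / (n : ℂ) ^ 2)‖ = 1 / |(n : ℝ)| ^ 2 := by
    rw [norm_div, norm_one, norm_pow, Complex.norm_intCast]
  rw [h3, h4]
  have hpi := Real.pi_gt_three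
  calc _ ≤ 1 / (4 * Real.pi ^ 2 * |h|) * (1 / |(n : ℝ)| ^ 2 * (2 * (2 * Real.pi * |(n : ℝ)| * |h|))) := by
        gcongr
    _ = Real.pi⁻¹ * |(n : ℝ)|⁻¹ := by field_simp; norm_num
    _ ≤ _ := by
        refine mul_le_mul_of_nonneg_right ?_ (by positivity)
        rw [inv_le_iff_one_le_mul₀ Real.pi_pos]
        linarith

theorem summable_norm_smoothArcCoeff (a b h : ℝ) : Summable fun n => ‖smoothArcCoeff a b h n‖ := by
  have h1 : Summable fun n : ℤ => 1 / (n : ℝ) ^ 2 := Real.summable_one_div_int_pow.2 one_lt_two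
  have h2 : Summable fun n : ℤ => ‖if n = 0 then ((b - a + h : ℝ) : ℂ) else 0‖ :=
    (hasSum_ite_eq (0 : ℤ) ((b - a + h : ℝ) : ℂ)).summable.norm
  refine Summable.of_nonneg_of_le (fun _ => norm_nonneg _) (fun n => ?_)
    (h2.add (h1.mul_left (4 * ‖-(1 / (4 * Real.pi ^ 2 * h) : ℂ)‖)))
  refine (norm_add_le _ _).trans ?_
  gcongr
  rw [norm_mul, norm_mul]
  have h4 : ‖(1 / (n : ℂ) ^ 2)‖ = 1 / (n : ℝ) ^ 2 := by
    rw [norm_div, norm_one, norm_pow, Complex.norm_intCast, sq_abs]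
  rw [h4]
  have h5 : ∀ p q r s : ℂ, ‖p‖ = 1 → ‖q‖ = 1 → ‖r‖ = 1 → ‖s‖ = 1 → ‖p - q - r + s‖ ≤ 4 := by
    intro p q r s hp hq hr hs
    linarith [norm_add_le (p - q - r) s, norm_sub_le (p - q) r, norm_sub_le p q]
  have h6 := h5 _ _ _ _ (norm_exp_two_pi_int_mul n (h - a)) (norm_exp_two_pi_int_mul n (-a))
    (norm_exp_two_pi_int_mul n (-b)) (norm_exp_two_pi_int_mul n (-b - h))
  calc _ ≤ ‖-(1 / (4 * Real.pi ^ 2 * h) : ℂ)‖ * (1 / (n : ℝ) ^ 2 * 4) := by gcongr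
    _ = _ := by ring

end

open MeasureTheory Real

theorem prod_add_sub_prod_le {d : ℕ} (x y : Fin d → ℝ) (hx : ∀ k, 0 ≤ x k) (hxy : ∀ k, x k ≤ y k)
    (hy : ∀ k, y k ≤ 2) {ε : ℝ} (hε : ∀ k, y k - x k ≤ ε) :
    ∏ k, y k - ∏ k, x k ≤ d * 2 ^ d * ε := by
  induction d with
  | zero => simp
  | succ d ih =>
    rw [Fin.prod_univ_succ, Fin.prod_univ_succ]
    have h1 := ih (fun k => x k.succ) (fun k => y k.succ) (fun k => hx _) (fun k => hxy _)
      (fun k => hy _) (fun k => hε _)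
    have hε0 : 0 ≤ ε := by linarith [hxy 0, hε 0]
    set X := ∏ k : Fin d, x k.succ
    set Y := ∏ k : Fin d, y k.succ
    have hX0 : 0 ≤ X := Finset.prod_nonneg fun k _ => hx _
    have hXY : X ≤ Y := Finset.prod_le_prod (fun k _ => hx _) fun k _ => hxy _
    have hY : Y ≤ 2 ^ d := by
      have := Finset.prod_le_prod (s := Finset.univ) (f := fun k : Fin d => y k.succ)
        (g := fun _ => (2 : ℝ)) (fun k _ => (hx _).trans (hxy _)) fun k _ => hy _
      simpa using this
    have e1 : y 0 * Y - x 0 * X = y 0 * (Y - X) + (y 0 - x 0) * X := by ring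
    have e2 : y 0 * (Y - X) ≤ 2 * (d * 2 ^ d * ε) :=
      mul_le_mul (hy 0) h1 (by linarith) (by norm_num)
    have e3 : (y 0 - x 0) * X ≤ ε * 2 ^ d := mul_le_mul (hε 0) (hXY.trans hY) hX0 hε0
    have e4 : 0 ≤ ε * 2 ^ d := by positivity
    rw [e1, pow_succ]
    push_cast
    nlinarith

theorem abs_integral_smoothArc_sub_le {d : ℕ} {α : Fin d → ℝ} {C : ℝ}
    (hα : ∀ n : Fin d → ℤ, n ≠ 0 → ∑ k, (n k : ℝ) * α k ≠ 0)
    (hC : ∀ u : Finset (Fin d → ℤ),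
      ∑ n ∈ u, (|∑ k, (n k : ℝ) * α k| * ∏ k, max 1 |(n k : ℝ)|)⁻¹ ≤ C)
    (s a b : Fin d → ℝ) {h : ℝ} (hh : h ≠ 0) (h0 : ∀ k, |b k - a k + h| ≤ 2) (T : ℝ) :
    |(∫ t in (0 : ℝ)..T, ∏ k, smoothArc (a k) (b k) h (s k + t * α k))
      - T * ∏ k, (b k - a k + h)| ≤ 2 ^ d * C := by
  have := norm_integral_prod_sub_le hα hC (fun k => smoothArcCoeff (a k) (b k) h)
    (fun k n => norm_smoothArcCoeff_le hh (h0 k) n)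
    (fun k => summable_norm_smoothArcCoeff (a k) (b k) h) (fun k => smoothArc (a k) (b k) h)
    (fun k x => hasSum_smoothArc hh x) s T
  simp_rw [smoothArcCoeff_zero] at this
  rw [← Complex.ofReal_prod, ← Complex.ofReal_mul, ← Complex.ofReal_sub, Complex.norm_real] at this
  exact this

theorem intervalIntegrable_prod_smoothArc {d : ℕ} (s α a b : Fin d → ℝ) {h : ℝ} (hh : h ≠ 0)
    (T : ℝ) : IntervalIntegrable (fun t => ∏ k, smoothArc (a k) (b k) h (s k + t * α k))
      volume 0 T := by
  have hc : ∀ k, Continuous (smoothArc (a k) (b k) h) := fun k =>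
    continuous_of_hasSum_exp (summable_norm_smoothArcCoeff (a k) (b k) h) fun x =>
      hasSum_smoothArc hh x
  refine Continuous.intervalIntegrable ?_ _ _
  exact continuous_finsetProd _ fun k _ => (hc k).comp (by fun_prop)

theorem intervalIntegrable_indicator_flow {d : ℕ} (s α a b : Fin d → ℝ) (T : ℝ) :
    IntervalIntegrable (fun t : ℝ => Set.indicator (Set.Icc a b) (fun _ => (1 : ℝ))
      (fun i => Int.fract (s i + t * α i))) volume 0 T := by
  have hm : Measurable fun t : ℝ => Set.indicator (Set.Icc a b) (fun _ => (1 : ℝ))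
      (fun i => Int.fract (s i + t * α i)) := by
    refine (measurable_const.indicator measurableSet_Icc).comp ?_
    exact measurable_pi_iff.2 fun i => measurable_fract.comp (by fun_prop)
  refine (intervalIntegrable_const (c := (1 : ℝ))).mono_fun hm.aestronglyMeasurable ?_
  refine ae_of_all _ fun t => ?_
  refine (norm_indicator_le_norm_self _ _).trans ?_
  simp

theorem abs_Delta_Icc_le {d : ℕ} {α : Fin d → ℝ} {C : ℝ} (hC0 : 0 ≤ C)
    (hα : ∀ n : Fin d → ℤ, n ≠ 0 → ∑ k, (n k : ℝ) * α k ≠ 0)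
    (hC : ∀ u : Finset (Fin d → ℤ),
      ∑ n ∈ u, (|∑ k, (n k : ℝ) * α k| * ∏ k, max 1 |(n k : ℝ)|)⁻¹ ≤ C)
    (s : Fin d → ℝ) {a b : Fin d → ℝ} (ha : ∀ k, 0 ≤ a k) (hb : ∀ k, b k ≤ 1)
    (hab : ∀ k, a k ≤ b k) {T : ℝ} (hT : 0 < T) :
    |Delta s α (Set.Icc a b) T| ≤ 2 ^ d * C + d * 2 ^ d + 2 := by
  classical
  set ε : ℝ := 1 / (T + 1) with hε
  have hε0 : 0 < ε := by positivity
  have hε1 : ε ≤ 1 := by rw [hε, div_le_one (by positivity)]; linarith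
  have hTε : T * ε ≤ 1 := by
    rw [hε, mul_one_div, div_le_one (by positivity)]; linarith
  have hCd : 0 ≤ 2 ^ d * C := by positivity
  have hdd : (0 : ℝ) ≤ d * 2 ^ d := by positivity
  set f : ℝ → ℝ := fun t => Set.indicator (Set.Icc a b) (fun _ => (1 : ℝ))
    (fun i => Int.fract (s i + t * α i)) with hf
  have hfi : IntervalIntegrable f volume 0 T := intervalIntegrable_indicator_flow s α a b T
  have hvol : (volume (Set.Icc a b)).toReal = ∏ k, (b k - a k) := Real.volume_Icc_pi_toReal hab
  have hD : Delta s α (Set.Icc a b) T = (∫ t in (0 : ℝ)..T, f t) - T * ∏ k, (b k - a k) := by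
    rw [Delta, hvol]
  have hscale : T * (d * 2 ^ d * ε) ≤ d * 2 ^ d := by
    calc T * (d * 2 ^ d * ε) = d * 2 ^ d * (T * ε) := by ring
      _ ≤ d * 2 ^ d * 1 := mul_le_mul_of_nonneg_left hTε hdd
      _ = _ := mul_one _
  have hba : ∀ k, 0 ≤ b k - a k ∧ b k - a k ≤ 1 := fun k =>
    ⟨by linarith [hab k], by linarith [ha k, hb k]⟩
  rw [hD, abs_le]
  constructor
  · by_cases hwide : ∀ k, 2 * ε ≤ b k - a k
    · have h1 := (abs_le.1 (abs_integral_smoothArc_sub_le hα hC s a b (neg_ne_zero.2 hε0.ne')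
        (fun k => abs_le.2 ⟨by linarith [hba k], by linarith [hba k]⟩) T)).1
      have h2 : ∫ t in (0 : ℝ)..T, ∏ k, smoothArc (a k) (b k) (-ε) (s k + t * α k)
          ≤ ∫ t in (0 : ℝ)..T, f t := by
        refine intervalIntegral.integral_mono_on hT.le
          (intervalIntegrable_prod_smoothArc s α a b (neg_ne_zero.2 hε0.ne') T) hfi fun t _ => ?_
        have hnn : ∀ k, 0 ≤ smoothArc (a k) (b k) (-ε) (s k + t * α k) := fun k =>
          smoothArc_neg_nonneg (hwide k) hε0 _
        by_cases hmem : (fun i => Int.fract (s i + t * α i)) ∈ Set.Icc a b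
        · rw [hf]
          simp only [Set.indicator_of_mem hmem]
          exact Finset.prod_le_one (fun k _ => hnn k) fun k _ =>
            smoothArc_neg_le_one (ha k) (hb k) hε0 (hmem.1 k) (hmem.2 k)
        · rw [hf]
          simp only [Set.indicator_of_notMem hmem]
          have : ∃ k, ¬(a k ≤ Int.fract (s k + t * α k) ∧ Int.fract (s k + t * α k) ≤ b k) := by
            by_contra! hcon
            exact hmem ⟨fun k => (hcon k).1, fun k => (hcon k).2⟩
          obtain ⟨k, hk⟩ := this
          refine (Finset.prod_eq_zero (Finset.mem_univ k) (le_antisymm ?_ (hnn k))).le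
          exact smoothArc_neg_nonpos (ha k) ((hab k).trans (hb k)) (hb k) ((ha k).trans (hab k))
            (hab k) hε0 hk
      have h3 := prod_add_sub_prod_le (fun k => b k - a k + -ε) (fun k => b k - a k)
        (fun k => by linarith [hwide k]) (fun k => by linarith) (fun k => by linarith [hba k])
        (ε := ε) (fun k => by linarith)
      have h4 := (mul_le_mul_of_nonneg_left h3 hT.le).trans hscale
      rw [mul_sub] at h4
      linarith
    · push Not at hwide
      obtain ⟨k, hk⟩ := hwide
      have h1 : 0 ≤ ∫ t in (0 : ℝ)..T, f t :=
        intervalIntegral.integral_nonneg hT.le fun t _ =>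
          Set.indicator_nonneg (fun _ _ => zero_le_one) _
      have h2 : ∏ k, (b k - a k) ≤ 2 * ε := by
        rw [← Finset.mul_prod_erase _ _ (Finset.mem_univ k)]
        refine (mul_le_of_le_one_right (hba k).1 ?_).trans hk.le
        exact Finset.prod_le_one (fun k _ => (hba k).1) fun k _ => (hba k).2
      have h3 := mul_le_mul_of_nonneg_left h2 hT.le
      linarith
  · have h1 := (abs_le.1 (abs_integral_smoothArc_sub_le hα hC s a b hε0.ne'
      (fun k => abs_le.2 ⟨by linarith [hba k], by linarith [hba k]⟩) T)).2
    have h2 : ∫ t in (0 : ℝ)..T, f t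
        ≤ ∫ t in (0 : ℝ)..T, ∏ k, smoothArc (a k) (b k) ε (s k + t * α k) := by
      refine intervalIntegral.integral_mono_on hT.le hfi
        (intervalIntegrable_prod_smoothArc s α a b hε0.ne' T) fun t _ => ?_
      by_cases hmem : (fun i => Int.fract (s i + t * α i)) ∈ Set.Icc a b
      · rw [hf]
        simp only [Set.indicator_of_mem hmem]
        have := Finset.prod_le_prod (s := Finset.univ) (f := fun _ : Fin d => (1 : ℝ))
          (g := fun k => smoothArc (a k) (b k) ε (s k + t * α k)) (fun _ _ => zero_le_one)
          fun k _ => one_le_smoothArc (ha k) (hb k) hε0 (hmem.1 k) (hmem.2 k)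
        simpa using this
      · rw [hf]
        simp only [Set.indicator_of_notMem hmem]
        exact Finset.prod_nonneg fun k _ => smoothArc_nonneg (hab k) hε0 _
    have h3 := prod_add_sub_prod_le (fun k => b k - a k) (fun k => b k - a k + ε)
      (fun k => (hba k).1) (fun k => by linarith) (fun k => by linarith [hba k])
      (ε := ε) (fun k => by linarith)
    have h4 := (mul_le_mul_of_nonneg_left h3 hT.le).trans hscale
    rw [mul_sub] at h4
    linarith

/-- Bounded discrepancy of the linear flow with algebraic direction with respect to the
family of axis-parallel boxes `∏ [a_k, b_k] ⊆ [0,1]^d`. -/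
theorem bounded_discrepancy_of_linear_flow
    {d : ℕ} (hd : 2 ≤ d) (α : Fin d → ℝ)
    (halg : ∀ i, IsAlgebraic ℚ (α i))
    (hli : LinearIndependent ℚ α) :
    ∃ C : ℝ, ∀ s ∈ Set.Icc (0 : Fin d → ℝ) 1,
      ∀ a b : Fin d → ℝ, Set.Icc a b ⊆ Set.Icc 0 1 →
        ∀ T : ℝ, 0 < T → |Delta s α (Set.Icc a b) T| ≤ C := by
  obtain ⟨C, hC0, hC⟩ := exists_sum_inv_le halg hli
  refine ⟨2 ^ d * C + d * 2 ^ d + 2, fun s _ a b hsub T hT => ?_⟩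
  by_cases hab : a ≤ b
  · exact abs_Delta_Icc_le hC0 (fun n hn => sum_int_mul_ne_zero hli hn) hC s
      (fun k => (hsub (Set.left_mem_Icc.2 hab)).1 k) (fun k => (hsub (Set.right_mem_Icc.2 hab)).2 k)
      (fun k => hab k) hT
  · rw [Set.Icc_eq_empty hab]
    simp only [Delta, Set.indicator_empty, intervalIntegral.integral_zero, measure_empty,
      ENNReal.toReal_zero, mul_zero, sub_zero, abs_zero]
    positivity
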